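/- arXiv:2602.18864 — 2 statements merged into one kernel-verified Lean document; each statement's English description precedes it below -/
import Mathlib

section
/- For every positive integer n with n ≡ 2 (mod 4), Φ(6×n,3,1) = 6n − 3; that is, there exists an optimal 2-D (6×n,3,1)-OOC with 6n − 3 codewords, and every 2-D (6×n,3,1)-OOC has at most 6n − 3 codewords. -/
/-- The cyclic shift of a codeword `B ⊆ I_m × Z_n` by `τ`. -/
def OOCshift {m n : ℕ} (B : Finset (Fin m × ZMod n)) (τ : ZMod n) :
    Finset (Fin m × ZMod n) :=
  B.image fun p => (p.1, p.2 + τ)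

/-- A two-dimensional `(m × n, k, lam)` optical orthogonal code: a family of
`k`-element codewords of `I_m × Z_n` with auto- and cross-correlation at most `lam`. -/
def IsOOC (m n k lam : ℕ) (C : Finset (Finset (Fin m × ZMod n))) : Prop :=
  (∀ A ∈ C, A.card = k) ∧
  (∀ A ∈ C, ∀ τ : ZMod n, τ ≠ 0 → (A ∩ OOCshift A τ).card ≤ lam) ∧
  (∀ A ∈ C, ∀ B ∈ C, A ≠ B → ∀ τ : ZMod n, (A ∩ OOCshift B τ).card ≤ lam)

/-- kind of each family: 0 a single block, 1 all nonzero parameters, 2 a half system. -/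
def ty8 : Fin 27 → Fin 3 :=
  ![0, 0, 0, 0, 0, 0, 0, 0, 0, 1, 1, 1, 1, 1, 1, 2, 2, 2, 2, 2, 2, 2, 2, 2, 2, 2, 2]

/-- rows of the three points of each block family. -/
def row8 : Fin 27 → Fin 3 → Fin 6 :=
  ![![0, 1, 3],
    ![0, 2, 4],
    ![0, 3, 5],
    ![0, 4, 5],
    ![1, 2, 5],
    ![1, 3, 4],
    ![1, 4, 5],
    ![2, 3, 4],
    ![2, 3, 5],
    ![0, 2, 5],
    ![0, 3, 5],
    ![0, 3, 4],
    ![1, 2, 4],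
    ![1, 2, 5],
    ![1, 3, 4],
    ![0, 0, 2],
    ![4, 4, 0],
    ![1, 1, 3],
    ![5, 5, 1],
    ![2, 2, 4],
    ![3, 3, 5],
    ![0, 0, 1],
    ![1, 1, 0],
    ![2, 2, 3],
    ![3, 3, 2],
    ![4, 4, 5],
    ![5, 5, 4]]

/-- parities of the three points of each block family. -/
def eps8 : Fin 27 → Fin 3 → ZMod 2 :=
  ![![0, 1, 0],
    ![0, 1, 0],
    ![0, 1, 0],
    ![0, 1, 1],
    ![0, 0, 0],
    ![0, 0, 1],
    ![0, 0, 1],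
    ![0, 0, 0],
    ![0, 1, 1],
    ![0, 1, 0],
    ![0, 0, 1],
    ![0, 1, 1],
    ![0, 0, 1],
    ![0, 1, 1],
    ![0, 1, 0],
    ![0, 0, 0],
    ![0, 0, 0],
    ![0, 0, 0],
    ![0, 0, 0],
    ![0, 0, 0],
    ![0, 0, 0],
    ![0, 1, 0],
    ![0, 1, 0],
    ![0, 1, 0],
    ![0, 1, 0],
    ![0, 1, 0],
    ![0, 1, 0]]

/-- coefficients of the three points of each block family. -/
def coef8 : Fin 27 → Fin 3 → ℤ :=
  ![![0, 0, 0],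
    ![0, 0, 0],
    ![0, 0, 0],
    ![0, 0, 0],
    ![0, 0, 0],
    ![0, 0, 0],
    ![0, 0, 0],
    ![0, 0, 0],
    ![0, 0, 0],
    ![0, 1, 2],
    ![0, 1, 2],
    ![0, 1, 2],
    ![0, 1, 2],
    ![0, 1, 2],
    ![0, 1, 2],
    ![-1, 1, 0],
    ![-1, 1, 0],
    ![-1, 1, 0],
    ![-1, 1, 0],
    ![-1, 1, 0],
    ![-1, 1, 0],
    ![-1, 1, 0],
    ![-1, 1, 0],
    ![-1, 1, 0],
    ![-1, 1, 0],
    ![-1, 1, 0],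
    ![-1, 1, 0]]

/-- the difference coefficient -/
def kd8 (t : Fin 27) (u v : Fin 3) : ℤ := coef8 t v - coef8 t u

lemma finite8 : ∀ t t' : Fin 27, ∀ u v u' v' : Fin 3, u ≠ v → u' ≠ v' →
    row8 t u = row8 t' u' → row8 t v = row8 t' v' →
    eps8 t v - eps8 t u = eps8 t' v' - eps8 t' u' →
    (t = t' ∧ u = u' ∧ v = v') ∨
    (ty8 t = 2 ∧ ty8 t' = 2 ∧ kd8 t u v = - kd8 t' u' v') ∨
    (ty8 t = 0 ∧ ty8 t' ≠ 0) ∨ (ty8 t ≠ 0 ∧ ty8 t' = 0) := by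
  decide +kernel

lemma finite8k : ∀ t : Fin 27, ∀ u v : Fin 3, u ≠ v →
    (ty8 t = 0 ∧ kd8 t u v = 0) ∨ (ty8 t ≠ 0 ∧
      (kd8 t u v = 1 ∨ kd8 t u v = -1 ∨ kd8 t u v = 2 ∨ kd8 t u v = -2)) := by
  decide +kernel

lemma mem_shift8 {m n : ℕ} (B : Finset (Fin m × ZMod n)) (τ : ZMod n) (p q : Fin m × ZMod n)
    (hp : p ∈ B) (h1 : p.1 = q.1) (h2 : p.2 + τ = q.2) : q ∈ OOCshift B τ := by
  unfold OOCshift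
  rw [Finset.mem_image]
  exact ⟨p, hp, by rw [h1, h2]⟩

lemma ooc_of_keys8 {n : ℕ} {ι : Type} (J : Finset ι) (f : ι → Fin 3 → Fin 6 × ZMod n)
    (hinj : ∀ b ∈ J, ∀ c ∈ J, ∀ u v u' v' : Fin 3, u ≠ v → u' ≠ v' →
      (f b u).1 = (f c u').1 → (f b v).1 = (f c v').1 →
      (f b v).2 - (f b u).2 = (f c v').2 - (f c u').2 → b = c ∧ u = u' ∧ v = v') :
    ∃ C : Finset (Finset (Fin 6 × ZMod n)), IsOOC 6 n 3 1 C ∧ C.card = J.card := by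
  classical
  have key : ∀ b ∈ J, ∀ c ∈ J, ∀ τ : ZMod n,
      1 < (Finset.univ.image (f b) ∩ OOCshift (Finset.univ.image (f c)) τ).card →
      b = c ∧ τ = 0 := by
    intro b hb c hc τ hlt
    obtain ⟨p, hp, q, hq, hpq⟩ := Finset.one_lt_card.mp hlt
    simp only [OOCshift, Finset.mem_inter, Finset.mem_image, Finset.mem_univ, true_and] at hp hq
    obtain ⟨⟨u, hu⟩, p', ⟨u', hu'⟩, hp'⟩ := hp
    obtain ⟨⟨v, hv⟩, q', ⟨v', hv'⟩, hq'⟩ := hq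
    subst hu hv hu' hv'
    have huv : u ≠ v := fun h => hpq (by rw [h])
    have huv' : u' ≠ v' := fun h => hpq (by rw [← hp', ← hq', h])
    obtain ⟨h1, h2⟩ := Prod.ext_iff.mp hp'
    obtain ⟨h3, h4⟩ := Prod.ext_iff.mp hq'
    simp only at h1 h2 h3 h4
    obtain ⟨rfl, rfl, rfl⟩ := hinj b hb c hc u v u' v' huv huv' h1.symm h3.symm
      (by rw [← h2, ← h4]; ring)
    exact ⟨rfl, by simpa using h2⟩
  have finj : ∀ b ∈ J, Function.Injective (f b) := by
    intro b hb u v huv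
    by_contra hne
    have := hinj b hb b hb u v v u hne (Ne.symm hne) (by rw [huv]) (by rw [huv]) (by rw [huv])
    exact hne this.2.1
  have hcard : ∀ b ∈ J, (Finset.univ.image (f b)).card = 3 := by
    intro b hb
    rw [Finset.card_image_of_injective _ (finj b hb)]; simp
  have hshift0 : ∀ B : Finset (Fin 6 × ZMod n), OOCshift B 0 = B := by
    intro B; simp [OOCshift]
  refine ⟨J.image fun b => Finset.univ.image (f b), ⟨?_, ?_, ?_⟩, ?_⟩
  · intro A hA
    obtain ⟨b, hb, rfl⟩ := Finset.mem_image.mp hA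
    exact hcard b hb
  · intro A hA τ hτ
    obtain ⟨b, hb, rfl⟩ := Finset.mem_image.mp hA
    by_contra hlt
    exact hτ (key b hb b hb τ (not_le.mp hlt)).2
  · intro A hA B hB hAB τ
    obtain ⟨b, hb, rfl⟩ := Finset.mem_image.mp hA
    obtain ⟨c, hc, rfl⟩ := Finset.mem_image.mp hB
    by_contra hlt
    exact hAB (by rw [(key b hb c hc τ (not_le.mp hlt)).1])
  · apply Finset.card_image_of_injOn
    intro b hb c hc hbc
    refine (key b hb c hc 0 ?_).1
    rw [hshift0]
    simp only at hbc
    rw [← hbc, Finset.inter_self, hcard b hb]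
    norm_num

lemma half8 (r : ℕ) : ∃ P : Finset (ZMod (2 * r + 1)), P.card = r ∧ (0 : ZMod (2*r+1)) ∉ P ∧
    ∀ e ∈ P, ∀ e' ∈ P, e ≠ -e' := by
  classical
  refine ⟨(Finset.Icc 1 r).image (fun k : ℕ => (k : ZMod (2 * r + 1))), ?_, ?_, ?_⟩
  · rw [Finset.card_image_of_injOn]
    · simp
    · intro a ha b hb hab
      simp only [Finset.coe_Icc, Set.mem_Icc] at ha hb
      have := (ZMod.natCast_eq_natCast_iff' a b _).mp hab
      rwa [Nat.mod_eq_of_lt (by omega), Nat.mod_eq_of_lt (by omega)] at this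
  · intro h0
    obtain ⟨k, hk, hk0⟩ := Finset.mem_image.mp h0
    rw [Finset.mem_Icc] at hk
    have := Nat.le_of_dvd (by omega) ((ZMod.natCast_eq_zero_iff k _).mp hk0)
    omega
  · intro e he e' he' hee
    obtain ⟨k, hk, rfl⟩ := Finset.mem_image.mp he
    obtain ⟨l, hl, rfl⟩ := Finset.mem_image.mp he'
    rw [Finset.mem_Icc] at hk hl
    have h0 : ((k + l : ℕ) : ZMod (2 * r + 1)) = 0 := by
      push_cast; rw [hee]; ring
    have := Nat.le_of_dvd (by omega) ((ZMod.natCast_eq_zero_iff _ _).mp h0)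
    omega

lemma two_cancel8 (r : ℕ) (x y : ZMod (2 * r + 1)) (hxy : 2 * x = 2 * y) : x = y := by
  have h0 : (2 * (r : ZMod (2 * r + 1)) + 1) = 0 := by
    have := ZMod.natCast_self (2 * r + 1)
    push_cast at this
    exact this
  linear_combination (x - y) * h0 - (r : ZMod (2 * r + 1)) * hxy

lemma k_cancel8 (r : ℕ) (k : ℤ) (hk : k = 1 ∨ k = -1 ∨ k = 2 ∨ k = -2)
    (x y : ZMod (2 * r + 1)) (hxy : (k : ZMod (2 * r + 1)) * x = k * y) : x = y := by
  rcases hk with rfl | rfl | rfl | rfl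
  · simpa using hxy
  · simpa using hxy
  · exact two_cancel8 r x y (by simpa using hxy)
  · exact two_cancel8 r x y (by simpa using hxy)

lemma exists8 (r : ℕ) : ∃ C : Finset (Finset (Fin 6 × ZMod (2 * (2 * r + 1)))),
    IsOOC 6 (2 * (2 * r + 1)) 3 1 C ∧ C.card = 24 * r + 9 := by
  classical
  obtain ⟨P, hPc, hP0, hPn⟩ := half8 r
  have hco : Nat.Coprime 2 (2 * r + 1) := by simp
  let φ : ZMod 2 × ZMod (2 * r + 1) ≃+* ZMod (2 * (2 * r + 1)) :=
    (ZMod.chineseRemainder hco).symm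
  let S : Fin 27 → Finset (ZMod (2 * r + 1)) := fun t =>
    if ty8 t = 0 then {0} else if ty8 t = 1 then Finset.univ.erase 0 else P
  have hS0 : ∀ t, ty8 t = 0 → ∀ e ∈ S t, e = 0 := by
    intro t ht e he; simpa [S, ht] using he
  have hSn : ∀ t, ty8 t ≠ 0 → ∀ e ∈ S t, e ≠ 0 := by
    intro t ht e he
    by_cases h1 : ty8 t = 1
    · simpa [S, h1] using he
    · simp only [S, ht, h1, if_false] at he
      rintro rfl; exact hP0 he
  have hS2 : ∀ t, ty8 t = 2 → ∀ e ∈ S t, e ∈ P := by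
    intro t ht e he; simpa [S, ht] using he
  obtain ⟨C, hC, hcard⟩ := ooc_of_keys8 (n := 2 * (2 * r + 1))
    ((Finset.univ : Finset (Fin 27)).sigma S)
    (fun b u => (row8 b.1 u, φ (eps8 b.1 u, (coef8 b.1 u : ZMod (2 * r + 1)) * b.2))) (by
      rintro ⟨t, e⟩ hb ⟨t', e'⟩ hc u v u' v' huv huv' h1 h2 h3
      simp only [Finset.mem_sigma, Finset.mem_univ, true_and] at hb hc
      simp only at h1 h2 h3
      rw [← map_sub, ← map_sub] at h3
      have h4 := φ.injective h3
      simp only [Prod.mk_sub_mk, Prod.mk.injEq] at h4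
      obtain ⟨h5, h6⟩ := h4
      have h7 : (kd8 t u v : ZMod (2 * r + 1)) * e = kd8 t' u' v' * e' := by
        unfold kd8; push_cast; linear_combination h6
      have hk := finite8k t u v huv
      have hk' := finite8k t' u' v' huv'
      rcases finite8 t t' u v u' v' huv huv' h1 h2 h5 with ⟨rfl, rfl, rfl⟩ | ⟨a, b, c⟩ |
        ⟨a, b⟩ | ⟨a, b⟩
      · have : e = e' := by
          rcases hk with ⟨z, _⟩ | ⟨_, z⟩
          · rw [hS0 t z e hb, hS0 t z e' hc]
          · exact k_cancel8 r _ z _ _ h7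
        subst this
        exact ⟨rfl, rfl, rfl⟩
      · exfalso
        rcases hk' with ⟨z, _⟩ | ⟨_, z⟩
        · rw [b] at z; exact absurd z (by decide)
        · rw [c] at h7
          refine hPn e (hS2 t a e hb) e' (hS2 t' b e' hc) (k_cancel8 r _ z _ _ ?_)
          push_cast at h7
          linear_combination -h7
      · exfalso
        rcases hk' with ⟨z, _⟩ | ⟨_, z⟩
        · exact b z
        · refine hSn t' b e' hc (k_cancel8 r _ z _ _ ?_)
          rw [← h7, hS0 t a e hb]; ring
      · exfalso
        rcases hk with ⟨z, _⟩ | ⟨_, z⟩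
        · exact a z
        · refine hSn t a e hb (k_cancel8 r _ z _ _ ?_)
          rw [h7, hS0 t' b e' hc]; ring)
  refine ⟨C, hC, ?_⟩
  rw [hcard, Finset.card_sigma]
  have hSc : ∀ t, (S t).card = if ty8 t = 0 then 1 else if ty8 t = 1 then 2 * r else r := by
    intro t
    simp only [S]
    split_ifs
    · simp
    · rw [Finset.card_erase_of_mem (Finset.mem_univ _), Finset.card_univ, ZMod.card]; rfl
    · exact hPc
  simp only [hSc]
  have e0 : (Finset.univ.filter fun t : Fin 27 => ty8 t = 0).card = 9 := by decide +kernel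
  have e1 : ((Finset.univ.filter fun t : Fin 27 => ¬ ty8 t = 0).filter
    fun t => ty8 t = 1).card = 6 := by decide +kernel
  have e2 : ((Finset.univ.filter fun t : Fin 27 => ¬ ty8 t = 0).filter
    fun t => ¬ ty8 t = 1).card = 12 := by decide +kernel
  rw [Finset.sum_ite, Finset.sum_ite, Finset.sum_const, Finset.sum_const, Finset.sum_const,
    e0, e1, e2]
  simp only [smul_eq_mul]
  ring

lemma tri_parity8 {α : Type} [DecidableEq α] (A : Finset α) (hA : A.card = 3) (g : α → ZMod 2) :
    4 ∣ (A.offDiag.filter fun x => g x.2 - g x.1 = 1).card := by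
  obtain ⟨a, b, c, hab, hac, hbc, rfl⟩ := Finset.card_eq_three.mp hA
  have h1 : (({a, b, c} : Finset α).offDiag.filter fun x => g x.2 - g x.1 = 1) =
      (({a, b, c} : Finset α) ×ˢ {a, b, c}).filter fun x => g x.2 - g x.1 = 1 := by
    ext ⟨x, y⟩
    simp only [Finset.mem_filter, Finset.mem_offDiag, Finset.mem_product]
    constructor
    · rintro ⟨⟨h1, h2, _⟩, h3⟩; exact ⟨⟨h1, h2⟩, h3⟩
    · rintro ⟨⟨h1, h2⟩, h3⟩
      refine ⟨⟨h1, h2, ?_⟩, h3⟩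
      rintro rfl
      simp at h3
  rw [h1, Finset.card_filter, Finset.sum_product]
  have hb : a ∉ ({b, c} : Finset α) := by simp [hab, hac]
  have hc : b ∉ ({c} : Finset α) := by simp [hbc]
  simp only [Finset.sum_insert hb, Finset.sum_insert hc, Finset.sum_singleton]
  generalize g a = x
  generalize g b = y
  generalize g c = z
  revert x y z
  decide

lemma upper8 (n r : ℕ) (hn : n = 2 * (2 * r + 1)) (C : Finset (Finset (Fin 6 × ZMod n)))
    (hC : IsOOC 6 n 3 1 C) : C.card ≤ 24 * r + 9 := by
  classical
  obtain ⟨h3, hauto, hcross⟩ := hC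
  have : NeZero n := ⟨by omega⟩
  let w : ZMod n := ((2 * r + 1 : ℕ) : ZMod n)
  have hw0 : w ≠ 0 := by
    intro h0
    have := Nat.le_of_dvd (by omega) ((ZMod.natCast_eq_zero_iff _ _).mp h0)
    omega
  have hww : w + w = 0 := by
    have : ((n : ℕ) : ZMod n) = 0 := ZMod.natCast_self n
    rw [← this]
    simp only [w]
    rw [← Nat.cast_add]
    congr 1
    omega
  let π : ZMod n →+* ZMod 2 := ZMod.castHom (Dvd.intro _ hn.symm) (ZMod 2)
  have hπw : π w = 1 := by
    simp only [w, map_natCast]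
    push_cast
    have : (2 : ZMod 2) = 0 := rfl
    rw [this]; ring
  let T : Finset (Σ _ : Finset (Fin 6 × ZMod n), (Fin 6 × ZMod n) × (Fin 6 × ZMod n)) :=
    C.sigma fun A => A.offDiag
  let F : (Σ _ : Finset (Fin 6 × ZMod n), (Fin 6 × ZMod n) × (Fin 6 × ZMod n)) →
      (Σ _ : Fin 6 × Fin 6, ZMod n) := fun x => ⟨(x.2.1.1, x.2.2.1), x.2.2.2 - x.2.1.2⟩
  let K : Finset (Σ _ : Fin 6 × Fin 6, ZMod n) := Finset.univ.sigma fun ij =>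
    if ij.1 = ij.2 then (Finset.univ.erase 0).erase w else Finset.univ
  have two : ∀ (A B : Finset (Fin 6 × ZMod n)) (τ : ZMod n) (p q : Fin 6 × ZMod n), p ≠ q →
      p ∈ A → q ∈ A → p ∈ OOCshift B τ → q ∈ OOCshift B τ →
      ¬ (A ∩ OOCshift B τ).card ≤ 1 := by
    intro A B τ p q hpq h1 h2 h3 h4
    rw [not_le, Finset.one_lt_card]
    exact ⟨p, Finset.mem_inter.mpr ⟨h1, h3⟩, q, Finset.mem_inter.mpr ⟨h2, h4⟩, hpq⟩
  have hmaps : ∀ x ∈ T, F x ∈ K := by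
    rintro ⟨A, p, q⟩ hx
    simp only [T, Finset.mem_sigma, Finset.mem_offDiag] at hx
    obtain ⟨hA, hp, hq, hpq⟩ := hx
    simp only [F, K, Finset.mem_sigma, Finset.mem_univ, true_and]
    split_ifs with hi
    · simp only [Finset.mem_erase, Finset.mem_univ, and_true]
      refine ⟨fun hd => ?_, fun hd => ?_⟩
      · refine two A A w p q hpq hp hq (mem_shift8 _ _ q p hq hi.symm ?_)
          (mem_shift8 _ _ p q hp hi ?_) (hauto A hA w hw0)
        · linear_combination hd + hww
        · linear_combination -hd
      · exact hpq (Prod.ext hi (by linear_combination -hd))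
    · simp
  have hinj : Set.InjOn F T := by
    rintro ⟨A, p, q⟩ hx ⟨B, p', q'⟩ hy hxy
    simp only [T, Finset.coe_sigma, Set.mem_sigma_iff, Finset.mem_coe, Finset.mem_offDiag] at hx hy
    obtain ⟨hA, hp, hq, hpq⟩ := hx
    obtain ⟨hB, hp', hq', hpq'⟩ := hy
    simp only [F, Sigma.mk.injEq, Prod.mk.injEq, heq_eq_eq] at hxy
    obtain ⟨⟨hr1, hr2⟩, hd⟩ := hxy
    have hno := two A B (p.2 - p'.2) p q hpq hp hq
      (mem_shift8 _ _ p' p hp' hr1.symm (by ring))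
      (mem_shift8 _ _ q' q hq' hr2.symm (by linear_combination -hd))
    have hAB : A = B := by
      by_contra hne
      exact hno (hcross A hA B hB hne _)
    subst hAB
    have hτ : p.2 - p'.2 = 0 := by
      by_contra hne
      exact hno (hauto A hA _ hne)
    have e1 : p = p' := Prod.ext hr1 (by linear_combination hτ)
    have e2 : q = q' := Prod.ext hr2 (by linear_combination hτ + hd)
    rw [e1, e2]
  have hT : T.card = 6 * C.card := by
    simp only [T]
    rw [Finset.card_sigma, Finset.sum_congr rfl (g := fun _ => 6), Finset.sum_const, smul_eq_mul,
      mul_comm]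
    intro A hA
    rw [Finset.offDiag_card, h3 A hA]
  have d1 : (Finset.univ.filter fun ij : Fin 6 × Fin 6 => ij.1 = ij.2).card = 6 := by decide
  have d2 : (Finset.univ.filter fun ij : Fin 6 × Fin 6 => ¬ ij.1 = ij.2).card = 30 := by decide
  have hK : K.card = 6 * (n - 2) + 30 * n := by
    simp only [K]
    rw [Finset.card_sigma]
    have : ∀ ij : Fin 6 × Fin 6,
        (if ij.1 = ij.2 then (Finset.univ.erase (0 : ZMod n)).erase w else Finset.univ).card =
        if ij.1 = ij.2 then n - 2 else n := by
      intro ij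
      split_ifs
      · rw [Finset.card_erase_of_mem (by simp [hw0]), Finset.card_erase_of_mem (by simp),
          Finset.card_univ, ZMod.card]
        omega
      · rw [Finset.card_univ, ZMod.card]
    simp only [this]
    rw [Finset.sum_ite, Finset.sum_const, Finset.sum_const, d1, d2]
    rfl
  have hle : T.card ≤ K.card := Finset.card_le_card_of_injOn F hmaps hinj
  by_contra hgt
  have heq : T.card = K.card := by omega
  have himg : T.image F = K := by
    apply Finset.eq_of_subset_of_card_le
    · intro y hy
      obtain ⟨x, hx, rfl⟩ := Finset.mem_image.mp hy
      exact hmaps x hx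
    · rw [Finset.card_image_of_injOn hinj, heq]
  have hodd : (Finset.univ.filter fun d : ZMod n => π d = 1).card = 2 * r + 1 := by
    have hs : (Finset.univ.filter fun d : ZMod n => π d = 1).card =
        (Finset.univ.filter fun d : ZMod n => ¬ π d = 1).card := by
      apply Finset.card_bij (fun d _ => d + 1)
      · intro d hd
        simp only [Finset.mem_filter, Finset.mem_univ, true_and] at hd ⊢
        rw [map_add, hd, map_one]; decide
      · intro a _ b _ hab; exact add_right_cancel hab
      · intro d hd
        simp only [Finset.mem_filter, Finset.mem_univ, true_and] at hd ⊢
        refine ⟨d - 1, ?_, by ring⟩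
        rw [map_sub, map_one]
        revert hd
        generalize π d = z
        revert z
        decide
    have hsum := Finset.card_filter_add_card_filter_not (s := (Finset.univ : Finset (ZMod n)))
      (fun d : ZMod n => π d = 1)
    rw [← hs, Finset.card_univ, ZMod.card] at hsum
    omega
  have hKodd : (K.filter fun y => π y.2 = 1).card = 6 * (2 * r) + 30 * (2 * r + 1) := by
    have : (K.filter fun y => π y.2 = 1) = Finset.univ.sigma fun ij : Fin 6 × Fin 6 =>
        if ij.1 = ij.2 then (Finset.univ.filter fun d : ZMod n => π d = 1).erase w
        else Finset.univ.filter fun d : ZMod n => π d = 1 := by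
      ext ⟨ij, d⟩
      simp only [K, Finset.mem_filter, Finset.mem_sigma, Finset.mem_univ, true_and]
      split_ifs
      · simp only [Finset.mem_erase, Finset.mem_filter, Finset.mem_univ, true_and, and_true]
        constructor
        · rintro ⟨⟨a, _⟩, b⟩; exact ⟨a, b⟩
        · rintro ⟨a, b⟩
          refine ⟨⟨a, ?_⟩, b⟩
          rintro rfl
          rw [map_zero] at b
          exact absurd b (by decide)
      · simp
    rw [this, Finset.card_sigma]
    have : ∀ ij : Fin 6 × Fin 6,
        (if ij.1 = ij.2 then (Finset.univ.filter fun d : ZMod n => π d = 1).erase w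
          else Finset.univ.filter fun d : ZMod n => π d = 1).card =
        if ij.1 = ij.2 then 2 * r else 2 * r + 1 := by
      intro ij
      split_ifs
      · rw [Finset.card_erase_of_mem (by simp [hπw]), hodd]; rfl
      · exact hodd
    simp only [this]
    rw [Finset.sum_ite, Finset.sum_const, Finset.sum_const, d1, d2]
    rfl
  have hTodd : 4 ∣ (K.filter fun y => π y.2 = 1).card := by
    rw [← himg, Finset.filter_image, Finset.card_image_of_injOn
      (hinj.mono (by intro x hx; exact Finset.mem_of_mem_filter x hx))]
    have : (T.filter fun x => π (F x).2 = 1) = C.sigma fun A =>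
        A.offDiag.filter fun x => π x.2.2 - π x.1.2 = 1 := by
      ext ⟨A, p, q⟩
      simp only [T, F, Finset.mem_filter, Finset.mem_sigma, map_sub, and_assoc]
    rw [this, Finset.card_sigma]
    apply Finset.dvd_sum
    intro A hA
    exact tri_parity8 A (h3 A hA) (fun p => π p.2)
  omega

theorem stmt_8 (n : ℕ) (hn : 0 < n) (h : n % 4 = 2) :
    (∃ C : Finset (Finset (Fin 6 × ZMod n)), IsOOC 6 n 3 1 C ∧ C.card = 6 * n - 3) ∧
    (∀ C : Finset (Finset (Fin 6 × ZMod n)), IsOOC 6 n 3 1 C → C.card ≤ 6 * n - 3) := by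
  obtain ⟨r, rfl⟩ : ∃ r, n = 2 * (2 * r + 1) := ⟨n / 4, by omega⟩
  have e : 6 * (2 * (2 * r + 1)) - 3 = 24 * r + 9 := by omega
  rw [e]
  exact ⟨exists8 r, upper8 _ r rfl⟩
end

section
/- Let m, g, n be positive integers with g dividing n. If n − g ≡ 0 (mod 6), n ≥ 4g, and n/g ≢ 2, 3 (mod 4) whenever g ≡ 2 (mod 4), then there exists a g-regular 2-D (m×n,3,1)-OOC with Υ(m,0,n,g,3) = m²(n−g)/6 codewords. -/
/-- The multiset `Δ_{ij}(C)` of all (pure and mixed) `(i,j)`-differences of the family `C`. -/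
def Delta {m n : ℕ} (i j : Fin m) (C : Finset (Finset (Fin m × ZMod n))) :
    Multiset (ZMod n) :=
  ∑ B ∈ C, (((B ×ˢ B).filter fun p => p.1 ≠ p.2 ∧ p.1.1 = i ∧ p.2.1 = j).val.map
      fun p => p.1.2 - p.2.2)

/-- A `g`-regular 2-D `([m : r] × n, k, 1)`-OOC with hole `R × Z_n` (`r = R.card`):
for `{i,j} ⊄ R` the multiset `Δ_{ij}(C)` is exactly `Z_n \ H` (each element once), where
`H = {z : g • z = 0}` is the subgroup of order `g` of `Z_n`, and `Δ_{ij}(C) = ∅` otherwise. -/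
def IsGRegOOC {m n : ℕ} (k g : ℕ) (R : Finset (Fin m))
    (C : Finset (Finset (Fin m × ZMod n))) : Prop :=
  (∀ A ∈ C, A.card = k) ∧
  ∀ i j : Fin m, ∀ z : ZMod n,
    Multiset.count z (Delta i j C) =
      if i ∈ R ∧ j ∈ R then 0 else if g • z = 0 then 0 else 1

/-! ### Coverings by difference triples -/

/-- the six differences of the triple `(a, b, a+b)` -/
def Hit (n : ℤ) (p : ℤ × ℤ) (z : ℤ) : Prop :=
  (n ∣ z - p.1 ∨ n ∣ z + p.1) ∨ (n ∣ z - p.2 ∨ n ∣ z + p.2) ∨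
    (n ∣ z - (p.1 + p.2) ∨ n ∣ z + (p.1 + p.2))

/-- at most `t` triples cover the set `S` modulo `n` -/
def Cov (n : ℤ) (S : ℤ → Prop) (t : ℕ) : Prop :=
  ∃ L : List (ℤ × ℤ), L.length ≤ t ∧ ∀ z, S z → ∃ p ∈ L, Hit n p z

def PP (g w : ℕ) : Prop :=
  Cov ((g * w : ℕ) : ℤ) (fun z => ¬ (w : ℤ) ∣ z) (g * (w - 1) / 6)

theorem exact_of_cov {m n g t : ℕ} [NeZero n] [NeZero m]
    (hg : 0 < g) (ht : 6 * t + g = n)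
    (L : List (ℤ × ℤ)) (hL : L.length ≤ t)
    (hc : ∀ z : ℤ, (g • (z : ZMod n) ≠ 0) → ∃ p ∈ L, Hit n p z) :
    ∃ C : Finset (Finset (Fin m × ZMod n)),
      IsGRegOOC 3 g (∅ : Finset (Fin m)) C ∧ C.card = m ^ 2 * t := by
  classical
  let blk : Fin L.length × Fin m × Fin m → Finset (Fin m × ZMod n) := fun x =>
    {(x.2.1, 0), (x.2.2, ((L.get x.1).1 : ZMod n)),
      (x.2.1 + x.2.2, (((L.get x.1).1 + (L.get x.1).2 : ℤ) : ZMod n))}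
  let C : Finset (Finset (Fin m × ZMod n)) := Finset.univ.image blk
  have hCcard : C.card ≤ m ^ 2 * t := by
    refine Finset.card_image_le.trans ?_
    simp only [Finset.card_univ, Fintype.card_prod, Fintype.card_fin]
    nlinarith [Nat.mul_le_mul_right (m*m) hL]
  have hB3 : ∀ B ∈ C, B.card ≤ 3 := by
    intro B hB
    obtain ⟨x, -, rfl⟩ := Finset.mem_image.1 hB
    exact Finset.card_le_three
  let F : Fin m × Fin m × ZMod n → ℕ := fun x => Multiset.count x.2.2 (Delta x.1 x.2.1 C)
  let G : Fin m × Fin m × ZMod n → ℕ := fun x => if g • x.2.2 = 0 then 0 else 1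
  -- pointwise bound
  have key : ∀ (B : Finset (Fin m × ZMod n)), B ∈ C → ∀ p ∈ B, ∀ q ∈ B, p ≠ q →
      ∀ i j z, p.1 = i → q.1 = j → p.2 - q.2 = z → 1 ≤ Multiset.count z (Delta i j C) := by
    rintro B hB p hp q hq hpq i j z rfl rfl rfl
    rw [Multiset.one_le_count_iff_mem, Delta, Multiset.mem_sum]
    refine ⟨B, hB, ?_⟩
    rw [Multiset.mem_map]
    refine ⟨(p, q), ?_, rfl⟩
    rw [Finset.mem_val, Finset.mem_filter, Finset.mem_product]
    exact ⟨⟨hp, hq⟩, hpq, rfl, rfl⟩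
  have hGF : ∀ x ∈ (Finset.univ : Finset (Fin m × Fin m × ZMod n)), G x ≤ F x := by
    rintro ⟨i, j, z⟩ -
    simp only [G, F]
    split_ifs with hz
    · exact Nat.zero_le _
    have hz0 : z ≠ 0 := by
      rintro rfl; simp at hz
    obtain ⟨z', rfl⟩ : ∃ z' : ℤ, (z' : ZMod n) = z := ZMod.intCast_surjective z
    obtain ⟨p, hp, hh⟩ := hc z' hz
    obtain ⟨l, rfl⟩ := List.mem_iff_get.1 hp
    have hmem : ∀ a b : Fin m, blk (l, a, b) ∈ C := fun a b =>
      Finset.mem_image_of_mem _ (Finset.mem_univ _)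
    have e1 : ∀ x : ℤ, (n : ℤ) ∣ z' - x → (z' : ZMod n) = (x : ZMod n) := by
      intro x h
      have := (ZMod.intCast_zmod_eq_zero_iff_dvd (z' - x) n).2 h
      push_cast at this
      exact sub_eq_zero.1 this
    have e2 : ∀ x : ℤ, (n : ℤ) ∣ z' + x → (z' : ZMod n) = -(x : ZMod n) := by
      intro x h
      have := (ZMod.intCast_zmod_eq_zero_iff_dvd (z' + x) n).2 h
      push_cast at this
      exact eq_neg_of_add_eq_zero_left this
    have ne : ∀ p q : Fin m × ZMod n, p.2 - q.2 = (z' : ZMod n) → p ≠ q := by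
      rintro p q h rfl
      exact hz0 (by rw [← h, sub_self])
    have fin : ∀ a b, ∀ p ∈ blk (l, a, b), ∀ q ∈ blk (l, a, b), p.1 = i → q.1 = j →
        p.2 - q.2 = (z' : ZMod n) → 1 ≤ Multiset.count (z' : ZMod n) (Delta i j C) := by
      intro a b p hp q hq h1 h2 h3
      exact key _ (hmem a b) p hp q hq (ne p q h3) i j _ h1 h2 h3
    rcases hh with (h | h) | (h | h) | (h | h)
    · have := e1 _ h
      exact fin j i (i, ((L.get l).1 : ZMod n)) (by simp [blk]) (j, 0) (by simp [blk]) rfl rfl (by rw [this]; simp)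
    · have := e2 _ h
      exact fin i j (i, 0) (by simp [blk]) (j, ((L.get l).1 : ZMod n)) (by simp [blk]) rfl rfl (by rw [this]; simp)
    · have := e1 _ h
      exact fin (i - j) j (i, (((L.get l).1 + (L.get l).2 : ℤ) : ZMod n)) (by simp [blk])
        (j, ((L.get l).1 : ZMod n)) (by simp [blk]) rfl rfl (by rw [this]; simp)
    · have := e2 _ h
      exact fin (j - i) i (i, ((L.get l).1 : ZMod n)) (by simp [blk])
        (j, (((L.get l).1 + (L.get l).2 : ℤ) : ZMod n)) (by simp [blk]) rfl rfl
        (by rw [this]; simp)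
    · have := e1 _ h
      exact fin j (i - j) (i, (((L.get l).1 + (L.get l).2 : ℤ) : ZMod n)) (by simp [blk])
        (j, 0) (by simp [blk]) rfl rfl (by rw [this]; simp)
    · have := e2 _ h
      exact fin i (j - i) (i, 0) (by simp [blk])
        (j, (((L.get l).1 + (L.get l).2 : ℤ) : ZMod n)) (by simp [blk]) rfl rfl
        (by rw [this]; simp)
  have hGsum : m ^ 2 * (6 * t) ≤ ∑ x, G x := by
    have h1 : (Finset.univ.filter fun z : ZMod n => g • z = 0).card ≤ g := by
      exact IsAddCyclic.card_nsmul_eq_zero_le hg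
    have h2 := Finset.card_filter_add_card_filter_not (s := (Finset.univ : Finset (ZMod n)))
      (p := fun z : ZMod n => g • z = 0)
    rw [Finset.card_univ, ZMod.card] at h2
    have h3 : ∑ z : ZMod n, (if g • z = 0 then 0 else 1 : ℕ) =
        (Finset.univ.filter fun z : ZMod n => ¬ g • z = 0).card := by
      rw [Finset.card_filter]
      refine Finset.sum_congr rfl fun z _ => ?_
      split_ifs <;> simp_all
    have h4 : ∑ x, G x = m ^ 2 * (Finset.univ.filter fun z : ZMod n => ¬ g • z = 0).card := by
      rw [Fintype.sum_prod_type]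
      simp only [Fintype.sum_prod_type, G, h3]
      simp [sq, mul_assoc]
    rw [h4]
    exact Nat.mul_le_mul_left _ (by omega)
  have hFsum : ∑ x, F x = ∑ B ∈ C, (B.card * B.card - B.card) := by
    have h1 : ∀ i j, ∑ z : ZMod n, Multiset.count z (Delta i j C) =
        ∑ B ∈ C, ((B ×ˢ B).filter fun p => p.1 ≠ p.2 ∧ p.1.1 = i ∧ p.2.1 = j).card := by
      intro i j
      rw [Multiset.sum_count_eq_card (fun _ _ => Finset.mem_univ _), Delta, Multiset.card_sum]
      refine Finset.sum_congr rfl fun B _ => ?_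
      rw [Multiset.card_map]; rfl
    rw [Fintype.sum_prod_type]
    simp only [Fintype.sum_prod_type, F, h1]
    rw [← Fintype.sum_prod_type' (f := fun i j => ∑ B ∈ C,
      ((B ×ˢ B).filter fun p => p.1 ≠ p.2 ∧ p.1.1 = i ∧ p.2.1 = j).card), Finset.sum_comm]
    refine Finset.sum_congr rfl fun B _ => ?_
    rw [← Finset.offDiag_card, Finset.card_eq_sum_card_fiberwise
      (f := fun p => (p.1.1, p.2.1)) (t := Finset.univ) (fun _ _ => Finset.mem_univ _)]
    refine Finset.sum_congr rfl fun x _ => ?_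
    congr 1
    ext ⟨p, q⟩
    simp only [Finset.mem_filter, Finset.mem_product, Finset.mem_offDiag, Prod.ext_iff]
    tauto
  have hb : ∀ B ∈ C, B.card * B.card - B.card ≤ 6 := by
    intro B hB
    have := hB3 B hB
    interval_cases B.card <;> norm_num
  have hFle : ∑ x, F x ≤ C.card * 6 := by
    rw [hFsum]
    exact (Finset.sum_le_sum hb).trans (by simp)
  have hle := Finset.sum_le_sum hGF
  have hCeq : C.card = m ^ 2 * t := by
    apply le_antisymm hCcard
    have : m ^ 2 * (6 * t) = (m ^ 2 * t) * 6 := by ring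
    omega
  have hFG : ∑ x, F x = ∑ x, G x := by
    have : m ^ 2 * (6 * t) = (m ^ 2 * t) * 6 := by ring
    rw [hCeq] at hFle
    omega
  refine ⟨C, ⟨?_, ?_⟩, hCeq⟩
  · have h6 : ∑ B ∈ C, (B.card * B.card - B.card) = ∑ B ∈ C, 6 := by
      rw [← hFsum]
      simp only [Finset.sum_const, smul_eq_mul]
      have : m ^ 2 * (6 * t) = (m ^ 2 * t) * 6 := by ring
      rw [hCeq] at hFle ⊢
      omega
    intro B hB
    have h7 := (Finset.sum_eq_sum_iff_of_le hb).1 h6 B hB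
    have := hB3 B hB
    interval_cases h : B.card <;> simp_all
  · intro i j z
    have := (Finset.sum_eq_sum_iff_of_le hGF).1 hFG.symm (i, j, z) (Finset.mem_univ _)
    simp only [Finset.notMem_empty, false_and, if_false]
    exact this.symm

theorem final_of_PP {m g w n : ℕ} (hm : 0 < m) (hg : 0 < g) (hw : 0 < w) (hn : n = g * w)
    (h6 : (n - g) % 6 = 0) (h : PP g w) :
    ∃ C : Finset (Finset (Fin m × ZMod n)),
      IsGRegOOC 3 g (∅ : Finset (Fin m)) C ∧ C.card = m ^ 2 * (n - g) / 6 := by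
  have hn0 : 0 < n := hn ▸ Nat.mul_pos hg hw
  haveI : NeZero n := ⟨hn0.ne'⟩
  haveI : NeZero m := ⟨hm.ne'⟩
  obtain ⟨L, hL, hc⟩ := h
  have e : g * (w - 1) = n - g := by rw [hn, Nat.mul_sub, mul_one]
  have hgn : g ≤ n := by rw [hn]; exact Nat.le_mul_of_pos_right g hw
  rw [e] at hL
  obtain ⟨C, h1, h2⟩ := exact_of_cov (m := m) (n := n) (g := g) (t := (n - g) / 6) hg (by omega)
    L hL (by
      intro z hz
      rw [← hn] at hc
      refine hc z ?_
      rintro ⟨y, rfl⟩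
      apply hz
      rw [nsmul_eq_mul]
      have : ((g : ZMod n)) * (((w : ℤ) * y : ℤ) : ZMod n) = ((n : ℕ) : ZMod n) * (y : ZMod n) := by
        rw [hn]; push_cast; ring
      rw [this, ZMod.natCast_self, zero_mul])
  refine ⟨C, h1, ?_⟩
  rw [h2]
  obtain ⟨q, hq⟩ := Nat.dvd_of_mod_eq_zero h6
  rw [hq, Nat.mul_div_cancel_left _ (by norm_num)]
  rw [show m ^ 2 * (6 * q) = 6 * (m ^ 2 * q) by ring, Nat.mul_div_cancel_left _ (by norm_num)]

theorem Cov.mono {n : ℤ} {S S' : ℤ → Prop} {t t' : ℕ} (h : Cov n S t) (hS : ∀ z, S' z → S z)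
    (ht : t ≤ t') : Cov n S' t' := by
  obtain ⟨L, hL, hc⟩ := h
  exact ⟨L, hL.trans ht, fun z hz => hc z (hS z hz)⟩

theorem Cov.union {n : ℤ} {S S' : ℤ → Prop} {t t' : ℕ} (h : Cov n S t) (h' : Cov n S' t') :
    Cov n (fun z => S z ∨ S' z) (t + t') := by
  obtain ⟨L, hL, hc⟩ := h
  obtain ⟨L', hL', hc'⟩ := h'
  refine ⟨L ++ L', by rw [List.length_append]; omega, ?_⟩
  rintro z (hz | hz)
  · obtain ⟨p, hp, hh⟩ := hc z hz
    exact ⟨p, List.mem_append_left _ hp, hh⟩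
  · obtain ⟨p, hp, hh⟩ := hc' z hz
    exact ⟨p, List.mem_append_right _ hp, hh⟩

theorem dvd_map {n n' c y z a : ℤ} (hc : n' ∣ n * c) (hz : n' ∣ z - c * y) (h : n ∣ y - a) :
    n' ∣ z - c * a := by
  have h1 : n' ∣ c * (y - a) := by
    refine hc.trans ?_
    rw [mul_comm]
    exact mul_dvd_mul_left c h
  have := dvd_add hz h1
  have e : z - c * y + c * (y - a) = z - c * a := by ring
  rwa [e] at this

theorem Cov.hom {n n' c : ℤ} {S : ℤ → Prop} {t : ℕ} (h : Cov n S t) (hc : n' ∣ n * c) :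
    Cov n' (fun z => ∃ y, S y ∧ n' ∣ z - c * y) t := by
  obtain ⟨L, hL, hL'⟩ := h
  refine ⟨L.map fun p => (c * p.1, c * p.2), by simpa using hL, ?_⟩
  rintro z ⟨y, hy, hz⟩
  obtain ⟨p, hp, hh⟩ := hL' y hy
  refine ⟨_, List.mem_map_of_mem hp, ?_⟩
  have f1 : ∀ a, n ∣ y - a → n' ∣ z - c * a := fun a => dvd_map hc hz
  have f2 : ∀ a, n ∣ y + a → n' ∣ z + c * a := by
    intro a h
    have := f1 (-a) (by simpa using h)
    simpa using this
  simp only [Hit, ← mul_add]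
  rcases hh with (h | h) | (h | h) | (h | h)
  · exact Or.inl (Or.inl (f1 _ h))
  · exact Or.inl (Or.inr (f2 _ h))
  · exact Or.inr (Or.inl (Or.inl (f1 _ h)))
  · exact Or.inr (Or.inl (Or.inr (f2 _ h)))
  · exact Or.inr (Or.inr (Or.inl (f1 _ h)))
  · exact Or.inr (Or.inr (Or.inr (f2 _ h)))

/-- odd lifts -/
theorem Cov.lift_odd {n : ℤ} {S : ℤ → Prop} {t u : ℕ} (h : Cov n S t) (hu : u % 2 = 1) :
    Cov (u * n) S (u * t) := by
  obtain ⟨L, hL, hL'⟩ := h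
  refine ⟨L.flatMap fun p => (List.range u).map fun i : ℕ => (p.1 + n * (i : ℤ), p.2 + n * (i : ℤ)), ?_, ?_⟩
  · have : (L.flatMap fun p => (List.range u).map fun i : ℕ =>
        (p.1 + n * (i : ℤ), p.2 + n * (i : ℤ))).length = L.length * u := by
      simp [List.length_flatMap]
    rw [this, mul_comm]
    exact Nat.mul_le_mul_left u hL
  intro z hz
  obtain ⟨p, hp, hh⟩ := hL' z hz
  have hu0 : (0 : ℤ) < u := by omega
  have mem : ∀ x : ℤ, (p.1 + n * (x % u), p.2 + n * (x % u)) ∈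
      L.flatMap fun p => (List.range u).map fun i : ℕ => (p.1 + n * (i : ℤ), p.2 + n * (i : ℤ)) := by
    intro x
    rw [List.mem_flatMap]
    refine ⟨p, hp, List.mem_map.2 ⟨(x % u).toNat, ?_, ?_⟩⟩
    · rw [List.mem_range]
      have := Int.emod_lt_of_pos x hu0
      have := Int.emod_nonneg x hu0.ne'
      omega
    · have := Int.emod_nonneg x hu0.ne'
      rw [Int.toNat_of_nonneg this]
  obtain ⟨v, hv⟩ : ∃ v : ℤ, (u : ℤ) = 2 * v + 1 := ⟨u / 2, by omega⟩
  rcases hh with (⟨x, h⟩ | ⟨x, h⟩) | (⟨x, h⟩ | ⟨x, h⟩) | (⟨x, h⟩ | ⟨x, h⟩)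
  · refine ⟨_, mem x, Or.inl (Or.inl ⟨x / u, ?_⟩)⟩
    have := Int.emod_add_mul_ediv x u
    simp only
    linear_combination h + n * (-this)
  · refine ⟨_, mem (-x), Or.inl (Or.inr ⟨-((-x) / u), ?_⟩)⟩
    have := Int.emod_add_mul_ediv (-x) u
    simp only
    linear_combination h + n * (this)
  · refine ⟨_, mem x, Or.inr (Or.inl (Or.inl ⟨x / u, ?_⟩))⟩
    have := Int.emod_add_mul_ediv x u
    simp only
    linear_combination h + n * (-this)
  · refine ⟨_, mem (-x), Or.inr (Or.inl (Or.inr ⟨-((-x) / u), ?_⟩))⟩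
    have := Int.emod_add_mul_ediv (-x) u
    simp only
    linear_combination h + n * (this)
  · refine ⟨_, mem (x * (v + 1)), Or.inr (Or.inr (Or.inl ⟨2 * (x * (v + 1) / u) - x, ?_⟩))⟩
    have := Int.emod_add_mul_ediv (x * (v + 1)) u
    simp only
    linear_combination h + 2 * n * (-this) + n * x * hv
  · refine ⟨_, mem (-x * (v + 1)), Or.inr (Or.inr (Or.inr ⟨-2 * (-x * (v + 1) / u) - x, ?_⟩))⟩
    have := Int.emod_add_mul_ediv (-x * (v + 1)) u
    simp only
    linear_combination h + 2 * n * (this) + n * x * hv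

theorem PP.lift_odd {g w u : ℕ} (h : PP g w) (hu : u % 2 = 1) : PP (u * g) w := by
  have := Cov.lift_odd h hu
  unfold PP
  have e : ((u * g * w : ℕ) : ℤ) = (u : ℤ) * ((g * w : ℕ) : ℤ) := by push_cast; ring
  rw [e]
  refine this.mono (fun _ h => h) ?_
  rw [mul_assoc]
  exact Nat.mul_div_le_mul_div_assoc u _ 6

theorem PP.one (g : ℕ) : PP g 1 := ⟨[], by simp, fun z hz => (hz (one_dvd _)).elim⟩

theorem PP.comp {g w1 w2 : ℕ} (h1 : PP (g * w1) w2) (h2 : PP g w1) (hw1 : 0 < w1) (hw2 : 0 < w2) :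
    PP g (w1 * w2) := by
  unfold PP at *
  have h2' := Cov.hom (n' := ((g * (w1 * w2) : ℕ) : ℤ)) (c := w2) h2 (by push_cast; exact ⟨1, by ring⟩)
  rw [mul_assoc] at h1
  refine (h1.union h2').mono ?_ ?_
  · intro z hz
    by_cases h : (w2 : ℤ) ∣ z
    · obtain ⟨y, rfl⟩ := h
      refine Or.inr ⟨y, ?_, by simp⟩
      rintro ⟨x, rfl⟩
      exact hz ⟨x, by push_cast; ring⟩
    · exact Or.inl h
  · have : g * (w1 * w2 - 1) = g * w1 * (w2 - 1) + g * (w1 - 1) := by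
      obtain ⟨a, rfl⟩ : ∃ a, w1 = a + 1 := ⟨w1 - 1, by omega⟩
      obtain ⟨b, rfl⟩ : ∃ b, w2 = b + 1 := ⟨w2 - 1, by omega⟩
      have : (a + 1) * (b + 1) - 1 = (a + 1) * b + a := by
        rw [Nat.add_mul]; ring_nf; omega
      rw [this]; simp; ring
    rw [this]
    omega

/-- doubling loops -/
theorem cov_loops {e w : ℤ} (he : 0 < e) (hw : w ∣ 4 * e) (X : List ℤ)
    (hX : ∀ x, 0 < x → x < 2 * e → x % 2 = 1 → ¬ w ∣ x → x ∈ X) :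
    Cov (8 * e) (fun z => ¬ (4 : ℤ) ∣ z ∧ ¬ w ∣ z) X.length := by
  refine ⟨X.map fun x => (x, x + 4 * e), by simp, ?_⟩
  rintro z ⟨h4, hz⟩
  have h0 := Int.emod_nonneg z (show 8 * e ≠ 0 by omega)
  have h1 := Int.emod_lt_of_pos z (show 0 < 8 * e by omega)
  have h2 := Int.emod_add_mul_ediv z (8 * e)
  set r := z % (8 * e)
  set q := z / (8 * e)
  have h3 : z = r + 8 * (e * q) := by linear_combination -h2
  have hw8 : w ∣ 8 * (e * q) := by
    have := hw.mul_right (2 * q)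
    have e' : 4 * e * (2 * q) = 8 * (e * q) := by ring
    rwa [e'] at this
  have hr : ¬ w ∣ r := fun h => hz (h3 ▸ dvd_add h hw8)
  have mem : ∀ x ∈ X, (x, x + 4 * e) ∈ X.map fun x => (x, x + 4 * e) := fun x hx =>
    List.mem_map.2 ⟨x, hx, rfl⟩
  rcases Int.emod_two_eq_zero_or_one r with hr2 | hr2
  · have hr4 : r % 4 = 2 := by omega
    by_cases hlt : r < 4 * e
    · refine ⟨_, mem ((4 * e - r) / 2) (hX _ (by omega) (by omega) (by omega) ?_),
        Or.inr (Or.inr (Or.inr ⟨q + 1, ?_⟩))⟩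
      · intro h
        apply hr
        have : r = 4 * e - 2 * ((4 * e - r) / 2) := by omega
        rw [this]
        exact dvd_sub hw (h.mul_left 2)
      · simp only
        have : 2 * ((4 * e - r) / 2) = 4 * e - r := by omega
        linear_combination h3 + this
    · refine ⟨_, mem ((r - 4 * e) / 2) (hX _ (by omega) (by omega) (by omega) ?_),
        Or.inr (Or.inr (Or.inl ⟨q, ?_⟩))⟩
      · intro h
        apply hr
        have : r = 4 * e + 2 * ((r - 4 * e) / 2) := by omega
        rw [this]
        exact dvd_add hw (h.mul_left 2)
      · simp only
        have : 2 * ((r - 4 * e) / 2) = r - 4 * e := by omega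
        linear_combination h3 - this
  · by_cases c1 : r < 2 * e
    · exact ⟨_, mem r (hX _ (by omega) (by omega) (by omega) hr), Or.inl (Or.inl ⟨q, by
        simp only; linear_combination h3⟩)⟩
    by_cases c2 : r < 4 * e
    · refine ⟨_, mem (4 * e - r) (hX _ (by omega) (by omega) (by omega) ?_),
        Or.inr (Or.inl (Or.inr ⟨q + 1, by simp only; linear_combination h3⟩))⟩
      intro h; apply hr
      have := dvd_sub hw h
      simpa using this
    by_cases c3 : r < 6 * e
    · refine ⟨_, mem (r - 4 * e) (hX _ (by omega) (by omega) (by omega) ?_),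
        Or.inr (Or.inl (Or.inl ⟨q, by simp only; linear_combination h3⟩))⟩
      intro h; apply hr
      have := dvd_add hw h
      simpa using this
    · refine ⟨_, mem (8 * e - r) (hX _ (by omega) (by omega) (by omega) ?_),
        Or.inl (Or.inr ⟨q + 1, by simp only; linear_combination h3⟩)⟩
      intro h; apply hr
      have := dvd_sub (hw.mul_left 2) h
      have e' : 2 * (4 * e) - (8 * e - r) = r := by ring
      rwa [e'] at this

theorem PP.quad_w {g v : ℕ} (h : PP g v) (hg : g % 2 = 0) (hg0 : 0 < g) (hv : 0 < v) :
    PP g (4 * v) := by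
  obtain ⟨h', rfl⟩ : ∃ h', g = 2 * h' := ⟨g / 2, by omega⟩
  have hl := cov_loops (e := ((h' * v : ℕ) : ℤ)) (w := ((4 * v : ℕ) : ℤ))
    (by exact_mod_cast Nat.mul_pos (by omega) hv) ⟨h', by push_cast; ring⟩
    ((List.range (h' * v)).map fun i : ℕ => 2 * (i : ℤ) + 1)
    (by
      intro x h0 h1 h2 _
      refine List.mem_map.2 ⟨(x / 2).toNat, ?_, ?_⟩
      · rw [List.mem_range]; omega
      · omega)
  have h2' := Cov.hom (n' := ((2 * h' * (4 * v) : ℕ) : ℤ)) (c := 4) h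
    (by push_cast; exact ⟨1, by ring⟩)
  have e : ((2 * h' * (4 * v) : ℕ) : ℤ) = 8 * ((h' * v : ℕ) : ℤ) := by push_cast; ring
  unfold PP
  rw [e] at h2' ⊢
  refine (hl.union h2').mono ?_ ?_
  · intro z hz
    by_cases h4 : (4 : ℤ) ∣ z
    · obtain ⟨y, rfl⟩ := h4
      refine Or.inr ⟨y, ?_, by simp⟩
      rintro ⟨x, rfl⟩
      exact hz ⟨x, by push_cast; ring⟩
    · exact Or.inl ⟨h4, hz⟩
  · rw [List.length_map, List.length_range]
    obtain ⟨a, rfl⟩ : ∃ a, v = a + 1 := ⟨v - 1, by omega⟩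
    have e1 : 2 * h' * (4 * (a + 1) - 1) = 8 * (h' * a) + 6 * h' := by
      have : 4 * (a + 1) - 1 = 4 * a + 3 := by omega
      rw [this]; ring
    have e2 : 2 * h' * (a + 1 - 1) = 2 * (h' * a) := by simp; ring
    rw [e1, e2, Nat.mul_add]
    omega

theorem PP.quad_g {g w : ℕ} (h : PP g w) (hg : g % 2 = 0) (hg0 : 0 < g) (hw : w % 2 = 1) :
    PP (4 * g) w := by
  obtain ⟨h', rfl⟩ : ∃ h', g = 2 * h' := ⟨g / 2, by omega⟩
  have hw0 : 0 < w := by omega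
  have hl := cov_loops (e := ((h' * w : ℕ) : ℤ)) (w := (w : ℤ))
    (by exact_mod_cast Nat.mul_pos (by omega) hw0) ⟨4 * h', by push_cast; ring⟩
    ((List.range (w - 1)).flatMap fun l : ℕ => (List.range h').map fun r : ℕ =>
      (((l + 1) + w * (2 * r + l % 2) : ℕ) : ℤ))
    (by
      intro x h0 h1 h2 h3
      obtain ⟨x, rfl⟩ : ∃ y : ℕ, x = y := ⟨x.toNat, by omega⟩
      have h3' : ¬ w ∣ x := fun h => h3 (by exact_mod_cast h)
      have h4 : x % w ≠ 0 := fun h => h3' (Nat.dvd_of_mod_eq_zero h)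
      have h5 := Nat.mod_lt x hw0
      have h6 := Nat.mod_add_div x w
      have h7 : x / w < 2 * h' := by
        rw [Nat.div_lt_iff_lt_mul hw0]
        have : (x : ℤ) < ((2 * h' * w : ℕ) : ℤ) := by push_cast at *; linarith
        exact_mod_cast this
      refine List.mem_flatMap.2 ⟨x % w - 1, ?_, List.mem_map.2 ⟨x / w / 2, ?_, ?_⟩⟩
      · rw [List.mem_range]; omega
      · rw [List.mem_range]; omega
      · have hpar : (x % w + x / w) % 2 = 1 := by
          have : (w * (x / w)) % 2 = (x / w) % 2 := by rw [Nat.mul_mod, hw]; simp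
          omega
        have : 2 * (x / w / 2) + (x % w - 1) % 2 = x / w := by omega
        rw [this]
        have : x % w - 1 + 1 = x % w := by omega
        rw [this, h6])
  have h2' := Cov.hom (n' := ((4 * (2 * h') * w : ℕ) : ℤ)) (c := 4) h
    (by push_cast; exact ⟨1, by ring⟩)
  have e : ((4 * (2 * h') * w : ℕ) : ℤ) = 8 * ((h' * w : ℕ) : ℤ) := by push_cast; ring
  unfold PP
  rw [e] at h2' ⊢
  refine (hl.union h2').mono ?_ ?_
  · intro z hz
    by_cases h4 : (4 : ℤ) ∣ z
    · obtain ⟨y, rfl⟩ := h4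
      refine Or.inr ⟨y, ?_, by simp⟩
      rintro ⟨x, rfl⟩
      exact hz ⟨4 * x, by push_cast; ring⟩
    · exact Or.inl ⟨h4, hz⟩
  · have : ((List.range (w - 1)).flatMap fun l : ℕ => (List.range h').map fun r : ℕ =>
      (((l + 1) + w * (2 * r + l % 2) : ℕ) : ℤ)).length = (w - 1) * h' := by
      simp [List.length_flatMap]
    rw [this]
    have e1 : 2 * h' * (w - 1) = 2 * ((w - 1) * h') := by ring
    have e2 : 4 * (2 * h') * (w - 1) = 8 * ((w - 1) * h') := by ring
    rw [e1, e2]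
    omega

/-! ### Coverings of `Z_n × A` -/

def HitE {A : Type} [AddCommGroup A] (n : ℤ) (a z : ℤ × A) : Prop :=
  (n ∣ z.1 - a.1 ∧ z.2 = a.2) ∨ (n ∣ z.1 + a.1 ∧ z.2 = -a.2)

def HitA {A : Type} [AddCommGroup A] (n : ℤ) (p : (ℤ × A) × (ℤ × A)) (z : ℤ × A) : Prop :=
  HitE n p.1 z ∨ HitE n p.2 z ∨ HitE n (p.1 + p.2) z

def CovA {A : Type} [AddCommGroup A] (n : ℤ) (S : ℤ × A → Prop) (t : ℕ) : Prop :=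
  ∃ L : List ((ℤ × A) × (ℤ × A)), L.length ≤ t ∧ ∀ z, S z → ∃ p ∈ L, HitA n p z

theorem HitE.neg {A : Type} [AddCommGroup A] {n : ℤ} {a z : ℤ × A} (h : HitE n a (-z)) :
    HitE n a z := by
  rcases h with ⟨h1, h2⟩ | ⟨h1, h2⟩
  · refine Or.inr ⟨?_, ?_⟩
    · have := (dvd_neg (a := n)).2 h1
      have e : -((-z).1 - a.1) = z.1 + a.1 := by simp; ring
      rwa [e] at this
    · rw [← h2]; simp
  · refine Or.inl ⟨?_, ?_⟩
    · have := (dvd_neg (a := n)).2 h1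
      have e : -((-z).1 + a.1) = z.1 - a.1 := by simp; ring
      rwa [e] at this
    · rw [Prod.snd_neg] at h2
      exact neg_injective h2

theorem HitA.neg {A : Type} [AddCommGroup A] {n : ℤ} {p : (ℤ × A) × (ℤ × A)} {z : ℤ × A}
    (h : HitA n p (-z)) : HitA n p z := by
  rcases h with h | h | h
  · exact Or.inl h.neg
  · exact Or.inr (Or.inl h.neg)
  · exact Or.inr (Or.inr h.neg)

theorem CovA.mono {A : Type} [AddCommGroup A] {n : ℤ} {S S' : ℤ × A → Prop} {t t' : ℕ}
    (h : CovA n S t) (hS : ∀ z, S' z → S z) (ht : t ≤ t') : CovA n S' t' := by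
  obtain ⟨L, hL, hc⟩ := h
  exact ⟨L, hL.trans ht, fun z hz => hc z (hS z hz)⟩

theorem CovA.union {A : Type} [AddCommGroup A] {n : ℤ} {S S' : ℤ × A → Prop} {t t' : ℕ}
    (h : CovA n S t) (h' : CovA n S' t') : CovA n (fun z => S z ∨ S' z) (t + t') := by
  obtain ⟨L, hL, hc⟩ := h
  obtain ⟨L', hL', hc'⟩ := h'
  refine ⟨L ++ L', by rw [List.length_append]; omega, ?_⟩
  rintro z (hz | hz)
  · obtain ⟨p, hp, hh⟩ := hc z hz
    exact ⟨p, List.mem_append_left _ hp, hh⟩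
  · obtain ⟨p, hp, hh⟩ := hc' z hz
    exact ⟨p, List.mem_append_right _ hp, hh⟩

/-- scaling of the rows -/
theorem CovA.scale {A : Type} [AddCommGroup A] {n c : ℤ} {S : ℤ × A → Prop} {t : ℕ}
    (h : CovA n S t) : CovA (c * n) (fun z => ∃ y, z.1 = c * y ∧ S (y, z.2)) t := by
  obtain ⟨L, hL, hc⟩ := h
  refine ⟨L.map fun p => ((c * p.1.1, p.1.2), (c * p.2.1, p.2.2)), by simpa using hL, ?_⟩
  rintro ⟨z, s⟩ ⟨y, hz, hy⟩
  simp only at hz hy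
  subst hz
  obtain ⟨p, hp, hh⟩ := hc _ hy
  refine ⟨_, List.mem_map_of_mem hp, ?_⟩
  have f : ∀ a : ℤ × A, HitE n a (y, s) → HitE (c * n) (c * a.1, a.2) (c * y, s) := by
    rintro a (⟨h1, h2⟩ | ⟨h1, h2⟩)
    · exact Or.inl ⟨by simp only [← mul_sub]; exact mul_dvd_mul_left c h1, h2⟩
    · exact Or.inr ⟨by simp only [← mul_add]; exact mul_dvd_mul_left c h1, h2⟩
  rcases hh with h | h | h
  · exact Or.inl (f _ h)
  · exact Or.inr (Or.inl (f _ h))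
  · have := f _ h
    refine Or.inr (Or.inr ?_)
    simpa [mul_add] using this

/-- homomorphism `(r, c) ↦ e r + f c` -/
theorem CovA.hom {A : Type} [AddCommGroup A] {n n' e : ℤ} (f : A →+ ℤ) {S : ℤ × A → Prop} {t : ℕ}
    (h : CovA n S t) (he : n' ∣ n * e) :
    Cov n' (fun z => ∃ y, S y ∧ n' ∣ z - (e * y.1 + f y.2)) t := by
  obtain ⟨L, hL, hL'⟩ := h
  refine ⟨L.map fun p => (e * p.1.1 + f p.1.2, e * p.2.1 + f p.2.2), by simpa using hL, ?_⟩
  rintro z ⟨y, hy, hz⟩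
  obtain ⟨p, hp, hh⟩ := hL' y hy
  refine ⟨_, List.mem_map_of_mem hp, ?_⟩
  have key : ∀ a : ℤ × A, HitE n a y →
      (n' ∣ z - (e * a.1 + f a.2) ∨ n' ∣ z + (e * a.1 + f a.2)) := by
    rintro a (⟨h1, h2⟩ | ⟨h1, h2⟩)
    · left
      have h3 : n' ∣ e * (y.1 - a.1) := by
        refine he.trans ?_
        rw [mul_comm]
        exact mul_dvd_mul_left e h1
      have := dvd_add hz h3
      rw [h2] at this
      have e' : z - (e * y.1 + f a.2) + e * (y.1 - a.1) = z - (e * a.1 + f a.2) := by ring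
      rwa [e'] at this
    · right
      have h3 : n' ∣ e * (y.1 + a.1) := by
        refine he.trans ?_
        rw [mul_comm]
        exact mul_dvd_mul_left e h1
      have := dvd_add hz h3
      rw [h2, map_neg] at this
      have e' : z - (e * y.1 + -f a.2) + e * (y.1 + a.1) = z + (e * a.1 + f a.2) := by ring
      rwa [e'] at this
  rcases hh with h | h | h
  · exact Or.inl (key _ h)
  · exact Or.inr (Or.inl (key _ h))
  · have := key _ h
    refine Or.inr (Or.inr ?_)
    have e' : e * p.1.1 + f p.1.2 + (e * p.2.1 + f p.2.2) =
      e * (p.1 + p.2).1 + f (p.1 + p.2).2 := by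
      simp only [Prod.fst_add, Prod.snd_add, map_add]; ring
    simp only [e']
    exact this

/-! ### Even lifts from two compatible systems -/

theorem nc1 {v y c : ℤ} (hv : 0 < v) (h : ¬ 2 * v ∣ y - c) :
    ∃ i : ℕ, (i : ℤ) < 2 * v - 1 ∧ 2 * v ∣ y - ((i : ℤ) + 1 + c) := by
  have h0 := Int.emod_nonneg (y - 1 - c) (show 2 * v ≠ 0 by omega)
  have h1 := Int.emod_lt_of_pos (y - 1 - c) (show 0 < 2 * v by omega)
  have h2 := Int.emod_add_mul_ediv (y - 1 - c) (2 * v)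
  refine ⟨((y - 1 - c) % (2 * v)).toNat, ?_, ?_⟩
  · rw [Int.toNat_of_nonneg h0]
    by_contra h3
    have h4 : (y - 1 - c) % (2 * v) = 2 * v - 1 := by omega
    exact h ⟨(y - 1 - c) / (2 * v) + 1, by linear_combination -h2 + h4⟩
  · rw [Int.toNat_of_nonneg h0]
    exact ⟨(y - 1 - c) / (2 * v), by linear_combination -h2⟩

theorem nc2 {v y c : ℤ} (hv : 0 < v) (h : ¬ 2 * v ∣ y - c) :
    ∃ i : ℕ, (i : ℤ) < 2 * v - 1 ∧
      2 * v ∣ y - ((if (i : ℤ) < v then (i : ℤ) else (i : ℤ) + 1) + v + c) := by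
  have h0 := Int.emod_nonneg (y - v - c) (show 2 * v ≠ 0 by omega)
  have h1 := Int.emod_lt_of_pos (y - v - c) (show 0 < 2 * v by omega)
  have h2 := Int.emod_add_mul_ediv (y - v - c) (2 * v)
  set r := (y - v - c) % (2 * v)
  have hr : r ≠ v := fun h3 => h ⟨(y - v - c) / (2 * v) + 1, by linear_combination -h2 + h3⟩
  by_cases hlt : r < v
  · refine ⟨r.toNat, ?_, ?_⟩
    · rw [Int.toNat_of_nonneg h0]; omega
    · rw [Int.toNat_of_nonneg h0, if_pos hlt]
      exact ⟨(y - v - c) / (2 * v), by linear_combination -h2⟩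
  · refine ⟨(r - 1).toNat, ?_, ?_⟩
    · rw [Int.toNat_of_nonneg (by omega)]; omega
    · rw [Int.toNat_of_nonneg (by omega), if_neg (by omega)]
      exact ⟨(y - v - c) / (2 * v), by linear_combination -h2⟩

theorem nc3 {v y c1 c2 c3 : ℤ} (hv : 0 < v) (hc : 2 * v ∣ c1 + c2 - c3 + v)
    (h : ¬ 2 * v ∣ y - c3) :
    ∃ i : ℕ, (i : ℤ) < 2 * v - 1 ∧
      2 * v ∣ y - (((i : ℤ) + 1 + c1) +
        ((if (i : ℤ) < v then (i : ℤ) else (i : ℤ) + 1) + v + c2)) := by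
  obtain ⟨k, hk⟩ := hc
  have h0 := Int.emod_nonneg (y - 1 - c3) (show 2 * v ≠ 0 by omega)
  have h1 := Int.emod_lt_of_pos (y - 1 - c3) (show 0 < 2 * v by omega)
  have h2 := Int.emod_add_mul_ediv (y - 1 - c3) (2 * v)
  set r := (y - 1 - c3) % (2 * v)
  have hr : r ≠ 2 * v - 1 := fun h3 =>
    h ⟨(y - 1 - c3) / (2 * v) + 1, by linear_combination -h2 + h3⟩
  rcases Int.emod_two_eq_zero_or_one r with hp | hp
  · refine ⟨(r / 2).toNat, ?_, ?_⟩
    · rw [Int.toNat_of_nonneg (by omega)]; omega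
    · rw [Int.toNat_of_nonneg (by omega), if_pos (by omega)]
      have h5 : 2 * (r / 2) = r := by omega
      exact ⟨(y - 1 - c3) / (2 * v) - k, by linear_combination -h2 - h5 - hk⟩
  · refine ⟨((r - 1) / 2 + v).toNat, ?_, ?_⟩
    · rw [Int.toNat_of_nonneg (by omega)]; omega
    · rw [Int.toNat_of_nonneg (by omega), if_neg (by omega)]
      have h5 : 2 * ((r - 1) / 2) = r - 1 := by omega
      exact ⟨(y - 1 - c3) / (2 * v) - k - 1, by linear_combination -h2 - h5 - hk⟩

/-- `l` is, up to sign, one of the three labels of the triple `p` -/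
def Lab {A : Type} [AddCommGroup A] (p : (ℤ × A) × (ℤ × A)) (l : ℤ × A) : Prop :=
  (l = p.1 ∨ l = -p.1) ∨ (l = p.2 ∨ l = -p.2) ∨ (l = p.1 + p.2 ∨ l = -(p.1 + p.2))

theorem hit_lift {A : Type} [AddCommGroup A] {n u x : ℤ} {a z : ℤ × A} {X : ℤ}
    (h1 : z.1 = a.1 + n * x) (h2 : z.2 = a.2) (h : u ∣ x - X) :
    HitE (n * u) (a.1 + n * X, a.2) z := by
  refine Or.inl ⟨?_, h2⟩
  obtain ⟨k, hk⟩ := h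
  exact ⟨k, by simp only; linear_combination h1 + n * hk⟩

theorem two_sys {A : Type} [AddCommGroup A] {n v : ℤ} {t : ℕ} (hv : 0 < v)
    (S : ℤ × A → Prop) (Lb : List (ℤ × A)) (T1 T2 : List ((ℤ × A) × (ℤ × A)))
    (f : ℤ × A → ℤ) (hf : ∀ a, f (-a) = f a)
    (hS : ∀ z, S z → ∃ l ∈ Lb, HitE n l z)
    (h1 : ∀ l ∈ Lb, ∃ p ∈ T1, Lab p l) (h2 : ∀ l ∈ Lb, ∃ p ∈ T2, Lab p l)
    (f1 : ∀ p ∈ T1, (f p.1 + f p.2 + f (p.1 + p.2)) % 2 = 1)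
    (f2 : ∀ p ∈ T2, (f p.1 + f p.2 + f (p.1 + p.2)) % 2 = 0)
    (t1 : T1.length ≤ t) (t2 : T2.length ≤ t) :
    CovA (n * (2 * v)) S ((2 * v).toNat * t) := by
  let X : (ℤ × A) × (ℤ × A) → ℕ → ℤ := fun p i => (i : ℤ) + 1 + f p.1 * v
  let Y : (ℤ × A) × (ℤ × A) → ℕ → ℤ := fun p i =>
    (if (i : ℤ) < v then (i : ℤ) else (i : ℤ) + 1) + v + f p.2 * v
  let L1 := T1.flatMap fun p => (List.range ((2 * v - 1).toNat)).map fun i =>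
    (((p.1.1 + n * X p i, p.1.2), (p.2.1 + n * Y p i, p.2.2)) : (ℤ × A) × (ℤ × A))
  let L2 := T2.map fun p =>
    (((p.1.1 + n * (f p.1 * v), p.1.2), (p.2.1 + n * (f p.2 * v), p.2.2)) : (ℤ × A) × (ℤ × A))
  refine ⟨L1 ++ L2, ?_, ?_⟩
  · have e1 : L1.length = T1.length * (2 * v - 1).toNat := by
      simp [L1, List.length_flatMap]
    have e2 : L2.length = T2.length := by simp [L2]
    rw [List.length_append, e1, e2]
    have e3 : (2 * v).toNat = (2 * v - 1).toNat + 1 := by omega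
    rw [e3, Nat.add_mul, one_mul, mul_comm]
    exact Nat.add_le_add (Nat.mul_le_mul_left _ t1) t2
  intro z hz
  -- normal form
  have main : ∀ (l z : ℤ × A) (x : ℤ), l ∈ Lb → z.1 = l.1 + n * x → z.2 = l.2 →
      ∃ p ∈ L1 ++ L2, HitA (n * (2 * v)) p z := by
    intro l z x hl hz1 hz2
    by_cases hx : 2 * v ∣ x - f l * v
    · obtain ⟨p, hp, hlab⟩ := h2 l hl
      refine ⟨((p.1.1 + n * (f p.1 * v), p.1.2), (p.2.1 + n * (f p.2 * v), p.2.2)),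
        List.mem_append_right _ (List.mem_map.2 ⟨p, hp, rfl⟩), ?_⟩
      have hx' : ∀ c : ℤ, c = f l → 2 * v ∣ -x - c * v := by
        rintro c rfl
        obtain ⟨k, hk⟩ := hx
        exact ⟨-k - f l, by linear_combination -hk⟩
      have h3 : ∀ x' c : ℤ, (f p.1 + f p.2 + c) % 2 = 0 → 2 * v ∣ x' - c * v →
          2 * v ∣ x' - (f p.1 * v + f p.2 * v) := by
        rintro x' c hc ⟨k, hk⟩
        have : 2 * ((f p.1 + f p.2 + c) / 2) = f p.1 + f p.2 + c := by omega
        exact ⟨k + c - (f p.1 + f p.2 + c) / 2, by linear_combination hk + v * this⟩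
      have f2p := f2 p hp
      rcases hlab with (rfl | rfl) | (rfl | rfl) | (rfl | rfl)
      · exact Or.inl (hit_lift hz1 hz2 hx)
      · refine HitA.neg (Or.inl (hit_lift (x := -x) ?_ ?_ (hx' _ (hf _).symm)))
        · simp only [Prod.fst_neg] at hz1 ⊢; linear_combination -hz1
        · simp only [Prod.snd_neg] at hz2 ⊢; rw [hz2, neg_neg]
      · exact Or.inr (Or.inl (hit_lift hz1 hz2 hx))
      · refine HitA.neg (Or.inr (Or.inl (hit_lift (x := -x) ?_ ?_ (hx' _ (hf _).symm))))
        · simp only [Prod.fst_neg] at hz1 ⊢; linear_combination -hz1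
        · simp only [Prod.snd_neg] at hz2 ⊢; rw [hz2, neg_neg]
      · refine Or.inr (Or.inr ?_)
        have := hit_lift (u := 2 * v) (X := f p.1 * v + f p.2 * v) hz1 hz2 (h3 x _ f2p hx)
        convert this using 2
        · simp only [Prod.fst_add]; ring
        · rfl
      · refine HitA.neg (Or.inr (Or.inr ?_))
        have := hit_lift (z := -z) (a := p.1 + p.2) (n := n) (x := -x) (u := 2 * v) (X := f p.1 * v + f p.2 * v)
          (by simp only [Prod.fst_neg] at hz1 ⊢; linear_combination -hz1)
          (by simp only [Prod.snd_neg] at hz2 ⊢; rw [hz2, neg_neg])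
          (h3 (-x) _ f2p (hx' _ (hf _).symm))
        convert this using 2
        · simp only [Prod.fst_add]; ring
        · rfl
    · obtain ⟨p, hp, hlab⟩ := h1 l hl
      have mem : ∀ i : ℕ, (i : ℤ) < 2 * v - 1 →
          (((p.1.1 + n * X p i, p.1.2), (p.2.1 + n * Y p i, p.2.2)) : (ℤ × A) × (ℤ × A)) ∈
            L1 ++ L2 := by
        intro i hi
        refine List.mem_append_left _ (List.mem_flatMap.2 ⟨p, hp, List.mem_map.2 ⟨i, ?_, rfl⟩⟩)
        rw [List.mem_range]; omega
      have hx' : ∀ c : ℤ, c = f l → ¬ 2 * v ∣ -x - c * v := by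
        rintro c rfl ⟨k, hk⟩
        exact hx ⟨-k - f l, by linear_combination -hk⟩
      have f1p := f1 p hp
      have hcc : 2 * v ∣ f p.1 * v + f p.2 * v - f (p.1 + p.2) * v + v := by
        have : 2 * ((f p.1 + f p.2 + f (p.1 + p.2) + 1) / 2) =
          f p.1 + f p.2 + f (p.1 + p.2) + 1 := by omega
        exact ⟨(f p.1 + f p.2 + f (p.1 + p.2) + 1) / 2 - f (p.1 + p.2), by
          linear_combination -v * this⟩
      rcases hlab with (rfl | rfl) | (rfl | rfl) | (rfl | rfl)
      · obtain ⟨i, hi, hd⟩ := nc1 hv hx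
        exact ⟨_, mem i hi, Or.inl (hit_lift hz1 hz2 hd)⟩
      · obtain ⟨i, hi, hd⟩ := nc1 hv (hx' _ (hf _).symm)
        refine ⟨_, mem i hi, HitA.neg (Or.inl (hit_lift (x := -x) ?_ ?_ hd))⟩
        · simp only [Prod.fst_neg] at hz1 ⊢; linear_combination -hz1
        · simp only [Prod.snd_neg] at hz2 ⊢; rw [hz2, neg_neg]
      · obtain ⟨i, hi, hd⟩ := nc2 hv hx
        exact ⟨_, mem i hi, Or.inr (Or.inl (hit_lift hz1 hz2 hd))⟩
      · obtain ⟨i, hi, hd⟩ := nc2 hv (hx' _ (hf _).symm)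
        refine ⟨_, mem i hi, HitA.neg (Or.inr (Or.inl (hit_lift (x := -x) ?_ ?_ hd)))⟩
        · simp only [Prod.fst_neg] at hz1 ⊢; linear_combination -hz1
        · simp only [Prod.snd_neg] at hz2 ⊢; rw [hz2, neg_neg]
      · obtain ⟨i, hi, hd⟩ := nc3 hv hcc hx
        refine ⟨_, mem i hi, Or.inr (Or.inr ?_)⟩
        have := hit_lift hz1 hz2 hd
        convert this using 2
        · simp only [Prod.fst_add, X, Y]; ring
        · rfl
      · obtain ⟨i, hi, hd⟩ := nc3 hv hcc (hx' _ (hf _).symm)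
        refine ⟨_, mem i hi, HitA.neg (Or.inr (Or.inr ?_))⟩
        have := hit_lift (z := -z) (a := p.1 + p.2) (n := n) (x := -x)
          (by simp only [Prod.fst_neg] at hz1 ⊢; linear_combination -hz1)
          (by simp only [Prod.snd_neg] at hz2 ⊢; rw [hz2, neg_neg]) hd
        convert this using 2
        · simp only [Prod.fst_add, X, Y]; ring
        · rfl
  obtain ⟨l, hl, ⟨⟨x, hx⟩, h4⟩ | ⟨⟨x, hx⟩, h4⟩⟩ := hS z hz
  · exact main l z x hl (by linear_combination hx) h4
  · obtain ⟨p, hp, hh⟩ := main l (-z) (-x) hl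
      (by simp only [Prod.fst_neg]; linear_combination -hx) (by simp only [Prod.snd_neg, h4, neg_neg])
    exact ⟨p, hp, hh.neg⟩

/-- the base case of the same construction -/
theorem one_sys {A : Type} [AddCommGroup A] {n : ℤ} {t : ℕ}
    (S : ℤ × A → Prop) (Lb : List (ℤ × A)) (T1 : List ((ℤ × A) × (ℤ × A)))
    (hS : ∀ z, S z → ∃ l ∈ Lb, HitE n l z)
    (h1 : ∀ l ∈ Lb, ∃ p ∈ T1, Lab p l) (t1 : T1.length ≤ t) : CovA n S t := by
  refine ⟨T1, t1, ?_⟩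
  intro z hz
  obtain ⟨l, hl, hh⟩ := hS z hz
  obtain ⟨p, hp, hlab⟩ := h1 l hl
  have key : ∀ a : ℤ × A, HitE n (-a) z → HitE n a z := by
    rintro a (⟨h1, h2⟩ | ⟨h1, h2⟩)
    · exact Or.inr ⟨by simpa using h1, h2⟩
    · exact Or.inl ⟨by simpa [sub_eq_add_neg] using h1, by simpa using h2⟩
  refine ⟨p, hp, ?_⟩
  rcases hlab with (rfl | rfl) | (rfl | rfl) | (rfl | rfl)
  · exact Or.inl hh
  · exact Or.inl (key _ hh)
  · exact Or.inr (Or.inl hh)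
  · exact Or.inr (Or.inl (key _ hh))
  · exact Or.inr (Or.inr hh)
  · exact Or.inr (Or.inr (key _ hh))

/-! ### One-parameter families of difference triples -/

/-- a linear form `s k + o` -/
abbrev LForm := ℤ × ℤ

def ev (f : LForm) (k : ℤ) : ℤ := f.1 * k + f.2

structure Fam where
  n : LForm
  lo : LForm
  hi : LForm
  cnt : LForm
  k0 : ℤ
  holes : List LForm
  nests : List (LForm × LForm × LForm)
  spor : List (LForm × LForm × LForm)

def Fam.triples (d : Fam) (k : ℤ) : List (ℤ × ℤ) :=
  (d.nests.flatMap fun N => (List.range (ev N.2.2 k).toNat).map fun i : ℕ =>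
    (ev N.1 k + 2 * (i : ℤ), ev N.2.1 k - (i : ℤ))) ++
  d.spor.map fun s => (ev s.1 k, ev s.2.1 k)

def Fam.pieces (d : Fam) (ρ : ℤ) : List (LForm × LForm) :=
  (d.nests.flatMap fun N =>
    [((N.2.1.1 - N.2.2.1, N.2.1.2 - N.2.2.2 + 1), N.2.1),
     ((N.1.1 + N.2.1.1, N.1.2 + N.2.1.2),
       (N.1.1 + N.2.1.1 + N.2.2.1, N.1.2 + N.2.1.2 + N.2.2.2 - 1))] ++
    (if N.1.1 % 2 = 0 ∧ N.1.2 % 2 = ρ then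
      [(N.1, (N.1.1 + 2 * N.2.2.1, N.1.2 + 2 * N.2.2.2 - 2))] else [])) ++
  (d.spor.flatMap fun s => [(s.1, s.1), (s.2.1, s.2.1), (s.2.2, s.2.2)]) ++
  d.holes.map fun h => (h, h)

def chain (P : List (LForm × LForm)) (ρ : ℤ) : ℕ → LForm → LForm → Bool
  | 0, cur, e => decide (cur = e)
  | f + 1, cur, e =>
    if cur = e then true else
    match P.find? (fun p => decide (p.1 = cur)) with
    | some p => chain P ρ f (p.2.1, p.2.2 + 1) e
    | none => if cur.1 % 2 = 0 ∧ cur.2 % 2 ≠ ρ then chain P ρ f (cur.1, cur.2 + 1) e else false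

def Fam.check (d : Fam) : Bool :=
  d.nests.all (fun N => decide (0 ≤ N.2.2.1 ∧ 0 ≤ N.2.2.1 * d.k0 + N.2.2.2)) &&
  d.spor.all (fun s => decide (s.2.2 = s.1 + s.2.1 ∨ s.1 + s.2.1 + s.2.2 = d.n)) &&
  decide ((d.nests.map fun N => N.2.2).sum + (0, (d.spor.length : ℤ)) = d.cnt) &&
  chain (d.pieces 0) 0 150 d.lo (d.hi.1, d.hi.2 + 1) &&
  chain (d.pieces 1) 1 150 d.lo (d.hi.1, d.hi.2 + 1)

theorem ev_add (f g : LForm) (k : ℤ) : ev (f + g) k = ev f k + ev g k := by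
  simp only [ev, Prod.fst_add, Prod.snd_add]; ring

theorem chain_sound {P : List (LForm × LForm)} {ρ k : ℤ} {Good : ℤ → Prop}
    (hP : ∀ p ∈ P, ∀ x, x % 2 = ρ → ev p.1 k ≤ x → x ≤ ev p.2 k → Good x) :
    ∀ (f : ℕ) (cur e : LForm), chain P ρ f cur e = true →
      ∀ x, x % 2 = ρ → ev cur k ≤ x → x < ev e k → Good x := by
  intro f
  induction f with
  | zero =>
    intro cur e h x _ h1 h2
    have : cur = e := of_decide_eq_true h
    subst this; omega
  | succ f ih =>
    intro cur e h x hx h1 h2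
    rw [chain] at h
    by_cases hce : cur = e
    · subst hce; omega
    rw [if_neg hce] at h
    split at h
    · next p hp =>
      have hp1 : p.1 = cur := by simpa using List.find?_some hp
      have hp2 := List.mem_of_find?_eq_some hp
      by_cases hx2 : x ≤ ev p.2 k
      · exact hP p hp2 x hx (by rw [hp1]; exact h1) hx2
      · refine ih _ _ h x hx ?_ h2
        simp only [ev] at hx2 ⊢; omega
    · split_ifs at h with hc
      · refine ih _ _ h x hx ?_ h2
        simp only [ev] at h1 ⊢
        have : (cur.1 * k) % 2 = 0 := by
          rw [Int.mul_emod, hc.1]; simp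
        omega

theorem sum_toNat (k : ℤ) (M : List (LForm × LForm × LForm)) (h : ∀ N ∈ M, 0 ≤ ev N.2.2 k) :
    (((M.map fun N => (ev N.2.2 k).toNat).sum : ℕ) : ℤ) = ev ((M.map fun N => N.2.2).sum) k := by
  induction M with
  | nil => simp [ev]
  | cons N M ih =>
    simp only [List.map_cons, List.sum_cons]
    rw [ev_add, Nat.cast_add, ih fun N hN => h N (List.mem_cons_of_mem _ hN),
      Int.toNat_of_nonneg (h N List.mem_cons_self)]

theorem Fam.sound (d : Fam) (h : d.check = true) (k : ℤ) (hk : d.k0 ≤ k) :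
    Cov (ev d.n k) (fun z => ev d.lo k ≤ z ∧ z ≤ ev d.hi k ∧ ∀ x ∈ d.holes, z ≠ ev x k)
      (ev d.cnt k).toNat := by
  simp only [Fam.check, Bool.and_eq_true, List.all_eq_true, decide_eq_true_eq] at h
  obtain ⟨⟨⟨⟨h1, h2⟩, h3⟩, h4⟩, h5⟩ := h
  have hlen : ∀ N ∈ d.nests, 0 ≤ ev N.2.2 k := by
    intro N hN
    obtain ⟨ha, hb⟩ := h1 N hN
    have := mul_le_mul_of_nonneg_left hk ha
    simp only [ev]; omega
  refine ⟨d.triples k, ?_, ?_⟩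
  · have e1 : (d.triples k).length =
        (d.nests.map fun N => (ev N.2.2 k).toNat).sum + d.spor.length := by
      simp [Fam.triples, List.length_flatMap]
    have e2 := sum_toNat k d.nests hlen
    have e3 : ev d.cnt k = ((d.triples k).length : ℤ) := by
      rw [← h3, ev_add, e1, Nat.cast_add, e2]
      simp [ev]
    omega
  -- every piece is good
  have hP : ∀ ρ, ∀ p ∈ d.pieces ρ, ∀ x, x % 2 = ρ → ev p.1 k ≤ x → x ≤ ev p.2 k →
      ((∃ y ∈ d.holes, x = ev y k) ∨ ∃ p ∈ d.triples k, Hit (ev d.n k) p x) := by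
    intro ρ p hp x hx hl hu
    simp only [Fam.pieces, List.mem_append, List.mem_flatMap, List.mem_map] at hp
    rcases hp with (⟨N, hN, hp⟩ | ⟨s, hs, hp⟩) | ⟨y, hy, rfl⟩
    · have mem : ∀ i : ℤ, 0 ≤ i → i < ev N.2.2 k →
          (ev N.1 k + 2 * i, ev N.2.1 k - i) ∈ d.triples k := by
        intro i hi0 hi1
        refine List.mem_append_left _ (List.mem_flatMap.2 ⟨N, hN, List.mem_map.2
          ⟨i.toNat, ?_, ?_⟩⟩)
        · rw [List.mem_range]; omega
        · rw [Int.toNat_of_nonneg hi0]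
      right
      rcases hp with hp | hp
      · simp only [List.mem_cons, List.not_mem_nil, or_false] at hp
        rcases hp with rfl | rfl
        · refine ⟨_, mem (ev N.2.1 k - x) ?_ ?_, Or.inr (Or.inl (Or.inl ?_))⟩
          · simp only at hu; omega
          · simp only [ev] at hl hu ⊢
            have : (N.2.1.1 - N.2.2.1) * k = N.2.1.1 * k - N.2.2.1 * k := by ring
            omega
          · simp
        · refine ⟨_, mem (x - ev N.1 k - ev N.2.1 k) ?_ ?_, Or.inr (Or.inr (Or.inl ?_))⟩
          · simp only [ev] at hl hu ⊢
            have : (N.1.1 + N.2.1.1) * k = N.1.1 * k + N.2.1.1 * k := by ring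
            omega
          · simp only [ev] at hl hu ⊢
            have : (N.1.1 + N.2.1.1 + N.2.2.1) * k =
              N.1.1 * k + N.2.1.1 * k + N.2.2.1 * k := by ring
            omega
          · have : x - (ev N.1 k + 2 * (x - ev N.1 k - ev N.2.1 k) +
              (ev N.2.1 k - (x - ev N.1 k - ev N.2.1 k))) = 0 := by ring
            simp only [this, dvd_zero]
      · split_ifs at hp with hc
        · simp only [List.mem_cons, List.not_mem_nil, or_false] at hp
          subst hp
          have hev : (N.1.1 * k) % 2 = 0 := by
            rw [Int.mul_emod, hc.1]; simp
          have h2 : (N.1.1 + 2 * N.2.2.1) * k = N.1.1 * k + 2 * (N.2.2.1 * k) := by ring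
          simp only [ev] at hl hu mem
          refine ⟨_, mem ((x - ev N.1 k) / 2) ?_ ?_, Or.inl (Or.inl ?_)⟩
          · simp only [ev]; omega
          · simp only [ev]; omega
          · simp only [ev]
            have : x - (N.1.1 * k + N.1.2 + 2 * ((x - (N.1.1 * k + N.1.2)) / 2)) = 0 := by omega
            simp only [this, dvd_zero]
        · exact absurd hp List.not_mem_nil
    · right
      refine ⟨_, List.mem_append_right _ (List.mem_map.2 ⟨s, hs, rfl⟩), ?_⟩
      simp only [List.mem_cons, List.not_mem_nil, or_false] at hp
      rcases hp with rfl | rfl | rfl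
      · have : x = ev s.1 k := le_antisymm hu hl
        subst this
        exact Or.inl (Or.inl (by simp))
      · have : x = ev s.2.1 k := le_antisymm hu hl
        subst this
        exact Or.inr (Or.inl (Or.inl (by simp)))
      · have : x = ev s.2.2 k := le_antisymm hu hl
        subst this
        refine Or.inr (Or.inr ?_)
        rcases h2 s hs with h | h
        · left
          rw [h, ev_add]; simp
        · right
          rw [← h, ev_add, ev_add]
          exact ⟨1, by ring⟩
    · left
      exact ⟨y, hy, le_antisymm hu hl⟩
  rintro x ⟨hx1, hx2, hx3⟩
  have hx4 : x < ev (d.hi.1, d.hi.2 + 1) k := by simp only [ev] at hx2 ⊢; omega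
  have : (∃ y ∈ d.holes, x = ev y k) ∨ ∃ p ∈ d.triples k, Hit (ev d.n k) p x := by
    rcases Int.emod_two_eq_zero_or_one x with h0 | h0
    · exact chain_sound (hP 0) _ _ _ h4 x h0 hx1 hx4
    · exact chain_sound (hP 1) _ _ _ h5 x h0 hx1 hx4
  rcases this with ⟨y, hy, hxy⟩ | h
  · exact absurd hxy (hx3 y hy)
  · exact h

def famS0 : Fam where
  n := (0, 0)
  lo := (0, 1)
  hi := (12, 0)
  cnt := (4, 0)
  k0 := 1
  holes := []
  nests := [((0, 2), (6, -1), (1, -1)),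
    ((2, 2), (5, -1), (1, -1)),
    ((0, 1), (10, -1), (1, 0)),
    ((2, 1), (9, -1), (1, 0))]
  spor := [((2, 0), (4, 0), (6, 0)),
    ((5, 0), (7, 0), (12, 0))]

theorem famS0_ok : famS0.check = true := by decide +kernel

def famS1 : Fam where
  n := (0, 0)
  lo := (0, 1)
  hi := (12, 3)
  cnt := (4, 1)
  k0 := 1
  holes := []
  nests := [((0, 2), (6, 0), (1, -1)),
    ((2, 2), (5, 1), (1, 0)),
    ((0, 3), (10, 1), (1, -1)),
    ((2, 1), (9, 2), (1, 0))]
  spor := [((0, 1), (7, 1), (7, 2)),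
    ((4, 1), (6, 1), (10, 2)),
    ((2, 0), (10, 3), (12, 3))]

theorem famS1_ok : famS1.check = true := by decide +kernel

def famS2 : Fam where
  n := (24, 13)
  lo := (0, 1)
  hi := (12, 6)
  cnt := (4, 2)
  k0 := 1
  holes := []
  nests := [((0, 2), (10, 3), (1, -1)),
    ((2, 0), (9, 4), (1, 1)),
    ((0, 3), (6, 2), (1, -1)),
    ((2, 3), (5, 1), (1, 0))]
  spor := [((2, 1), (10, 4), (12, 5)),
    ((0, 1), (5, 2), (5, 3)),
    ((6, 3), (6, 4), (12, 6))]

theorem famS2_ok : famS2.check = true := by decide +kernel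

def famS3 : Fam where
  n := (24, 19)
  lo := (0, 1)
  hi := (12, 9)
  cnt := (4, 3)
  k0 := 1
  holes := []
  nests := [((0, 4), (10, 2), (1, -1)),
    ((2, 2), (9, 3), (1, -1)),
    ((0, 3), (6, 2), (1, -1)),
    ((2, 3), (5, 2), (1, 0))]
  spor := [((5, 3), (7, 4), (12, 7)),
    ((4, 0), (6, 4), (10, 4)),
    ((4, 2), (6, 3), (10, 5)),
    ((2, 1), (10, 3), (12, 4)),
    ((0, 1), (12, 5), (12, 6)),
    ((0, 2), (12, 8), (12, 9))]

theorem famS3_ok : famS3.check = true := by decide +kernel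

def famP3a : Fam where
  n := (24, -3)
  lo := (0, 1)
  hi := (12, -2)
  cnt := (4, -1)
  k0 := 1
  holes := [(8, -1)]
  nests := [((0, 2), (6, -2), (1, -1)),
    ((2, 2), (5, -2), (1, -1)),
    ((0, 1), (10, -2), (1, 0)),
    ((2, 1), (9, -2), (1, -1))]
  spor := [((2, 0), (4, -1), (6, -1)),
    ((5, -1), (7, -1), (12, -2))]

theorem famP3a_ok : famP3a.check = true := by decide +kernel

def famP3b : Fam where
  n := (24, 3)
  lo := (0, 1)
  hi := (12, 1)
  cnt := (4, 0)
  k0 := 1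
  holes := [(8, 1)]
  nests := [((0, 2), (6, 0), (1, -1)),
    ((2, 2), (5, 0), (1, -1)),
    ((0, 1), (10, 2), (1, 0)),
    ((2, 3), (9, 0), (1, -1))]
  spor := [((2, 1), (4, 0), (6, 1)),
    ((4, 1), (5, 1), (9, 2)),
    ((2, 0), (7, 1), (9, 1))]

theorem famP3b_ok : famP3b.check = true := by decide +kernel

def famP3c : Fam where
  n := (24, 9)
  lo := (0, 1)
  hi := (12, 4)
  cnt := (4, 1)
  k0 := 1
  holes := [(8, 3)]
  nests := [((0, 2), (10, 3), (1, 0)),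
    ((2, 2), (9, 3), (1, 0)),
    ((0, 3), (6, 1), (1, -1)),
    ((2, 3), (5, 0), (1, -1))]
  spor := [((2, 1), (4, 1), (6, 2)),
    ((0, 1), (5, 1), (5, 2)),
    ((6, 3), (8, 2), (10, 4))]

theorem famP3c_ok : famP3c.check = true := by decide +kernel

def famP3d : Fam where
  n := (24, 15)
  lo := (0, 1)
  hi := (12, 7)
  cnt := (4, 2)
  k0 := 1
  holes := [(8, 5)]
  nests := [((0, 4), (10, 3), (1, -1)),
    ((2, 2), (9, 4), (1, -1)),
    ((0, 3), (6, 3), (1, -1)),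
    ((2, 3), (5, 2), (1, 0))]
  spor := [((0, 1), (5, 3), (5, 4)),
    ((4, 2), (6, 4), (10, 6)),
    ((4, 0), (6, 5), (10, 5)),
    ((2, 1), (10, 4), (12, 5)),
    ((0, 2), (12, 6), (12, 7))]

theorem famP3d_ok : famP3d.check = true := by decide +kernel

def famP6a : Fam where
  n := (24, 0)
  lo := (0, 1)
  hi := (12, -1)
  cnt := (4, -1)
  k0 := 1
  holes := [(4, 0), (8, 0)]
  nests := [((0, 2), (6, 0), (1, -1)),
    ((2, 2), (5, -1), (1, -1)),
    ((0, 3), (10, -2), (1, -1)),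
    ((2, 1), (9, -1), (1, -1))]
  spor := [((2, 0), (10, -1), (12, -1)),
    ((0, 1), (5, 0), (5, 1)),
    ((4, -1), (6, 1), (10, 0))]

theorem famP6a_ok : famP6a.check = true := by decide +kernel

def famP6b : Fam where
  n := (24, 6)
  lo := (0, 1)
  hi := (12, 2)
  cnt := (4, 0)
  k0 := 1
  holes := [(4, 1), (8, 2)]
  nests := [((0, 2), (10, 2), (1, -1)),
    ((2, 2), (9, 2), (1, -1)),
    ((0, 1), (6, 1), (1, 0)),
    ((2, 1), (5, 1), (1, 0))]
  spor := [((4, 0), (9, 3), (11, 3)),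
    ((2, 0), (8, 3), (10, 3))]

theorem famP6b_ok : famP6b.check = true := by decide +kernel

def famP4 : Fam where
  n := (24, 4)
  lo := (0, 1)
  hi := (12, 1)
  cnt := (4, 0)
  k0 := 0
  holes := [(6, 1)]
  nests := [((0, 2), (6, 0), (1, 0)),
    ((2, 2), (5, 0), (1, 0)),
    ((0, 1), (10, 1), (1, 0)),
    ((2, 1), (9, 1), (1, 0))]
  spor := []

theorem famP4_ok : famP4.check = true := by decide +kernel

def famP12 : Fam where
  n := (24, 12)
  lo := (0, 1)
  hi := (12, 5)
  cnt := (4, 0)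
  k0 := 2
  holes := [(2, 1), (4, 2), (6, 3), (8, 4), (10, 5)]
  nests := [((0, 2), (6, 2), (1, 0)),
    ((2, 2), (5, 2), (1, 0)),
    ((0, 3), (10, 4), (1, -2)),
    ((2, 3), (9, 3), (1, -1))]
  spor := [((4, 1), (9, 6), (11, 5)),
    ((0, 1), (9, 4), (9, 5)),
    ((2, -1), (10, 6), (12, 5))]

theorem famP12_ok : famP12.check = true := by decide +kernel

def famP24 : Fam where
  n := (96, -24)
  lo := (0, 1)
  hi := (48, -13)
  cnt := (16, -8)
  k0 := 2
  holes := [(4, -1), (8, -2), (12, -3), (16, -4), (20, -5), (24, -6), (28, -7), (32, -8), (36, -9), (40, -10), (44, -11)]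
  nests := [((0, 4), (24, -7), (2, -2)),
    ((4, 2), (22, -6), (2, -3)),
    ((8, 0), (20, -6), (2, -1)),
    ((12, 0), (18, -6), (2, -3)),
    ((0, 3), (40, -12), (2, -2)),
    ((4, 1), (38, -11), (2, -2)),
    ((8, 1), (36, -10), (2, -2)),
    ((12, -1), (34, -9), (2, -2))]
  spor := [((8, -1), (12, -2), (20, -3)),
    ((4, 0), (20, -4), (24, -4)),
    ((16, -5), (34, -8), (46, -11)),
    ((0, 1), (8, -4), (8, -3)),
    ((18, -5), (26, -5), (44, -10)),
    ((0, 2), (32, -9), (32, -7)),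
    ((16, -6), (24, -5), (40, -11)),
    ((16, -3), (38, -10), (42, -11)),
    ((22, -5), (30, -7), (44, -12))]

theorem famP24_ok : famP24.check = true := by decide +kernel

def famP8 : Fam where
  n := (96, -40)
  lo := (0, 1)
  hi := (48, -21)
  cnt := (16, -8)
  k0 := 1
  holes := [(12, -5), (24, -10), (36, -15)]
  nests := [((0, 2), (24, -11), (2, -1)),
    ((4, 0), (22, -10), (2, -1)),
    ((8, 0), (20, -10), (2, -2)),
    ((12, -4), (18, -8), (2, -1)),
    ((0, 3), (40, -18), (2, -2)),
    ((4, 1), (38, -17), (2, -2)),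
    ((8, -1), (36, -17), (2, -2)),
    ((12, -3), (34, -15), (2, -2))]
  spor := [((8, -2), (20, -9), (28, -11)),
    ((8, -3), (32, -13), (40, -16)),
    ((0, 1), (46, -20), (46, -19)),
    ((16, -7), (38, -16), (42, -17)),
    ((4, -1), (36, -16), (40, -17))]

theorem famP8_ok : famP8.check = true := by decide +kernel

def famL3 : Fam where
  n := (0, 0)
  lo := (0, 3)
  hi := (12, 2)
  cnt := (4, 0)
  k0 := 2
  holes := []
  nests := [((0, 4), (6, -1), (1, -2)),
    ((2, 2), (5, 0), (1, -1)),
    ((0, 3), (10, 0), (1, -1)),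
    ((2, 1), (9, 1), (1, 0))]
  spor := [((5, 1), (7, 1), (12, 2)),
    ((4, 0), (6, 2), (10, 2)),
    ((4, 1), (6, 0), (10, 1)),
    ((2, 0), (6, 1), (8, 1))]

theorem famL3_ok : famL3.check = true := by decide +kernel

def famH3 : Fam where
  n := (24, 17)
  lo := (0, 3)
  hi := (12, 8)
  cnt := (4, 2)
  k0 := 2
  holes := []
  nests := [((0, 4), (10, 1), (1, -1)),
    ((2, 2), (9, 2), (1, 0)),
    ((0, 5), (6, 0), (1, -2)),
    ((2, 3), (5, 1), (1, -1))]
  spor := [((4, 1), (6, 1), (10, 2)),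
    ((2, 1), (10, 3), (12, 4)),
    ((4, 2), (6, 2), (10, 4)),
    ((5, 2), (7, 3), (12, 5)),
    ((0, 3), (12, 6), (12, 8)),
    ((6, 3), (6, 4), (12, 7))]

theorem famH3_ok : famH3.check = true := by decide +kernel

def famL4 : Fam where
  n := (0, 0)
  lo := (0, 4)
  hi := (12, 3)
  cnt := (4, 0)
  k0 := 2
  holes := []
  nests := [((0, 4), (10, -2), (1, -1)),
    ((2, 2), (9, -1), (1, 0)),
    ((0, 5), (6, -2), (1, -2)),
    ((2, 3), (5, -1), (1, -2))]
  spor := [((4, -1), (6, 0), (10, -1)),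
    ((6, 1), (6, 2), (12, 3)),
    ((4, 1), (6, -1), (10, 0)),
    ((2, 1), (10, 1), (12, 2)),
    ((5, 0), (7, 1), (12, 1))]

theorem famL4_ok : famL4.check = true := by decide +kernel

def famH4 : Fam where
  n := (24, 19)
  lo := (0, 4)
  hi := (12, 9)
  cnt := (4, 2)
  k0 := 2
  holes := []
  nests := [((0, 6), (10, 3), (1, -2)),
    ((2, 2), (9, 5), (1, -2)),
    ((0, 5), (6, 2), (1, -2)),
    ((2, 3), (5, 3), (1, 0))]
  spor := [((5, 4), (7, 5), (12, 9)),
    ((4, -2), (8, 7), (12, 5)),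
    ((0, 4), (10, 4), (10, 8)),
    ((4, 0), (8, 6), (12, 6)),
    ((6, 5), (6, 6), (12, 8)),
    ((4, 2), (6, 3), (10, 5)),
    ((2, 1), (10, 6), (12, 7)),
    ((4, 3), (6, 4), (10, 7))]

theorem famH4_ok : famH4.check = true := by decide +kernel

def famL6 : Fam where
  n := (0, 0)
  lo := (0, 6)
  hi := (12, 5)
  cnt := (4, 0)
  k0 := 3
  holes := []
  nests := [((0, 6), (10, 0), (1, -2)),
    ((2, 4), (9, 1), (1, -2)),
    ((0, 7), (6, -1), (1, -3)),
    ((2, 3), (5, 1), (1, -3))]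
  spor := [((2, 2), (9, 2), (11, 4)),
    ((5, 2), (7, 3), (12, 5)),
    ((4, -3), (6, 4), (10, 1)),
    ((4, 0), (6, 5), (10, 5)),
    ((4, 4), (6, 0), (10, 4)),
    ((4, 3), (8, 1), (12, 4)),
    ((4, -1), (6, 3), (10, 2)),
    ((4, 2), (6, 1), (10, 3)),
    ((4, 1), (8, 2), (12, 3)),
    ((2, 1), (6, 2), (8, 3))]

theorem famL6_ok : famL6.check = true := by decide +kernel

def famH6 : Fam where
  n := (24, 23)
  lo := (0, 6)
  hi := (12, 11)
  cnt := (4, 2)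
  k0 := 3
  holes := []
  nests := [((0, 8), (6, 0), (1, -3)),
    ((2, 4), (5, 2), (1, -3)),
    ((0, 7), (10, 1), (1, -3)),
    ((2, 3), (9, 3), (1, -1))]
  spor := [((2, 1), (9, 4), (11, 5)),
    ((5, 3), (7, 5), (12, 8)),
    ((4, 0), (6, 2), (10, 2)),
    ((4, -2), (6, 5), (10, 3)),
    ((4, 5), (8, 4), (12, 9)),
    ((4, 3), (6, 3), (10, 6)),
    ((2, 2), (10, 4), (12, 6)),
    ((4, 1), (6, 6), (10, 7)),
    ((4, 2), (8, 3), (12, 5)),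
    ((4, 4), (6, 1), (10, 5)),
    ((0, 6), (12, 7), (12, 10)),
    ((6, 4), (6, 7), (12, 11))]

theorem famH6_ok : famH6.check = true := by decide +kernel

def famL7 : Fam where
  n := (0, 0)
  lo := (0, 7)
  hi := (12, 6)
  cnt := (4, 0)
  k0 := 4
  holes := []
  nests := [((0, 8), (6, -3), (1, -4)),
    ((2, 4), (5, 0), (1, -3)),
    ((0, 7), (10, -2), (1, -4)),
    ((2, 3), (9, 2), (1, -1))]
  spor := [((4, 0), (6, -1), (10, -1)),
    ((4, -2), (7, 3), (11, 1)),
    ((4, 2), (6, -2), (10, 0)),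
    ((4, 1), (7, 2), (11, 3)),
    ((5, 1), (6, 1), (11, 2)),
    ((4, 3), (7, 1), (11, 4)),
    ((2, 0), (8, 1), (10, 1)),
    ((6, 0), (6, 4), (12, 4)),
    ((2, -1), (8, 3), (10, 2)),
    ((6, 2), (6, 3), (12, 5)),
    ((2, 1), (8, 2), (10, 3)),
    ((2, 2), (10, 4), (12, 6))]

theorem famL7_ok : famL7.check = true := by decide +kernel

def famH7 : Fam where
  n := (24, 25)
  lo := (0, 7)
  hi := (12, 12)
  cnt := (4, 2)
  k0 := 4
  holes := []
  nests := [((0, 10), (6, 0), (1, -4)),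
    ((2, 4), (5, 4), (1, -1)),
    ((0, 7), (10, 4), (1, -3)),
    ((2, 3), (9, 6), (1, -1))]
  spor := [((4, 1), (7, 7), (11, 8)),
    ((2, 1), (7, 6), (9, 7)),
    ((0, 8), (12, 8), (12, 9)),
    ((4, 5), (6, 1), (10, 6)),
    ((4, 3), (6, 2), (10, 5)),
    ((4, 4), (6, 3), (10, 7)),
    ((2, 2), (10, 8), (12, 10)),
    ((4, 2), (6, 7), (10, 9)),
    ((6, 8), (8, 7), (10, 10)),
    ((6, 4), (6, 9), (12, 12)),
    ((6, 5), (6, 6), (12, 11))]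

theorem famH7_ok : famH7.check = true := by decide +kernel

/-! ### Finite certificates -/

theorem Cov.half {n : ℤ} {S : ℤ → Prop} {t : ℕ} (hn : 0 < n) (hneg : ∀ z, S z → S (-z))
    (hper : ∀ z k, S z → S (z + n * k)) (h : Cov n (fun z => 1 ≤ z ∧ 2 * z ≤ n ∧ S z) t) :
    Cov n (fun z => S z ∧ ¬ n ∣ z) t := by
  obtain ⟨L, hL, hc⟩ := h
  refine ⟨L, hL, ?_⟩
  rintro z ⟨hz, hz0⟩
  have h0 := Int.emod_nonneg z hn.ne'
  have h1 := Int.emod_lt_of_pos z hn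
  have h2 := Int.emod_add_mul_ediv z n
  have h3 : z % n ≠ 0 := fun h => hz0 (Int.dvd_of_emod_eq_zero h)
  by_cases h4 : 2 * (z % n) ≤ n
  · obtain ⟨p, hp, hh⟩ := hc (z % n) ⟨by omega, h4, by
      have := hper z (-(z / n)) hz
      rwa [show z + n * -(z / n) = z % n by linear_combination -h2] at this⟩
    refine ⟨p, hp, ?_⟩
    have key1 : ∀ a, n ∣ z % n - a → n ∣ z - a := by
      rintro a ⟨k, hk⟩; exact ⟨k + z / n, by linear_combination hk - h2⟩
    have key2 : ∀ a, n ∣ z % n + a → n ∣ z + a := by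
      rintro a ⟨k, hk⟩; exact ⟨k + z / n, by linear_combination hk - h2⟩
    rcases hh with (h | h) | (h | h) | (h | h)
    · exact Or.inl (Or.inl (key1 _ h))
    · exact Or.inl (Or.inr (key2 _ h))
    · exact Or.inr (Or.inl (Or.inl (key1 _ h)))
    · exact Or.inr (Or.inl (Or.inr (key2 _ h)))
    · exact Or.inr (Or.inr (Or.inl (key1 _ h)))
    · exact Or.inr (Or.inr (Or.inr (key2 _ h)))
  · obtain ⟨p, hp, hh⟩ := hc (n - z % n) ⟨by omega, by omega, by
      have := hper (-z) (z / n + 1) (hneg z hz)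
      rwa [show -z + n * (z / n + 1) = n - z % n by linear_combination h2] at this⟩
    refine ⟨p, hp, ?_⟩
    have key1 : ∀ a, n ∣ n - z % n - a → n ∣ z + a := by
      rintro a ⟨k, hk⟩; exact ⟨1 - k + z / n, by linear_combination -hk - h2⟩
    have key2 : ∀ a, n ∣ n - z % n + a → n ∣ z - a := by
      rintro a ⟨k, hk⟩; exact ⟨1 - k + z / n, by linear_combination -hk - h2⟩
    rcases hh with (h | h) | (h | h) | (h | h)
    · exact Or.inl (Or.inr (key1 _ h))
    · exact Or.inl (Or.inl (key2 _ h))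
    · exact Or.inr (Or.inl (Or.inr (key1 _ h)))
    · exact Or.inr (Or.inl (Or.inl (key2 _ h)))
    · exact Or.inr (Or.inr (Or.inr (key1 _ h)))
    · exact Or.inr (Or.inr (Or.inl (key2 _ h)))

theorem PP.of_half {g w t : ℕ} (hg : 0 < g) (hw : 0 < w)
    (h : Cov ((g * w : ℕ) : ℤ) (fun z => 1 ≤ z ∧ 2 * z ≤ ((g * w : ℕ) : ℤ) ∧ ¬ (w : ℤ) ∣ z) t)
    (ht : t ≤ g * (w - 1) / 6) : PP g w := by
  have hn : (0 : ℤ) < ((g * w : ℕ) : ℤ) := by exact_mod_cast Nat.mul_pos hg hw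
  have hd : (w : ℤ) ∣ ((g * w : ℕ) : ℤ) := by push_cast; exact Dvd.intro_left _ rfl
  refine (Cov.half hn ?_ ?_ h).mono ?_ ht
  · intro z hz h; exact hz ((dvd_neg).1 h)
  · intro z k hz h
    exact hz ((dvd_add_left (hd.mul_right k)).1 h)
  · intro z hz
    exact ⟨hz, fun h => hz (hd.trans h)⟩

/-- the bits of the elements of the list `X` -/
def bits (X : List ℕ) : ℕ := X.foldr (fun x m => 2 ^ x ||| m) 0

theorem testBit_bits (X : List ℕ) (i : ℕ) : (bits X).testBit i = true ↔ i ∈ X := by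
  induction X with
  | nil => simp [bits]
  | cons x X ih =>
    have : bits (x :: X) = 2 ^ x ||| bits X := rfl
    rw [this, Nat.testBit_or, Bool.or_eq_true, ih, Nat.testBit_two_pow, List.mem_cons]
    simp [eq_comm]

theorem bits_sub {X Y : List ℕ} (h : bits X ||| bits Y = bits Y) {i : ℕ} (hi : i ∈ X) : i ∈ Y := by
  rw [← testBit_bits] at hi ⊢
  rw [← h, Nat.testBit_or, hi, Bool.true_or]

def resid (n : ℕ) (L : List (ℤ × ℤ)) : List ℕ :=
  L.flatMap fun p => [(p.1 % (n : ℤ)).toNat, (-p.1 % (n : ℤ)).toNat, (p.2 % (n : ℤ)).toNat, (-p.2 % (n : ℤ)).toNat,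
    ((p.1 + p.2) % (n : ℤ)).toNat, (-(p.1 + p.2) % (n : ℤ)).toNat]

theorem cov_fin {n t : ℕ} {S : ℤ → Prop} (hn : 0 < n) (X : List ℕ) (L : List (ℤ × ℤ))
    (hX : bits X ||| bits (resid n L) = bits (resid n L)) (hL : L.length ≤ t)
    (hS : ∀ z : ℤ, S z → (z % n).toNat ∈ X) : Cov n S t := by
  refine ⟨L, hL, fun z hz => ?_⟩
  have h := bits_sub hX (hS z hz)
  obtain ⟨p, hp, h⟩ := List.mem_flatMap.1 h
  refine ⟨p, hp, ?_⟩
  have hn' : (n : ℤ) ≠ 0 := by exact_mod_cast hn.ne'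
  have key : ∀ a : ℤ, (z % n).toNat = (a % n).toNat → (n : ℤ) ∣ z - a := by
    intro a h
    have h0 := Int.emod_nonneg z hn'
    have h1 := Int.emod_nonneg a hn'
    exact Int.ModEq.dvd (show a % n = z % n by omega)
  have key2 : ∀ a : ℤ, (z % n).toNat = (-a % n).toNat → (n : ℤ) ∣ z + a := by
    intro a h
    have := key _ h
    rwa [sub_neg_eq_add] at this
  simp only [List.mem_cons, List.not_mem_nil, or_false] at h
  rcases h with h | h | h | h | h | h
  · exact Or.inl (Or.inl (key _ h))
  · exact Or.inl (Or.inr (key2 _ h))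
  · exact Or.inr (Or.inl (Or.inl (key _ h)))
  · exact Or.inr (Or.inl (Or.inr (key2 _ h)))
  · exact Or.inr (Or.inr (Or.inl (key _ h)))
  · exact Or.inr (Or.inr (Or.inr (key2 _ h)))

def nonmult (w N : ℕ) : List ℕ := (List.range N).filter fun x => decide (¬ x % w = 0)

theorem PP.fin {g w : ℕ} (L : List (ℤ × ℤ)) (hg : 0 < g) (hw : 0 < w)
    (hX : bits (nonmult w (g * w)) ||| bits (resid (g * w) L) = bits (resid (g * w) L))
    (hL : L.length ≤ g * (w - 1) / 6) : PP g w := by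
  have hn := Nat.mul_pos hg hw
  refine cov_fin hn _ L hX hL ?_
  intro z hz
  have hn' : (0 : ℤ) < ((g * w : ℕ) : ℤ) := by exact_mod_cast hn
  have h0 := Int.emod_nonneg z hn'.ne'
  have h1 := Int.emod_lt_of_pos z hn'
  simp only [nonmult, List.mem_filter, List.mem_range, decide_eq_true_eq]
  refine ⟨by omega, fun h => hz ?_⟩
  have h2 : ((w : ℕ) : ℤ) ∣ (((z % ((g * w : ℕ) : ℤ)).toNat : ℕ) : ℤ) :=
    Int.natCast_dvd_natCast.2 (Nat.dvd_of_mod_eq_zero h)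
  rw [Int.toNat_of_nonneg h0] at h2
  have h3 := Int.emod_add_mul_ediv z ((g * w : ℕ) : ℤ)
  rw [← h3]
  exact dvd_add h2 (Dvd.dvd.mul_right (by push_cast; exact Dvd.intro_left _ rfl) _)

/-! ### integer labels, with even lifts -/

def absl (L : List (ℤ × ℤ)) : List ℕ :=
  L.flatMap fun p => [p.1.natAbs, p.2.natAbs, (p.1 + p.2).natAbs]

def fbit (F : ℕ) (a : ℤ) : ℤ := if F.testBit a.natAbs then 1 else 0

theorem PP.two {g w : ℕ} (T1 T2 : List (ℤ × ℤ)) (F : ℕ) (hg : g % 2 = 0) (hg0 : 0 < g) (hw : 0 < w)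
    (h1 : bits (nonmult w (g * w / 2)) ||| bits (absl T1) = bits (absl T1))
    (h2 : bits (nonmult w (g * w / 2)) ||| bits (absl T2) = bits (absl T2))
    (f1 : T1.all fun p => decide ((fbit F p.1 + fbit F p.2 + fbit F (p.1 + p.2)) % 2 = 1))
    (f2 : T2.all fun p => decide ((fbit F p.1 + fbit F p.2 + fbit F (p.1 + p.2)) % 2 = 0))
    (t1 : T1.length ≤ g * (w - 1) / 6) (t2 : T2.length ≤ g * (w - 1) / 6)
    (u : ℕ) (hu : u = 1 ∨ (0 < u ∧ u % 2 = 0)) : PP (g * u) w := by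
  let I : ℤ → ℤ × Unit := fun a => (a, ())
  let J : ℤ × ℤ → (ℤ × Unit) × (ℤ × Unit) := fun p => (I p.1, I p.2)
  let S : ℤ × Unit → Prop := fun z => ¬ (w : ℤ) ∣ z.1
  let Lb : List (ℤ × Unit) := (nonmult w (g * w / 2)).map fun (x : ℕ) => I (x : ℤ)
  have hn0 := Nat.mul_pos hg0 hw
  have hn : (0 : ℤ) < ((g * w : ℕ) : ℤ) := by exact_mod_cast hn0
  have hd : (w : ℤ) ∣ ((g * w : ℕ) : ℤ) := by push_cast; exact Dvd.intro_left _ rfl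
  have hhalf : g * w = 2 * (g / 2 * w) := by
    rw [← mul_assoc, Nat.mul_div_cancel' (Nat.dvd_of_mod_eq_zero hg)]
  have hhd : g * w / 2 = g / 2 * w := by rw [hhalf]; simp
  have hlab : ∀ T : List (ℤ × ℤ), bits (nonmult w (g * w / 2)) ||| bits (absl T) = bits (absl T) →
      ∀ l ∈ Lb, ∃ p ∈ T.map J, Lab p l := by
    intro T hT l hl
    obtain ⟨x, hx, rfl⟩ := List.mem_map.1 hl
    obtain ⟨p, hp, h⟩ := List.mem_flatMap.1 (bits_sub hT hx)
    refine ⟨J p, List.mem_map_of_mem hp, ?_⟩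
    have key : ∀ a : ℤ, x = a.natAbs → I x = I a ∨ I x = -I a := by
      intro a ha
      have : (x : ℤ) = a ∨ (x : ℤ) = -a := by omega
      rcases this with h | h
      · left; rw [h]
      · right; rw [h]; rfl
    simp only [List.mem_cons, List.not_mem_nil, or_false] at h
    rcases h with h | h | h
    · exact Or.inl (key _ h)
    · exact Or.inr (Or.inl (key _ h))
    · exact Or.inr (Or.inr (key _ h))
  have hS : ∀ z, S z → ∃ l ∈ Lb, HitE ((g * w : ℕ) : ℤ) l z := by
    rintro ⟨z, c⟩ hz
    have h0 := Int.emod_nonneg z hn.ne'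
    have h1 := Int.emod_lt_of_pos z hn
    have h2 := Int.emod_add_mul_ediv z ((g * w : ℕ) : ℤ)
    set n : ℤ := ((g * w : ℕ) : ℤ) with hnn
    have hmem : ∀ x : ℤ, 0 ≤ x → 2 * x < n → ¬ (w : ℤ) ∣ x → I x ∈ Lb := by
      intro x hx0 hx1 hx2
      refine List.mem_map.2 ⟨x.toNat, ?_, by rw [Int.toNat_of_nonneg hx0]⟩
      simp only [nonmult, List.mem_filter, List.mem_range, decide_eq_true_eq]
      refine ⟨by omega, fun h => hx2 ?_⟩
      have := Int.natCast_dvd_natCast.2 (Nat.dvd_of_mod_eq_zero h)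
      rwa [Int.toNat_of_nonneg hx0] at this
    have hr : ¬ (w : ℤ) ∣ z % n := by
      intro h
      apply hz
      change (w : ℤ) ∣ z
      rw [← h2]
      exact dvd_add h (hd.mul_right _)
    by_cases h4 : 2 * (z % n) < n
    · exact ⟨I (z % n), hmem _ h0 h4 hr, Or.inl ⟨⟨z / n, by simp only [I]; linear_combination -h2⟩, rfl⟩⟩
    · have hne : 2 * (z % n) ≠ n := by
        intro h
        have h5 : z % n = ((g / 2 * w : ℕ) : ℤ) := by omega
        apply hr
        rw [h5]; push_cast; exact Dvd.intro_left _ rfl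
      refine ⟨I (n - z % n), hmem _ (by omega) (by omega) ?_, Or.inr ⟨⟨z / n + 1, ?_⟩, rfl⟩⟩
      · intro h
        exact hr ((dvd_sub_right hd).1 h)
      · simp only [I]; linear_combination -h2
  have fin : ∀ {u t : ℕ}, u * (g * (w - 1) / 6) ≤ g * u * (w - 1) / 6 → CovA (((g * w : ℕ) : ℤ) * u) S t →
      t ≤ u * (g * (w - 1) / 6) → PP (g * u) w := by
    intro u t hut h ht
    have := CovA.hom (n' := ((g * u * w : ℕ) : ℤ)) (e := 1) (0 : Unit →+ ℤ) h
      (by push_cast; exact ⟨1, by ring⟩)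
    refine this.mono ?_ (ht.trans hut)
    intro z hz
    exact ⟨(z, ()), hz, by simp⟩
  have hle : ∀ u, u * (g * (w - 1) / 6) ≤ g * u * (w - 1) / 6 := by
    intro u
    rw [Nat.le_div_iff_mul_le (by norm_num)]
    calc u * (g * (w - 1) / 6) * 6 = u * (g * (w - 1) / 6 * 6) := by ring
      _ ≤ u * (g * (w - 1)) := Nat.mul_le_mul_left _ (Nat.div_mul_le_self _ _)
      _ = _ := by ring
  rcases hu with rfl | ⟨hu0, hu⟩
  · refine fin (t := g * (w - 1) / 6) (hle 1) ?_ (by omega)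
    have := one_sys (n := ((g * w : ℕ) : ℤ)) (t := g * (w - 1) / 6) S Lb (T1.map J) hS (hlab T1 h1)
      (by simpa using t1)
    simpa using this
  · refine fin (t := u * (g * (w - 1) / 6)) (hle u) ?_ le_rfl
    have hv : (2 : ℤ) * ((u / 2 : ℕ) : ℤ) = (u : ℤ) := by omega
    have := two_sys (n := ((g * w : ℕ) : ℤ)) (v := ((u / 2 : ℕ) : ℤ)) (t := g * (w - 1) / 6)
      (by omega) S Lb (T1.map J) (T2.map J) (fun a => fbit F a.1) ?_ hS (hlab T1 h1) (hlab T2 h2)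
      ?_ ?_ (by simpa using t1) (by simpa using t2)
    · rw [hv] at this
      simpa using this
    · intro a; simp [fbit]
    · intro p hp
      obtain ⟨q, hq, rfl⟩ := List.mem_map.1 hp
      exact of_decide_eq_true (List.all_eq_true.1 f1 q hq)
    · intro p hp
      obtain ⟨q, hq, rfl⟩ := List.mem_map.1 hp
      exact of_decide_eq_true (List.all_eq_true.1 f2 q hq)

/-! ### The basic families -/

theorem PP.of_fam (d : Fam) (h : d.check = true) (k : ℤ) (hk : d.k0 ≤ k) {g w : ℕ} (hg : 0 < g)
    (hw : 0 < w) (hn : ev d.n k = 0 ∨ ev d.n k = ((g * w : ℕ) : ℤ)) (hlo : ev d.lo k = 1)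
    (hhi : ∀ z : ℤ, 2 * z ≤ ((g * w : ℕ) : ℤ) → ¬ (w : ℤ) ∣ z → z ≤ ev d.hi k)
    (hholes : ∀ x ∈ d.holes, (w : ℤ) ∣ ev x k)
    (hcnt : (ev d.cnt k).toNat ≤ g * (w - 1) / 6) : PP g w := by
  refine PP.of_half hg hw (t := (ev d.cnt k).toNat) ?_ hcnt
  have h1 := d.sound h k hk
  have h2 := Cov.hom (n' := ((g * w : ℕ) : ℤ)) (c := 1) h1 (by
    rcases hn with h | h <;> rw [h] <;> simp)
  refine h2.mono ?_ le_rfl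
  rintro z ⟨hz1, hz2, hz3⟩
  refine ⟨z, ⟨by omega, hhi z hz2 hz3, ?_⟩, by simp⟩
  rintro x hx rfl
  exact hz3 (hholes x hx)

theorem PP1 {t : ℕ} (ht : 0 < t) : PP 1 (6 * t + 1) := by
  by_cases h3 : t < 4
  · interval_cases t
    · exact PP.fin [(1, 2)] (by norm_num) (by norm_num) (by decide +kernel) (by decide)
    · exact PP.fin [(1, 3), (2, 5)] (by norm_num) (by norm_num) (by decide +kernel) (by decide)
    · exact PP.fin [(1, 5), (2, 8), (3, 4)] (by norm_num) (by norm_num) (by decide +kernel)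
        (by decide)
  obtain ⟨k, r, hr, hk, rfl⟩ : ∃ k r : ℕ, r < 4 ∧ 1 ≤ k ∧ t = 4 * k + r :=
    ⟨t / 4, t % 4, by omega, by omega, by omega⟩
  have hk' : (1 : ℤ) ≤ k := by exact_mod_cast hk
  interval_cases r
  · refine PP.of_fam famS0 famS0_ok k hk' one_pos (by omega) (Or.inl ?_) ?_ ?_ ?_ ?_ <;>
      simp only [famS0, ev]
    · simp
    · simp
    · intro z hz _; push_cast at hz; omega
    · simp
    · omega
  · refine PP.of_fam famS1 famS1_ok k hk' one_pos (by omega) (Or.inl ?_) ?_ ?_ ?_ ?_ <;>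
      simp only [famS1, ev]
    · simp
    · simp
    · intro z hz _; push_cast at hz; omega
    · simp
    · omega
  · refine PP.of_fam famS2 famS2_ok k hk' one_pos (by omega) (Or.inr ?_) ?_ ?_ ?_ ?_ <;>
      simp only [famS2, ev]
    · push_cast; ring
    · simp
    · intro z hz _; push_cast at hz; omega
    · simp
    · omega
  · refine PP.of_fam famS3 famS3_ok k hk' one_pos (by omega) (Or.inr ?_) ?_ ?_ ?_ ?_ <;>
      simp only [famS3, ev]
    · push_cast; ring
    · simp
    · intro z hz _; push_cast at hz; omega
    · simp
    · omega

theorem PP2 {l : ℕ} (hl : 0 < l) (h : l % 4 = 0 ∨ l % 4 = 1) : PP 2 (3 * l + 1) := by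
  by_cases h3 : l < 4
  · have : l = 1 := by omega
    subst this
    exact PP.fin [(1, 2)] (by norm_num) (by norm_num) (by decide +kernel) (by decide)
  have key : ∀ z : ℤ, 2 * z ≤ ((2 * (3 * l + 1) : ℕ) : ℤ) → ¬ ((3 * l + 1 : ℕ) : ℤ) ∣ z →
      z ≤ 3 * (l : ℤ) := by
    intro z hz h
    push_cast at hz h
    by_contra h'
    have : z = 3 * (l : ℤ) + 1 := by omega
    exact h (by rw [this])
  rcases h with h | h
  · obtain ⟨k, rfl⟩ : ∃ k, l = 4 * k := ⟨l / 4, by omega⟩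
    refine PP.of_fam famS0 famS0_ok k (show (1 : ℤ) ≤ k by omega) two_pos (by omega) (Or.inl ?_)
      ?_ ?_ ?_ ?_ <;> simp only [famS0, ev]
    · simp
    · simp
    · intro z hz hz'
      have := key z hz hz'
      push_cast at this; omega
    · simp
    · omega
  · obtain ⟨k, rfl⟩ : ∃ k, l = 4 * k + 1 := ⟨l / 4, by omega⟩
    refine PP.of_fam famS1 famS1_ok k (show (1 : ℤ) ≤ k by omega) two_pos (by omega) (Or.inl ?_)
      ?_ ?_ ?_ ?_ <;> simp only [famS1, ev]
    · simp
    · simp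
    · intro z hz hz'
      have := key z hz hz'
      push_cast at this; omega
    · simp
    · omega

theorem hole_dvd {w : ℕ} {x : LForm} {k : ℤ} (i : ℤ) (h : ev x k = i * (w : ℤ)) :
    (w : ℤ) ∣ ev x k := ⟨i, by rw [h, mul_comm]⟩

theorem PP3 {w : ℕ} (hw : 5 ≤ w) (h : w % 2 = 1) : PP 3 w := by
  by_cases h5 : w = 5
  · subst h5
    exact PP.fin [(1, 3), (2, 6)] (by norm_num) (by norm_num) (by decide +kernel) (by decide)
  have key : ∀ z : ℤ, 2 * z ≤ ((3 * w : ℕ) : ℤ) → ¬ (w : ℤ) ∣ z → 2 * z ≤ 3 * (w : ℤ) := by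
    intro z hz _
    push_cast at hz; exact hz
  obtain ⟨k, r, hr, hk, hw'⟩ : ∃ (k : ℕ) (r : ℕ), r < 4 ∧ 1 ≤ k ∧ w + 1 = 8 * k + 2 * r :=
    ⟨(w + 1) / 8, (w + 1) % 8 / 2, by omega, by omega, by omega⟩
  have hk' : (1 : ℤ) ≤ k := by exact_mod_cast hk
  have hwz : (w : ℤ) = 8 * k + 2 * r - 1 := by omega
  interval_cases r
  · refine PP.of_fam famP3a famP3a_ok k hk' three_pos (by omega) (Or.inr ?_) ?_ ?_ ?_ ?_ <;>
      simp only [famP3a, List.forall_mem_cons]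
    · simp only [ev]; push_cast; rw [hwz]; ring
    · simp [ev]
    · intro z hz hz'; have := key z hz hz'; simp only [ev]; omega
    · exact ⟨hole_dvd 1 (by rw [hwz]; simp only [ev]; push_cast; ring), by simp⟩
    · simp only [ev]; omega
  · refine PP.of_fam famP3b famP3b_ok k hk' three_pos (by omega) (Or.inr ?_) ?_ ?_ ?_ ?_ <;>
      simp only [famP3b, List.forall_mem_cons]
    · simp only [ev]; push_cast; rw [hwz]; push_cast; ring
    · simp [ev]
    · intro z hz hz'; have := key z hz hz'; simp only [ev]; omega
    · exact ⟨hole_dvd 1 (by rw [hwz]; simp only [ev]; push_cast; ring), by simp⟩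
    · simp only [ev]; omega
  · refine PP.of_fam famP3c famP3c_ok k hk' three_pos (by omega) (Or.inr ?_) ?_ ?_ ?_ ?_ <;>
      simp only [famP3c, List.forall_mem_cons]
    · simp only [ev]; push_cast; rw [hwz]; push_cast; ring
    · simp [ev]
    · intro z hz hz'; have := key z hz hz'; simp only [ev]; omega
    · exact ⟨hole_dvd 1 (by rw [hwz]; simp only [ev]; push_cast; ring), by simp⟩
    · simp only [ev]; omega
  · refine PP.of_fam famP3d famP3d_ok k hk' three_pos (by omega) (Or.inr ?_) ?_ ?_ ?_ ?_ <;>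
      simp only [famP3d, List.forall_mem_cons]
    · simp only [ev]; push_cast; rw [hwz]; push_cast; ring
    · simp [ev]
    · intro z hz hz'; have := key z hz hz'; simp only [ev]; omega
    · exact ⟨hole_dvd 1 (by rw [hwz]; simp only [ev]; push_cast; ring), by simp⟩
    · simp only [ev]; omega

/-- for even `g` the middle element is a multiple of `w` -/
theorem half_key {g w h : ℕ} (hg : g = 2 * h) (z : ℤ) (hz : 2 * z ≤ ((g * w : ℕ) : ℤ))
    (hz' : ¬ (w : ℤ) ∣ z) : z ≤ h * (w : ℤ) - 1 := by
  subst hg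
  push_cast at hz
  by_contra h'
  have h1 : z = (h : ℤ) * w := by
    have : 2 * (h : ℤ) * w = 2 * ((h : ℤ) * w) := by ring
    omega
  exact hz' (by rw [h1]; exact Dvd.intro_left _ rfl)

theorem PP6 {w : ℕ} (hw : 4 ≤ w) (h : w % 4 = 0 ∨ w % 4 = 1) : PP 6 w := by
  have key := half_key (g := 6) (w := w) (h := 3) rfl
  rcases h with h | h
  · obtain ⟨k, hk⟩ : ∃ k : ℕ, w = 4 * k := ⟨w / 4, by omega⟩
    have hwz : (w : ℤ) = 4 * k := by omega
    refine PP.of_fam famP6a famP6a_ok k (show (1 : ℤ) ≤ k by omega) (by norm_num) (by omega)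
      (Or.inr ?_) ?_ ?_ ?_ ?_ <;> simp only [famP6a, List.forall_mem_cons]
    · simp only [ev]; push_cast; rw [hwz]; ring
    · simp [ev]
    · intro z hz hz'; have := key z hz hz'; simp only [ev]; push_cast at this; omega
    · exact ⟨hole_dvd 1 (by rw [hwz]; simp only [ev]; push_cast; ring),
        hole_dvd 2 (by rw [hwz]; simp only [ev]; push_cast; ring), by simp⟩
    · simp only [ev]; omega
  · obtain ⟨k, hk⟩ : ∃ k : ℕ, w = 4 * k + 1 := ⟨w / 4, by omega⟩
    have hwz : (w : ℤ) = 4 * k + 1 := by omega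
    refine PP.of_fam famP6b famP6b_ok k (show (1 : ℤ) ≤ k by omega) (by norm_num) (by omega)
      (Or.inr ?_) ?_ ?_ ?_ ?_ <;> simp only [famP6b, List.forall_mem_cons]
    · simp only [ev]; push_cast; rw [hwz]; ring
    · simp [ev]
    · intro z hz hz'; have := key z hz hz'; simp only [ev]; push_cast at this; omega
    · exact ⟨hole_dvd 1 (by rw [hwz]; simp only [ev]; push_cast; ring),
        hole_dvd 2 (by rw [hwz]; simp only [ev]; push_cast; ring), by simp⟩
    · simp only [ev]; omega

theorem PP4 {k : ℕ} : PP 4 (6 * k + 1) := by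
  have key := half_key (g := 4) (w := 6 * k + 1) (h := 2) rfl
  refine PP.of_fam famP4 famP4_ok k (show (0 : ℤ) ≤ k by omega) (by norm_num) (by omega)
    (Or.inr ?_) ?_ ?_ ?_ ?_ <;> simp only [famP4, List.forall_mem_cons]
  · simp only [ev]; push_cast; ring
  · simp [ev]
  · intro z hz hz'; have := key z hz hz'; simp only [ev]; push_cast at this; omega
  · exact ⟨hole_dvd 1 (by simp only [ev]; push_cast; ring), by simp⟩
  · simp only [ev]; omega

theorem PP12 {w : ℕ} (hw : 5 ≤ w) (h : w % 2 = 1) : PP 12 w := by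
  have key := half_key (g := 12) (w := w) (h := 6) rfl
  obtain ⟨k, hk⟩ : ∃ k : ℕ, w = 2 * k + 1 := ⟨w / 2, by omega⟩
  have hwz : (w : ℤ) = 2 * k + 1 := by omega
  refine PP.of_fam famP12 famP12_ok k (show (2 : ℤ) ≤ k by omega) (by norm_num) (by omega)
    (Or.inr ?_) ?_ ?_ ?_ ?_ <;> simp only [famP12, List.forall_mem_cons]
  · simp only [ev]; push_cast; rw [hwz]; ring
  · simp [ev]
  · intro z hz hz'; have := key z hz hz'; simp only [ev]; push_cast at this; omega
  · refine ⟨hole_dvd 1 ?_, hole_dvd 2 ?_, hole_dvd 3 ?_, hole_dvd 4 ?_, hole_dvd 5 ?_, by simp⟩ <;>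
      (rw [hwz]; simp only [ev]; push_cast; ring)
  · simp only [ev]; omega

theorem PP24 {w : ℕ} (hw : 7 ≤ w) (h : w % 4 = 3) : PP 24 w := by
  have key := half_key (g := 24) (w := w) (h := 12) rfl
  obtain ⟨k, hk⟩ : ∃ k : ℕ, w + 1 = 4 * k := ⟨(w + 1) / 4, by omega⟩
  have hwz : (w : ℤ) = 4 * k - 1 := by omega
  refine PP.of_fam famP24 famP24_ok k (show (2 : ℤ) ≤ k by omega) (by norm_num) (by omega)
    (Or.inr ?_) ?_ ?_ ?_ ?_ <;> simp only [famP24, List.forall_mem_cons]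
  · simp only [ev]; push_cast; rw [hwz]; ring
  · simp [ev]
  · intro z hz hz'; have := key z hz hz'; simp only [ev]; push_cast at this; omega
  · refine ⟨hole_dvd 1 ?_, hole_dvd 2 ?_, hole_dvd 3 ?_, hole_dvd 4 ?_, hole_dvd 5 ?_,
      hole_dvd 6 ?_, hole_dvd 7 ?_, hole_dvd 8 ?_, hole_dvd 9 ?_, hole_dvd 10 ?_,
      hole_dvd 11 ?_, by simp⟩ <;>
      (rw [hwz]; simp only [ev]; push_cast; ring)
  · simp only [ev]; omega

theorem PP8 {w : ℕ} (h : w % 12 = 7) : PP 8 w := by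
  have key := half_key (g := 8) (w := w) (h := 4) rfl
  obtain ⟨k, hk⟩ : ∃ k : ℕ, w + 5 = 12 * k := ⟨(w + 5) / 12, by omega⟩
  have hwz : (w : ℤ) = 12 * k - 5 := by omega
  refine PP.of_fam famP8 famP8_ok k (show (1 : ℤ) ≤ k by omega) (by norm_num) (by omega)
    (Or.inr ?_) ?_ ?_ ?_ ?_ <;> simp only [famP8, List.forall_mem_cons]
  · simp only [ev]; push_cast; rw [hwz]; ring
  · simp [ev]
  · intro z hz hz'; have := key z hz hz'; simp only [ev]; push_cast at this; omega
  · refine ⟨hole_dvd 1 ?_, hole_dvd 2 ?_, hole_dvd 3 ?_, by simp⟩ <;>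
      (rw [hwz]; simp only [ev]; push_cast; ring)
  · simp only [ev]; omega

/-! ### Certificates for small even quotients -/

theorem PP12_6 (u : ℕ) (hu : u = 1 ∨ (0 < u ∧ u % 2 = 0)) : PP (12 * u) 6 :=
  PP.two
    [(35, -28), (33, 1), (21, 11), (31, -26), (16, 4), (29, -15), (10, 13), (8, -17), (25, 2),
     (3, -22)]
    [(32, 3), (19, 15), (5, -33), (25, -26), (14, -22), (27, -31), (10, -17), (16, -29),
     (21, -23), (20, -9)]
    58653869056
    (by norm_num) (by norm_num) (by norm_num) (by decide +kernel) (by decide +kernel)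
    (by decide +kernel) (by decide +kernel) (by decide +kernel) (by decide +kernel) u hu

theorem PP12_8 (u : ℕ) (hu : u = 1 ∨ (0 < u ∧ u % 2 = 0)) : PP (12 * u) 8 :=
  PP.two
    [(47, -6), (17, 28), (46, -27), (39, -42), (37, -14), (43, 1), (34, -36), (35, -4),
     (26, -33), (10, 12), (9, 21), (11, 18), (38, -25), (20, -5)]
    [(46, -33), (4, 43), (42, -45), (35, 9), (38, -37), (28, -30), (23, 11), (7, -25), (6, -21),
     (19, 20), (41, -12), (36, -10), (17, -31), (22, 5)]
    20858446807040
    (by norm_num) (by norm_num) (by norm_num) (by decide +kernel) (by decide +kernel)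
    (by decide +kernel) (by decide +kernel) (by decide +kernel) (by decide +kernel) u hu

theorem PP12_12 (u : ℕ) (hu : u = 1 ∨ (0 < u ∧ u % 2 = 0)) : PP (12 * u) 12 :=
  PP.two
    [(71, -33), (43, 27), (2, -68), (51, -69), (64, -53), (39, -67), (10, 55), (1, -59),
     (62, -57), (49, -52), (15, 30), (21, 40), (13, 31), (7, -54), (14, 32), (63, -37),
     (34, -56), (20, -16), (29, -35), (23, -42), (17, -25), (9, -50)]
    [(71, -5), (51, 19), (68, -28), (44, -69), (62, -41), (35, 32), (65, -58), (34, 30),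
     (61, -18), (8, -63), (46, -57), (54, -45), (56, -59), (27, 23), (42, -26), (52, -13),
     (38, -37), (53, -22), (2, -17), (49, -20), (6, 4), (14, -47)]
    3675822876740400709632
    (by norm_num) (by norm_num) (by norm_num) (by decide +kernel) (by decide +kernel)
    (by decide +kernel) (by decide +kernel) (by decide +kernel) (by decide +kernel) u hu

theorem PP12_18 (u : ℕ) (hu : u = 1 ∨ (0 < u ∧ u % 2 = 0)) : PP (12 * u) 18 :=
  PP.two
    [(107, -32), (42, 64), (10, 95), (38, 66), (27, 76), (101, -3), (99, -20), (82, 15),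
     (26, 74), (19, -88), (22, 80), (94, -93), (37, 49), (63, -92), (45, 51), (91, -84),
     (8, -89), (30, -70), (60, -77), (57, 11), (61, 24), (14, -73), (2, -67), (33, -83),
     (55, -43), (71, -58), (23, 16), (52, -48), (41, -46), (21, -56), (31, -78), (6, -34),
     (62, 25), (9, -53)]
    [(66, -107), (80, 26), (105, -45), (93, -104), (4, 99), (78, 22), (29, -102), (76, -97),
     (39, 59), (58, -92), (40, -101), (64, 32), (91, -42), (95, -27), (46, 43), (12, 82),
     (88, -50), (83, -52), (3, 84), (30, -74), (35, 28), (51, 19), (53, -86), (25, 37), (8, -85),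
     (6, 75), (20, -15), (67, -57), (1, -14), (2, -71), (16, 7), (24, 55), (48, -65), (9, -56)]
    188142959775564700510903062233088
    (by norm_num) (by norm_num) (by norm_num) (by decide +kernel) (by decide +kernel)
    (by decide +kernel) (by decide +kernel) (by decide +kernel) (by decide +kernel) u hu

theorem PP4_46 (u : ℕ) (hu : u = 1 ∨ (0 < u ∧ u % 2 = 0)) : PP (4 * u) 46 :=
  PP.two
    [(43, 47), (73, 18), (66, -88), (89, -77), (72, 15), (38, 48), (83, -55), (58, -82),
     (85, -52), (84, -9), (53, 25), (79, -30), (35, -80), (32, -74), (19, 50), (76, -59),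
     (41, 40), (56, 4), (61, 6), (63, 8), (36, -62), (70, -65), (16, -39), (29, -31), (57, 11),
     (20, 1), (27, -13), (10, -64), (37, -34), (7, 44)]
    [(49, -90), (57, 34), (43, 45), (53, 36), (77, -85), (87, -82), (84, -6), (14, 66), (74, 7),
     (50, 26), (61, 25), (83, -31), (22, -73), (30, 40), (54, 15), (79, -32), (28, -67), (59, 4),
     (44, -68), (3, -75), (65, -9), (62, 2), (60, -18), (35, -55), (29, -10), (13, -12),
     (21, 37), (71, -23), (27, -38), (16, 17)]
    1290146659637804801147797504
    (by norm_num) (by norm_num) (by norm_num) (by decide +kernel) (by decide +kernel)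
    (by decide +kernel) (by decide +kernel) (by decide +kernel) (by decide +kernel) u hu

theorem PP12_38 (u : ℕ) (hu : u = 1 ∨ (0 < u ∧ u % 2 = 0)) : PP (12 * u) 38 :=
  PP.two
    [(4, 112), (6, 111), (8, 110), (10, 109), (12, 108), (14, 107), (16, 106), (18, 105),
     (20, 104), (22, 103), (24, 102), (26, 101), (28, 100), (30, 99), (32, 98), (34, 97),
     (36, 96), (40, 93), (42, 92), (44, 91), (46, 90), (48, 89), (50, 88), (52, 87), (54, 86),
     (56, 85), (58, 84), (60, 83), (62, 82), (64, 81), (66, 80), (68, 79), (70, 78), (72, 77),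
     (5, 187), (7, 186), (9, 185), (11, 184), (13, 183), (15, 182), (17, 181), (19, 180),
     (21, 179), (23, 178), (25, 177), (27, 176), (29, 175), (31, 174), (33, 173), (35, 172),
     (41, 170), (43, 169), (45, 168), (47, 167), (49, 166), (51, 165), (53, 164), (55, 163),
     (57, 162), (59, 161), (61, 160), (63, 159), (65, 158), (67, 157), (69, 156), (71, 155),
     (73, 154), (1, 74), (94, 115), (95, 113), (39, 171), (37, 151), (2, 189), (3, 150)]
    [(4, 188), (6, 187), (8, 186), (10, 185), (12, 184), (14, 183), (16, 182), (18, 181),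
     (20, 180), (22, 179), (24, 178), (26, 177), (28, 176), (30, 175), (32, 174), (34, 173),
     (40, 169), (42, 168), (44, 167), (46, 166), (48, 165), (50, 164), (52, 163), (54, 162),
     (56, 161), (58, 160), (60, 159), (62, 158), (64, 157), (66, 156), (68, 155), (70, 154),
     (72, 153), (3, 113), (5, 112), (7, 111), (9, 110), (11, 109), (13, 108), (15, 107),
     (17, 106), (19, 105), (21, 104), (23, 103), (25, 102), (27, 101), (29, 100), (31, 99),
     (33, 98), (35, 97), (39, 94), (41, 93), (43, 92), (45, 91), (47, 90), (49, 89), (51, 88),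
     (53, 87), (55, 86), (57, 85), (59, 84), (61, 83), (63, 82), (65, 81), (67, 80), (69, 79),
     (71, 78), (73, 77), (2, 170), (37, 171), (74, 115), (36, 191), (1, 95), (75, 151)]
    335501238566891092198109826655124133857687846358664373754726780502016
    (by norm_num) (by norm_num) (by norm_num) (by decide +kernel) (by decide +kernel)
    (by decide +kernel) (by decide +kernel) (by decide +kernel) (by decide +kernel) u hu

theorem PP12_74 (u : ℕ) (hu : u = 1 ∨ (0 < u ∧ u % 2 = 0)) : PP (12 * u) 74 :=
  PP.two
    [(4, 220), (6, 219), (8, 218), (10, 217), (12, 216), (14, 215), (16, 214), (18, 213),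
     (20, 212), (22, 211), (24, 210), (26, 209), (28, 208), (30, 207), (32, 206), (34, 205),
     (36, 204), (38, 203), (40, 202), (42, 201), (44, 200), (46, 199), (48, 198), (50, 197),
     (52, 196), (54, 195), (56, 194), (58, 193), (60, 192), (62, 191), (64, 190), (66, 189),
     (68, 188), (70, 187), (72, 186), (76, 183), (78, 182), (80, 181), (82, 180), (84, 179),
     (86, 178), (88, 177), (90, 176), (92, 175), (94, 174), (96, 173), (98, 172), (100, 171),
     (102, 170), (104, 169), (106, 168), (108, 167), (110, 166), (112, 165), (114, 164),
     (116, 163), (118, 162), (120, 161), (122, 160), (124, 159), (126, 158), (128, 157),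
     (130, 156), (132, 155), (134, 154), (136, 153), (138, 152), (140, 151), (142, 150),
     (144, 149), (5, 367), (7, 366), (9, 365), (11, 364), (13, 363), (15, 362), (17, 361),
     (19, 360), (21, 359), (23, 358), (25, 357), (27, 356), (29, 355), (31, 354), (33, 353),
     (35, 352), (37, 351), (39, 350), (41, 349), (43, 348), (45, 347), (47, 346), (49, 345),
     (51, 344), (53, 343), (55, 342), (57, 341), (59, 340), (61, 339), (63, 338), (65, 337),
     (67, 336), (69, 335), (71, 334), (77, 332), (79, 331), (81, 330), (83, 329), (85, 328),
     (87, 327), (89, 326), (91, 325), (93, 324), (95, 323), (97, 322), (99, 321), (101, 320),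
     (103, 319), (105, 318), (107, 317), (109, 316), (111, 315), (113, 314), (115, 313),
     (117, 312), (119, 311), (121, 310), (123, 309), (125, 308), (127, 307), (129, 306),
     (131, 305), (133, 304), (135, 303), (137, 302), (139, 301), (141, 300), (143, 299),
     (145, 298), (1, 146), (184, 223), (185, 221), (75, 333), (73, 295), (2, 369), (3, 294)]
    [(4, 368), (6, 367), (8, 366), (10, 365), (12, 364), (14, 363), (16, 362), (18, 361),
     (20, 360), (22, 359), (24, 358), (26, 357), (28, 356), (30, 355), (32, 354), (34, 353),
     (36, 352), (38, 351), (40, 350), (42, 349), (44, 348), (46, 347), (48, 346), (50, 345),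
     (52, 344), (54, 343), (56, 342), (58, 341), (60, 340), (62, 339), (64, 338), (66, 337),
     (68, 336), (70, 335), (76, 331), (78, 330), (80, 329), (82, 328), (84, 327), (86, 326),
     (88, 325), (90, 324), (92, 323), (94, 322), (96, 321), (98, 320), (100, 319), (102, 318),
     (104, 317), (106, 316), (108, 315), (110, 314), (112, 313), (114, 312), (116, 311),
     (118, 310), (120, 309), (122, 308), (124, 307), (126, 306), (128, 305), (130, 304),
     (132, 303), (134, 302), (136, 301), (138, 300), (140, 299), (142, 298), (144, 297),
     (3, 221), (5, 220), (7, 219), (9, 218), (11, 217), (13, 216), (15, 215), (17, 214),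
     (19, 213), (21, 212), (23, 211), (25, 210), (27, 209), (29, 208), (31, 207), (33, 206),
     (35, 205), (37, 204), (39, 203), (41, 202), (43, 201), (45, 200), (47, 199), (49, 198),
     (51, 197), (53, 196), (55, 195), (57, 194), (59, 193), (61, 192), (63, 191), (65, 190),
     (67, 189), (69, 188), (71, 187), (75, 184), (77, 183), (79, 182), (81, 181), (83, 180),
     (85, 179), (87, 178), (89, 177), (91, 176), (93, 175), (95, 174), (97, 173), (99, 172),
     (101, 171), (103, 170), (105, 169), (107, 168), (109, 167), (111, 166), (113, 165),
     (115, 164), (117, 163), (119, 162), (121, 161), (123, 160), (125, 159), (127, 158),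
     (129, 157), (131, 156), (133, 155), (135, 154), (137, 153), (139, 152), (141, 151),
     (143, 150), (145, 149), (2, 332), (73, 333), (146, 223), (72, 371), (1, 185), (147, 295)]
    35332437986463462963329763896808778959300063367475668099586050342993508459099976759201313688374423616519300510141257352510553089638400
    (by norm_num) (by norm_num) (by norm_num) (by decide +kernel) (by decide +kernel)
    (by decide +kernel) (by decide +kernel) (by decide +kernel) (by decide +kernel) u hu

/-! ### Homogeneous difference matrices with holes -/

instance labDec {A : Type} [AddCommGroup A] [DecidableEq A] (p : (ℤ × A) × (ℤ × A)) (l : ℤ × A) :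
    Decidable (Lab p l) := by unfold Lab; infer_instance

def hd1 : List ((ℤ × ℤ × ℤ) × (ℤ × ℤ × ℤ)) :=
  [((1, 1, 1), (6, 0, -1)),
   ((6, 1, 0), (-5, -1, -1)),
   ((3, 1, 0), (-5, 0, 1)),
   ((-1, 1, 1), (3, 0, -1)),
   ((-2, 0, 1), (-3, -1, -1)),
   ((2, 1, 1), (-1, -1, 0))]

def hd2 : List ((ℤ × ℤ × ℤ) × (ℤ × ℤ × ℤ)) :=
  [((-6, 0, 1), (5, 1, 0)),
   ((-2, 1, 1), (-1, -1, 0)),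
   ((2, 1, 0), (-3, -1, -1)),
   ((3, 1, 0), (-2, -1, -1)),
   ((1, 1, 1), (5, 0, -1)),
   ((7, 1, 0), (-2, 0, 1))]

def hdL : List (ℤ × ℤ × ℤ) :=
  [(1, 1, 0), (2, 1, 0), (3, 1, 0), (5, 1, 0), (6, 1, 0), (7, 1, 0),
   (-6, 0, 1), (-5, 0, 1), (-3, 0, 1), (-2, 0, 1), (-1, 0, 1), (1, 0, 1),
   (-2, 1, 1), (-1, 1, 1), (1, 1, 1), (2, 1, 1), (3, 1, 1), (5, 1, 1)]

def hdF : List (ℤ × ℤ × ℤ) :=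
  [(7, 1, 0), (-3, 0, 1), (1, 0, 1), (-2, 1, 1), (3, 1, 1), (5, 1, 1)]

def hd16 : List ((ℤ × ℤ × ℤ) × (ℤ × ℤ × ℤ)) :=
  [(4, 3), (2, 15), (9, 5), (5, 10), (3, 6), (13, 9), (6, 7), (15, 12), (1, 2), (11, 1), (12, 14), (10, 11), (14, 4), (7, 13)].map fun p => ((p.1, 1, 0), (p.2, 0, 1))

theorem hitE_fin {A : Type} [AddCommGroup A] {q : ℕ} {Lb : List (ℤ × A)} (hq : 0 < q) {z : ℤ × A}
    (h : ∃ l ∈ Lb, (((((z.1 % q).toNat : ℕ) : ℤ) - l.1) % (q : ℤ) = 0 ∧ z.2 = l.2) ∨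
      (((((z.1 % q).toNat : ℕ) : ℤ) + l.1) % (q : ℤ) = 0 ∧ z.2 = -l.2)) :
    ∃ l ∈ Lb, HitE (q : ℤ) l z := by
  obtain ⟨l, hl, h⟩ := h
  have hq' : (0 : ℤ) < q := by exact_mod_cast hq
  have h0 := Int.emod_nonneg z.1 hq'.ne'
  have h2 := Int.emod_add_mul_ediv z.1 (q : ℤ)
  rw [Int.toNat_of_nonneg h0] at h
  refine ⟨l, hl, ?_⟩
  rcases h with ⟨h3, h4⟩ | ⟨h3, h4⟩
  · obtain ⟨k, hk⟩ := Int.dvd_of_emod_eq_zero h3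
    exact Or.inl ⟨⟨k + z.1 / q, by linear_combination hk - h2⟩, h4⟩
  · obtain ⟨k, hk⟩ := Int.dvd_of_emod_eq_zero h3
    exact Or.inr ⟨⟨k + z.1 / q, by linear_combination hk - h2⟩, h4⟩

theorem toNat_emod_lt {q : ℕ} (hq : 0 < q) (z : ℤ) : (z % (q : ℤ)).toNat < q := by
  have hq' : (0 : ℤ) < q := by exact_mod_cast hq
  have h0 := Int.emod_nonneg z hq'.ne'
  have h1 := Int.emod_lt_of_pos z hq'
  omega

def flist {A : Type} [AddCommGroup A] [DecidableEq A] (F : List (ℤ × A)) (a : ℤ × A) : ℤ :=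
  if a ∈ F ∨ -a ∈ F then 1 else 0

theorem flist_neg {A : Type} [AddCommGroup A] [DecidableEq A] (F : List (ℤ × A)) (a : ℤ × A) :
    flist F (-a) = flist F a := by
  simp only [flist, neg_neg, or_comm]

def hdS (h : ℤ) (z : ℤ × ℤ × ℤ) : Prop :=
  ¬ h ∣ z.1 ∧ (z.2 = (1, 0) ∨ z.2 = (0, 1) ∨ z.2 = (1, 1))

theorem hd_cols {z : ℤ × ℤ × ℤ} (h : z.2 = (1, 0) ∨ z.2 = (0, 1) ∨ z.2 = (1, 1)) :
    z.2 ∈ ([(1, 0), (0, 1), (1, 1)] : List (ℤ × ℤ)) := by simpa using h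

theorem hd8_hS : ∀ z, hdS 4 z → ∃ l ∈ hdL, HitE ((8 : ℕ) : ℤ) l z := by
  rintro z ⟨hz1, hz2⟩
  refine hitE_fin (by norm_num) ?_
  have key : ∀ r < 8, r % 4 ≠ 0 → ∀ c ∈ ([(1, 0), (0, 1), (1, 1)] : List (ℤ × ℤ)),
      ∃ l ∈ hdL, (((r : ℕ) : ℤ) - l.1) % ((8 : ℕ) : ℤ) = 0 ∧ c = l.2 := by decide +kernel
  obtain ⟨l, hl, h⟩ := key _ (toNat_emod_lt (by norm_num) z.1) (by omega) _ (hd_cols hz2)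
  exact ⟨l, hl, Or.inl h⟩

theorem hd8 : CovA (2 * 4) (hdS 4) 6 :=
  one_sys (n := ((8 : ℕ) : ℤ)) _ hdL hd1 hd8_hS (by decide +kernel) (by decide)

theorem hd8_lift (v : ℤ) (hv : 0 < v) : CovA (8 * (2 * v)) (hdS 4) ((2 * v).toNat * 6) :=
  two_sys (n := ((8 : ℕ) : ℤ)) hv _ hdL hd1 hd2 (flist hdF) (flist_neg hdF) hd8_hS
    (by decide +kernel) (by decide +kernel) (by decide +kernel) (by decide +kernel)
    (by decide) (by decide)

set_option synthInstance.maxHeartbeats 400000 in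
set_option synthInstance.maxSize 1024 in
theorem hd16_ok : CovA (2 * 8) (hdS 8) 14 := by
  refine ⟨hd16, by decide, ?_⟩
  rintro z ⟨hz1, hz2⟩
  have key : ∀ r < 16, r % 8 ≠ 0 → ∀ c ∈ ([(1, 0), (0, 1), (1, 1)] : List (ℤ × ℤ)),
      ∃ p ∈ hd16, ((((r : ℕ) : ℤ) - p.1.1) % 16 = 0 ∧ c = p.1.2) ∨
        ((((r : ℕ) : ℤ) - p.2.1) % 16 = 0 ∧ c = p.2.2) ∨
        ((((r : ℕ) : ℤ) - (p.1 + p.2).1) % 16 = 0 ∧ c = (p.1 + p.2).2) := by decide +kernel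
  obtain ⟨p, hp, h⟩ := key _ (toNat_emod_lt (q := 16) (by norm_num) z.1) (by omega) _ (hd_cols hz2)
  refine ⟨p, hp, ?_⟩
  have k2 : ∀ a : ℤ, ((((z.1 % ((16 : ℕ) : ℤ)).toNat : ℕ) : ℤ) - a) % 16 = 0 → (2 * 8 : ℤ) ∣ z.1 - a := by
    intro a h; omega
  rcases h with ⟨h1, h2⟩ | ⟨h1, h2⟩ | ⟨h1, h2⟩
  · exact Or.inl (Or.inl ⟨k2 _ h1, h2⟩)
  · exact Or.inr (Or.inl (Or.inl ⟨k2 _ h1, h2⟩))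
  · exact Or.inr (Or.inr (Or.inl ⟨k2 _ h1, h2⟩))

theorem hd_step (v : ℕ) (hv : 0 < v) (h : CovA (2 * ((2 * v : ℕ) : ℤ)) (hdS ((2 * v : ℕ) : ℤ)) (2 * (2 * v) - 2)) :
    CovA (2 * ((8 * v : ℕ) : ℤ)) (hdS ((8 * v : ℕ) : ℤ)) (2 * (8 * v) - 2) := by
  have h1 := hd8_lift (v : ℤ) (by exact_mod_cast hv)
  have h2 := h.scale (c := 4)
  have e1 : (2 : ℤ) * ((8 * v : ℕ) : ℤ) = 8 * (2 * (v : ℤ)) := by push_cast; ring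
  have e2 : (4 : ℤ) * (2 * ((2 * v : ℕ) : ℤ)) = 8 * (2 * (v : ℤ)) := by push_cast; ring
  rw [e1]
  rw [e2] at h2
  refine (h1.union h2).mono ?_ (by omega)
  rintro ⟨r, c⟩ ⟨hz1, hz2⟩
  by_cases h4 : (4 : ℤ) ∣ r
  · obtain ⟨y, rfl⟩ := h4
    refine Or.inr ⟨y, rfl, ?_, hz2⟩
    rintro ⟨k, hk⟩
    exact hz1 ⟨k, by simp only at hk ⊢; rw [hk]; push_cast; ring⟩
  · exact Or.inl ⟨h4, hz2⟩

theorem hd_all (j : ℕ) : CovA (2 * ((4 * 2 ^ j : ℕ) : ℤ)) (hdS ((4 * 2 ^ j : ℕ) : ℤ)) (2 * (4 * 2 ^ j) - 2) := by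
  induction j using Nat.strong_induction_on with
  | _ j ih =>
    match j with
    | 0 => exact hd8
    | 1 => exact hd16_ok
    | j + 2 =>
      have := hd_step (2 * 2 ^ j) (by positivity) (by
        have := ih j (by omega)
        rwa [show 2 * (2 * 2 ^ j) = 4 * 2 ^ j by ring])
      rwa [show 8 * (2 * 2 ^ j) = 4 * 2 ^ (j + 2) by ring] at this

/-! ### Lifting the outer part -/

def Xset (N d : ℤ) (z : ℤ) : Prop := ∀ c, -d < c → c < d → ¬ N ∣ z - c

theorem Cov.big {α : Type} {n : ℤ} {t : ℕ} (L : List α) (S : α → ℤ → Prop)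
    (h : ∀ p ∈ L, Cov n (S p) t) : Cov n (fun z => ∃ p ∈ L, S p z) (L.length * t) := by
  induction L with
  | nil => exact ⟨[], by simp, fun z hz => by simp at hz⟩
  | cons p L ih =>
    have := (h p List.mem_cons_self).union (ih fun q hq => h q (List.mem_cons_of_mem _ hq))
    refine this.mono ?_ (by rw [List.length_cons]; apply le_of_eq; ring)
    rintro z ⟨q, hq, hz⟩
    rcases List.mem_cons.1 hq with rfl | hq
    · exact Or.inl hz
    · exact Or.inr ⟨q, hq, hz⟩

theorem crt_pair {q N : ℤ} (h : IsCoprime q N) : ∃ e f : ℤ, q * N ∣ q * e ∧ ∀ z c r : ℤ, q ∣ z - r → N ∣ z - c →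
    q * N ∣ z - (e * r + f * c) := by
  obtain ⟨a, b, hab⟩ := h
  refine ⟨b * N, a * q, ⟨b, by ring⟩, ?_⟩
  rintro z c r ⟨k, hk⟩ ⟨l, hl⟩
  refine ⟨b * k + a * l, ?_⟩
  linear_combination z * (-hab) + b * N * hk + a * q * hl

def lin2 (f a b : ℤ) : ℤ × ℤ →+ ℤ where
  toFun c := f * (c.1 * a + c.2 * b)
  map_zero' := by simp
  map_add' x y := by simp only [Prod.fst_add, Prod.snd_add]; ring

theorem CovA.symm {A : Type} [AddCommGroup A] {n : ℤ} {S : ℤ × A → Prop} {t : ℕ} (h : CovA n S t) :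
    CovA n (fun z => S z ∨ S (-z)) t := by
  obtain ⟨L, hL, hc⟩ := h
  refine ⟨L, hL, ?_⟩
  rintro z (hz | hz)
  · exact hc z hz
  · obtain ⟨p, hp, hh⟩ := hc _ hz
    exact ⟨p, hp, hh.neg⟩

theorem Xlift {N d : ℤ} {t : ℕ} (hN : N % 2 = 1) (h1 : Cov N (Xset N d) t)
    (h2 : Cov (2 * N) (Xset N d) (2 * t)) (j : ℕ) :
    Cov (((8 * 2 ^ j : ℕ) : ℤ) * N) (Xset N d) (8 * 2 ^ j * t) := by
  obtain ⟨L, hL, hc⟩ := h1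
  have hh := (hd_all j).symm
  set h : ℤ := ((4 * 2 ^ j : ℕ) : ℤ) with hdef
  have hq : ((8 * 2 ^ j : ℕ) : ℤ) = 2 * h := by rw [hdef]; push_cast; ring
  have cop : IsCoprime (2 * h) N := by
    have h2N : IsCoprime (2 : ℤ) N := ⟨-(N / 2), 1, by omega⟩
    have : 2 * h = 2 ^ (j + 3) := by rw [hdef]; push_cast; ring
    rw [this]
    exact h2N.pow_left
  rw [hq]
  -- rows not divisible by `h`
  obtain ⟨e, f, he, hef⟩ := crt_pair cop
  have c1 := Cov.big (n := 2 * h * N) (t := 2 * (4 * 2 ^ j) - 2) L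
    (fun p z => ¬ h ∣ z ∧ Hit N p z) (by
      intro p hp
      have := CovA.hom (n' := 2 * h * N) (lin2 f p.1 p.2) hh he
      refine this.mono ?_ le_rfl
      rintro z ⟨hz, hhit⟩
      have hz' : ¬ h ∣ -z := fun h => hz ((dvd_neg).1 h)
      rcases hhit with (k | k) | (k | k) | (k | k)
      · refine ⟨(z, (1, 0)), Or.inl ⟨hz, by simp⟩, ?_⟩
        have := hef z p.1 z (by simp) k
        simpa [lin2] using this
      · refine ⟨(z, -(1, 0)), Or.inr ⟨hz', by simp⟩, ?_⟩
        have := hef z (-p.1) z (by simp) (by simpa using k)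
        simpa [lin2] using this
      · refine ⟨(z, (0, 1)), Or.inl ⟨hz, by simp⟩, ?_⟩
        have := hef z p.2 z (by simp) k
        simpa [lin2] using this
      · refine ⟨(z, -(0, 1)), Or.inr ⟨hz', by simp⟩, ?_⟩
        have := hef z (-p.2) z (by simp) (by simpa using k)
        simpa [lin2] using this
      · refine ⟨(z, (1, 1)), Or.inl ⟨hz, by simp⟩, ?_⟩
        have := hef z (p.1 + p.2) z (by simp) k
        simpa [lin2] using this
      · refine ⟨(z, -(1, 1)), Or.inr ⟨hz', by simp⟩, ?_⟩
        have := hef z (-(p.1 + p.2)) z (by simp) (by rwa [sub_neg_eq_add])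
        have e' : e * z + (lin2 f p.1 p.2) (-(1, 1)) = e * z + f * -(p.1 + p.2) := by
          simp only [lin2, AddMonoidHom.coe_mk, ZeroHom.coe_mk, Prod.fst_neg, Prod.snd_neg]; ring
        simp only
        rw [e']
        exact this)
  -- rows divisible by `h`
  obtain ⟨a, b, hab⟩ := id cop
  have c2 := Cov.hom (n' := 2 * h * N) (c := h * (2 * a + N)) h2 ⟨2 * a + N, by ring⟩
  refine (c1.union c2).mono ?_ ?_
  · intro z hz
    by_cases hd : h ∣ z
    · right
      obtain ⟨m, hm⟩ := hd
      refine ⟨z + N * (z + m), ?_, ?_⟩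
      · intro c hc1 hc2 hc3
        apply hz c hc1 hc2
        have e' : z - c = z + N * (z + m) - c - N * (z + m) := by ring
        rw [e']
        exact dvd_sub hc3 (Dvd.intro _ rfl)
      · refine IsCoprime.mul_dvd cop ?_ ?_
        · have : (2 : ℤ) ∣ m - (2 * a + N) * (z + N * (z + m)) := by
            obtain ⟨M, hM⟩ : ∃ M, N = 2 * M + 1 := ⟨N / 2, by omega⟩
            rw [hM]
            exact ⟨-a * (z + (2 * M + 1) * (z + m)) - M * (z + (2 * M + 1) * (z + m))
              - z - M * (z + m), by ring⟩
          obtain ⟨k, hk⟩ := this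
          exact ⟨k, by linear_combination hm + h * hk⟩
        · exact ⟨b * z - h * z - (h * (2 * a + N)) * (z + m), by
            linear_combination z * (-hab)⟩
    · left
      obtain ⟨p, hp, hh⟩ := hc z hz
      exact ⟨p, hp, hd, hh⟩
  · have h3 := Nat.mul_le_mul_right (2 * (4 * 2 ^ j) - 2) hL
    have h4 : 0 < 2 ^ j := by positivity
    calc _ ≤ t * (2 * (4 * 2 ^ j) - 2) + 2 * t := Nat.add_le_add_right h3 _
      _ = t * (2 * (4 * 2 ^ j) - 2 + 2) := by ring
      _ = _ := by rw [show 2 * (4 * 2 ^ j) - 2 + 2 = 8 * 2 ^ j by omega]; ring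

/-! ### The outer parts -/

theorem Xset.neg' {N d z : ℤ} (h : Xset N d z) : Xset N d (-z) := by
  intro c h1 h2 h3
  refine h (-c) (by omega) (by omega) ?_
  have := (dvd_neg).2 h3
  rwa [show -(-z - c) = z - -c by ring] at this

theorem Xset.per {N d z M : ℤ} (hM : N ∣ M) (h : Xset N d z) (k : ℤ) : Xset N d (z + M * k) := by
  intro c h1 h2 h3
  refine h c h1 h2 ?_
  have := dvd_sub h3 (hM.mul_right k)
  rwa [show z + M * k - c - M * k = z - c by ring] at this

theorem X_of_fam (F : Fam) (h : F.check = true) (k : ℤ) (hk : F.k0 ≤ k) {N D M : ℤ} {t : ℕ}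
    (hD : 0 < D) (hM0 : 0 < M) (hM : N ∣ M) (hn : ev F.n k = 0 ∨ ev F.n k = M)
    (hlo : ev F.lo k = D) (hhi : ∀ z, 2 * z ≤ M → Xset N D z → z ≤ ev F.hi k)
    (hholes : F.holes = []) (hcnt : (ev F.cnt k).toNat ≤ t) : Cov M (Xset N D) t := by
  have h1 := F.sound h k hk
  have h2 := Cov.hom (n' := M) (c := 1) h1 (by
    rcases hn with h | h <;> rw [h] <;> simp)
  have h3 : Cov M (fun z => 1 ≤ z ∧ 2 * z ≤ M ∧ Xset N D z) t := by
    refine h2.mono ?_ hcnt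
    rintro z ⟨hz1, hz2, hz3⟩
    refine ⟨z, ⟨?_, hhi z hz2 hz3, ?_⟩, by simp⟩
    · rw [hlo]
      by_contra hlt
      exact hz3 z (by omega) (by omega) (by simp)
    · rw [hholes]; simp
  refine (Cov.half hM0 (fun z hz => hz.neg') (fun z k hz => hz.per hM k) h3).mono ?_ le_rfl
  intro z hz
  exact ⟨hz, fun h => hz 0 (by omega) hD (by simpa using hM.trans h)⟩

theorem X1_hi {N D H : ℤ} (hN : N = 2 * H + 1) :
    ∀ z, 2 * z ≤ N → Xset N D z → z ≤ H := by
  intro z hz _; omega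

theorem X2_hi {N D : ℤ} (hD : 0 < D) :
    ∀ z, 2 * z ≤ 2 * N → Xset N D z → z ≤ N - D := by
  intro z hz hx
  by_contra h
  refine hx (z - N) (by omega) (by omega) ?_
  simp

def xres (N D M : ℕ) : List ℕ := (List.range M).filter fun x => decide (D ≤ x % N ∧ x % N + D ≤ N)

theorem X_fin {N D : ℕ} (i : ℕ) {t : ℕ} (L : List (ℤ × ℤ)) (hN : 0 < N) (hi : 0 < i)
    (hX : bits (xres N D (i * N)) ||| bits (resid (i * N) L) = bits (resid (i * N) L))
    (hL : L.length ≤ t) : Cov ((i * N : ℕ) : ℤ) (Xset N D) t := by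
  have hM := Nat.mul_pos hi hN
  refine cov_fin hM _ L hX hL ?_
  intro z hz
  simp only [xres, List.mem_filter, List.mem_range, decide_eq_true_eq]
  refine ⟨toNat_emod_lt hM z, ?_⟩
  have hM' : (0 : ℤ) < ((i * N : ℕ) : ℤ) := by exact_mod_cast hM
  have h0 := Int.emod_nonneg z hM'.ne'
  have h2 := Int.emod_add_mul_ediv z ((i * N : ℕ) : ℤ)
  set x := (z % ((i * N : ℕ) : ℤ)).toNat with hx
  have hx' : (x : ℤ) = z % ((i * N : ℕ) : ℤ) := by rw [hx, Int.toNat_of_nonneg h0]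
  have h3 : (x : ℤ) = ((x % N : ℕ) : ℤ) + N * ((x / N : ℕ) : ℤ) := by
    exact_mod_cast (Nat.mod_add_div x N).symm
  have h4 := Nat.mod_lt x hN
  have hd : ∀ c : ℤ, (N : ℤ) ∣ ((x % N : ℕ) : ℤ) - c → (N : ℤ) ∣ z - c := by
    rintro c ⟨k, hk⟩
    refine ⟨k + ((x / N : ℕ) : ℤ) + i * (z / ((i * N : ℕ) : ℤ)), ?_⟩
    push_cast at h2 hx' hk h3 ⊢
    linear_combination hk + h3 - hx' - h2
  constructor
  · by_contra h
    exact hz ((x % N : ℕ) : ℤ) (by omega) (by omega) (hd _ (by simp))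
  · by_contra h
    refine hz (((x % N : ℕ) : ℤ) - N) (by omega) (by omega) (hd _ ?_)
    simp

def XX (N D t : ℕ) : Prop := Cov (N : ℤ) (Xset N D) t ∧ Cov (2 * (N : ℤ)) (Xset N D) (2 * t)

theorem X1_fin {N D t : ℕ} (L : List (ℤ × ℤ)) (hN : 0 < N)
    (hX : bits (xres N D (1 * N)) ||| bits (resid (1 * N) L) = bits (resid (1 * N) L))
    (hL : L.length ≤ t) : Cov (N : ℤ) (Xset N D) t := by
  have := X_fin 1 L hN one_pos hX hL
  rwa [one_mul] at this

theorem X2_fin {N D t : ℕ} (L : List (ℤ × ℤ)) (hN : 0 < N)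
    (hX : bits (xres N D (2 * N)) ||| bits (resid (2 * N) L) = bits (resid (2 * N) L))
    (hL : L.length ≤ 2 * t) : Cov (2 * (N : ℤ)) (Xset N D) (2 * t) := by
  have := X_fin 2 L hN two_pos hX hL
  push_cast at this
  exact this

theorem XX3 (j : ℕ) : XX (12 * j + 5) 3 (2 * j) := by
  constructor
  · by_cases hs : j < 4
    · interval_cases j
      · exact X1_fin
          []
          (by norm_num) (by decide +kernel) (by decide +kernel)
      · exact X1_fin
          [(3, 5), (4, 6)]
          (by norm_num) (by decide +kernel) (by decide +kernel)
      · exact X1_fin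
          [(5, 8), (3, 6), (7, 10), (4, 11)]
          (by norm_num) (by decide +kernel) (by decide +kernel)
      · exact X1_fin
          [(5, 14), (6, 7), (10, 11), (4, 12), (3, 15), (8, 9)]
          (by norm_num) (by decide +kernel) (by decide +kernel)
    rcases Nat.even_or_odd' j with ⟨k, hk | hk⟩
    · refine X_of_fam famL3 famL3_ok k (show (2 : ℤ) ≤ k by omega) (by norm_num) (by omega)
        dvd_rfl (Or.inl ?_) ?_ (X1_hi ?_) rfl ?_ <;> simp only [famL3, ev]
      · simp
      · simp
      · subst hk; push_cast; ring
      · omega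
    · refine X_of_fam famH3 famH3_ok k (show (2 : ℤ) ≤ k by omega) (by norm_num) (by omega)
        dvd_rfl (Or.inr ?_) ?_ (X1_hi ?_) rfl ?_ <;> simp only [famH3, ev]
      · subst hk; push_cast; ring
      · simp
      · subst hk; push_cast; ring
      · omega
  · by_cases hs : j < 2
    · interval_cases j
      · exact X2_fin
          []
          (by norm_num) (by decide +kernel) (by decide +kernel)
      · exact X2_fin
          [(5, 6), (8, 12), (4, 9), (3, 7)]
          (by norm_num) (by decide +kernel) (by decide +kernel)
    refine X_of_fam famL3 famL3_ok j (show (2 : ℤ) ≤ j by omega) (by norm_num) (by omega)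
      (Dvd.intro_left _ rfl) (Or.inl ?_) ?_ ?_ rfl ?_
    · simp [famL3, ev]
    · simp [famL3, ev]
    · intro z h1 h2
      have := X2_hi (by norm_num) z h1 h2
      simp only [famL3, ev]; push_cast at this; omega
    · simp only [famL3, ev]; omega

theorem XX4 (j : ℕ) (hj1 : j ≠ 1) : XX (12 * j + 7) 4 (2 * j) := by
  constructor
  · by_cases hs : j < 4
    · interval_cases j
      · exact X1_fin
          []
          (by norm_num) (by decide +kernel) (by decide +kernel)
      · omega
      · exact X1_fin
          [(4, 7), (5, 12), (8, 10), (6, 9)]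
          (by norm_num) (by decide +kernel) (by decide +kernel)
      · exact X1_fin
          [(7, 16), (12, 14), (8, 10), (5, 6), (9, 13), (4, 15)]
          (by norm_num) (by decide +kernel) (by decide +kernel)
    rcases Nat.even_or_odd' j with ⟨k, hk | hk⟩
    · refine X_of_fam famL4 famL4_ok k (show (2 : ℤ) ≤ k by omega) (by norm_num) (by omega)
        dvd_rfl (Or.inl ?_) ?_ (X1_hi ?_) rfl ?_ <;> simp only [famL4, ev]
      · simp
      · simp
      · subst hk; push_cast; ring
      · omega
    · refine X_of_fam famH4 famH4_ok k (show (2 : ℤ) ≤ k by omega) (by norm_num) (by omega)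
        dvd_rfl (Or.inr ?_) ?_ (X1_hi ?_) rfl ?_ <;> simp only [famH4, ev]
      · subst hk; push_cast; ring
      · simp
      · subst hk; push_cast; ring
      · omega
  · by_cases hs : j < 1
    · interval_cases j
      · exact X2_fin
          []
          (by norm_num) (by decide +kernel) (by decide +kernel)
    refine X_of_fam famL4 famL4_ok j (show (2 : ℤ) ≤ j by omega) (by norm_num) (by omega)
      (Dvd.intro_left _ rfl) (Or.inl ?_) ?_ ?_ rfl ?_
    · simp [famL4, ev]
    · simp [famL4, ev]
    · intro z h1 h2
      have := X2_hi (by norm_num) z h1 h2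
      simp only [famL4, ev]; push_cast at this; omega
    · simp only [famL4, ev]; omega

theorem XX6 (j : ℕ) (hj1 : j ≠ 1) (hj2 : j ≠ 2) : XX (12 * j + 11) 6 (2 * j) := by
  constructor
  · by_cases hs : j < 6
    · interval_cases j
      · exact X1_fin
          []
          (by norm_num) (by decide +kernel) (by decide +kernel)
      · omega
      · omega
      · exact X1_fin
          [(11, 12), (7, 10), (9, 16), (8, 18), (13, 15), (6, 14)]
          (by norm_num) (by decide +kernel) (by decide +kernel)
      · exact X1_fin
          [(11, 18), (15, 17), (8, 25), (16, 20), (6, 7), (14, 21), (10, 12), (9, 19)]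
          (by norm_num) (by decide +kernel) (by decide +kernel)
      · exact X1_fin
          [(11, 18), (12, 13), (19, 20), (6, 21), (9, 28), (14, 22), (10, 16), (8, 15), (17, 24),
           (7, 31)]
          (by norm_num) (by decide +kernel) (by decide +kernel)
    rcases Nat.even_or_odd' j with ⟨k, hk | hk⟩
    · refine X_of_fam famL6 famL6_ok k (show (3 : ℤ) ≤ k by omega) (by norm_num) (by omega)
        dvd_rfl (Or.inl ?_) ?_ (X1_hi ?_) rfl ?_ <;> simp only [famL6, ev]
      · simp
      · simp
      · subst hk; push_cast; ring
      · omega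
    · refine X_of_fam famH6 famH6_ok k (show (3 : ℤ) ≤ k by omega) (by norm_num) (by omega)
        dvd_rfl (Or.inr ?_) ?_ (X1_hi ?_) rfl ?_ <;> simp only [famH6, ev]
      · subst hk; push_cast; ring
      · simp
      · subst hk; push_cast; ring
      · omega
  · by_cases hs : j < 1
    · interval_cases j
      · exact X2_fin
          []
          (by norm_num) (by decide +kernel) (by decide +kernel)
    refine X_of_fam famL6 famL6_ok j (show (3 : ℤ) ≤ j by omega) (by norm_num) (by omega)
      (Dvd.intro_left _ rfl) (Or.inl ?_) ?_ ?_ rfl ?_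
    · simp [famL6, ev]
    · simp [famL6, ev]
    · intro z h1 h2
      have := X2_hi (by norm_num) z h1 h2
      simp only [famL6, ev]; push_cast at this; omega
    · simp only [famL6, ev]; omega

theorem XX7 (j : ℕ) (hj1 : j ≠ 1) (hj2 : j ≠ 2) : XX (12 * j + 13) 7 (2 * j) := by
  constructor
  · by_cases hs : j < 8
    · interval_cases j
      · exact X1_fin
          []
          (by norm_num) (by decide +kernel) (by decide +kernel)
      · omega
      · omega
      · exact X1_fin
          [(11, 13), (8, 15), (14, 17), (12, 16), (7, 20), (9, 10)]
          (by norm_num) (by decide +kernel) (by decide +kernel)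
      · exact X1_fin
          [(13, 18), (12, 20), (11, 22), (9, 14), (15, 21), (7, 17), (10, 16), (8, 19)]
          (by norm_num) (by decide +kernel) (by decide +kernel)
      · exact X1_fin
          [(13, 18), (8, 20), (14, 19), (17, 27), (11, 24), (10, 12), (15, 26), (16, 21),
           (7, 23), (9, 25)]
          (by norm_num) (by decide +kernel) (by decide +kernel)
      · exact X1_fin
          [(13, 33), (21, 30), (8, 14), (18, 23), (16, 24), (15, 20), (9, 27), (11, 31), (7, 10),
           (12, 26), (19, 29), (25, 28)]
          (by norm_num) (by decide +kernel) (by decide +kernel)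
      · exact X1_fin
          [(13, 33), (21, 24), (14, 20), (22, 36), (29, 31), (11, 16), (7, 28), (12, 42),
           (9, 10), (18, 26), (8, 41), (17, 30), (15, 23), (25, 32)]
          (by norm_num) (by decide +kernel) (by decide +kernel)
    rcases Nat.even_or_odd' j with ⟨k, hk | hk⟩
    · refine X_of_fam famL7 famL7_ok k (show (4 : ℤ) ≤ k by omega) (by norm_num) (by omega)
        dvd_rfl (Or.inl ?_) ?_ (X1_hi ?_) rfl ?_ <;> simp only [famL7, ev]
      · simp
      · simp
      · subst hk; push_cast; ring
      · omega
    · refine X_of_fam famH7 famH7_ok k (show (4 : ℤ) ≤ k by omega) (by norm_num) (by omega)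
        dvd_rfl (Or.inr ?_) ?_ (X1_hi ?_) rfl ?_ <;> simp only [famH7, ev]
      · subst hk; push_cast; ring
      · simp
      · subst hk; push_cast; ring
      · omega
  · by_cases hs : j < 4
    · interval_cases j
      · exact X2_fin
          []
          (by norm_num) (by decide +kernel) (by decide +kernel)
      · omega
      · omega
      · exact X2_fin
          [(14, 19), (10, 16), (18, 38), (8, 17), (12, 15), (20, 21), (24, 34), (11, 28),
           (13, 22), (9, 23), (7, 29), (30, 31)]
          (by norm_num) (by decide +kernel) (by decide +kernel)
    refine X_of_fam famL7 famL7_ok j (show (4 : ℤ) ≤ j by omega) (by norm_num) (by omega)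
      (Dvd.intro_left _ rfl) (Or.inl ?_) ?_ ?_ rfl ?_
    · simp [famL7, ev]
    · simp [famL7, ev]
    · intro z h1 h2
      have := X2_hi (by norm_num) z h1 h2
      simp only [famL7, ev]; push_cast at this; omega
    · simp only [famL7, ev]; omega


/-! ### The inner parts -/

def kS (d : ℤ) (z : ℤ × ℤ) : Prop := (z.2 = 0 ∧ z.1 % 2 = 1) ∨ (1 ≤ z.2 ∧ z.2 < d)

def kA8_3 : List ((ℤ × ℤ) × (ℤ × ℤ)) :=
  [((2, 2), (-3, -2)), ((3, 0), (-4, 2)), ((-2, 1), (3, 1)), ((0, 1), (-3, 1)),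
   ((-1, 1), (0, -2)), ((-4, 1), (2, -2))]

def kB8_3 : List ((ℤ × ℤ) × (ℤ × ℤ)) :=
  [((2, 1), (-3, -2)), ((2, 2), (-1, -2)), ((-2, 2), (2, -1)), ((-3, 2), (3, 0)),
   ((-1, 1), (-3, 1)), ((-1, 2), (-3, -1))]

def kL8_3 : List (ℤ × ℤ) :=
  (([-4, -3, -2, -1, 0, 1, 2, 3] : List ℤ).flatMap fun r =>
    ([1, 2] : List ℤ).map fun c => (r, c)) ++
  ([1, 3] : List ℤ).map fun r => (r, 0)

def kF8_3 : List (ℤ × ℤ) :=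
  [(2, 1), (3, 1), (-3, 2), (-1, 2), (0, 2), (3, 2)]

theorem kh8_3 : ∀ z, kS 3 z → ∃ l ∈ kL8_3, HitE ((8 : ℕ) : ℤ) l z := by
  intro z hz
  refine hitE_fin (by norm_num) ?_
  rcases hz with ⟨h0, h1⟩ | ⟨h1, h2⟩
  · have key : ∀ r < 8, r % 2 = 1 → ∃ l ∈ kL8_3, ((((r : ℕ) : ℤ) - l.1) % ((8 : ℕ) : ℤ) = 0 ∧ 0 = l.2) ∨
      ((((r : ℕ) : ℤ) + l.1) % ((8 : ℕ) : ℤ) = 0 ∧ 0 = -l.2) := by decide +kernel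
    rw [h0]
    exact key _ (toNat_emod_lt (by norm_num) z.1) (by omega)
  · have key : ∀ r < 8, ∀ c < 3, c ≠ 0 →
      ∃ l ∈ kL8_3, (((r : ℕ) : ℤ) - l.1) % ((8 : ℕ) : ℤ) = 0 ∧ ((c : ℕ) : ℤ) = l.2 := by decide +kernel
    obtain ⟨l, hl, h⟩ := key _ (toNat_emod_lt (by norm_num) z.1) z.2.toNat (by omega) (by omega)
    rw [Int.toNat_of_nonneg (a := z.2) (by omega)] at h
    exact ⟨l, hl, Or.inl h⟩

theorem K8_3 (j : ℕ) : CovA (((8 * 2 ^ j : ℕ)) : ℤ) (kS 3) (2 ^ j * 6) := by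
  cases j with
  | zero => exact one_sys (n := ((8 : ℕ) : ℤ)) _ kL8_3 kA8_3 kh8_3 (by decide +kernel) (by decide)
  | succ j =>
    have h := two_sys (n := ((8 : ℕ) : ℤ)) (v := 2 ^ j) (by positivity) _ kL8_3 kA8_3 kB8_3
      (flist kF8_3) (flist_neg kF8_3) kh8_3
      (by decide +kernel) (by decide +kernel) (by decide +kernel) (by decide +kernel)
      (t := 6) (by decide) (by decide)
    have e1 : ((8 : ℕ) : ℤ) * (2 * 2 ^ j) = (((8 * 2 ^ (j + 1) : ℕ)) : ℤ) := by push_cast; ring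
    have e2 : ((2 * 2 ^ j : ℤ)).toNat = 2 ^ (j + 1) := by
      rw [show (2 * 2 ^ j : ℤ) = ((2 ^ (j + 1) : ℕ) : ℤ) by push_cast; ring]; exact Int.toNat_natCast _
    rw [e1, e2] at h
    exact h

def kA8_6 : List ((ℤ × ℤ) × (ℤ × ℤ)) :=
  [((3, 2), (0, 3)), ((3, 4), (-1, -1)), ((-1, 4), (3, 1)), ((-3, 1), (3, 3)),
   ((0, 2), (2, 2)), ((0, 1), (-1, -5)), ((1, 2), (-4, 1)), ((3, 0), (0, -5)),
   ((2, 1), (2, -3)), ((-3, 4), (4, -4)), ((1, 3), (1, -5)), ((-1, 3), (2, -5)),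
   ((-2, 4), (-2, 1)), ((-1, 1), (-3, 2))]

def kB8_6 : List ((ℤ × ℤ) × (ℤ × ℤ)) :=
  [((1, 3), (-3, -5)), ((3, 0), (-3, -4)), ((0, 2), (2, 3)), ((0, 5), (-1, -5)),
   ((2, 4), (1, -1)), ((-2, 2), (-1, -4)), ((0, 1), (-4, 1)), ((3, 1), (-4, 3)),
   ((-3, 3), (-1, 2)), ((2, 1), (2, -5)), ((0, 3), (3, -5)), ((1, 1), (-2, 4)),
   ((1, 2), (-3, 1)), ((-2, 1), (3, -4))]

def kL8_6 : List (ℤ × ℤ) :=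
  (([-4, -3, -2, -1, 0, 1, 2, 3] : List ℤ).flatMap fun r =>
    ([1, 2, 3, 4, 5] : List ℤ).map fun c => (r, c)) ++
  ([1, 3] : List ℤ).map fun r => (r, 0)

def kF8_6 : List (ℤ × ℤ) :=
  [(1, 2), (2, 2), (-4, 3), (-2, 3), (-4, 4), (-2, 4), (-1, 4), (0, 4),
   (3, 4), (-2, 5), (-1, 5), (0, 5), (1, 5), (3, 5)]

theorem kh8_6 : ∀ z, kS 6 z → ∃ l ∈ kL8_6, HitE ((8 : ℕ) : ℤ) l z := by
  intro z hz
  refine hitE_fin (by norm_num) ?_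
  rcases hz with ⟨h0, h1⟩ | ⟨h1, h2⟩
  · have key : ∀ r < 8, r % 2 = 1 → ∃ l ∈ kL8_6, ((((r : ℕ) : ℤ) - l.1) % ((8 : ℕ) : ℤ) = 0 ∧ 0 = l.2) ∨
      ((((r : ℕ) : ℤ) + l.1) % ((8 : ℕ) : ℤ) = 0 ∧ 0 = -l.2) := by decide +kernel
    rw [h0]
    exact key _ (toNat_emod_lt (by norm_num) z.1) (by omega)
  · have key : ∀ r < 8, ∀ c < 6, c ≠ 0 →
      ∃ l ∈ kL8_6, (((r : ℕ) : ℤ) - l.1) % ((8 : ℕ) : ℤ) = 0 ∧ ((c : ℕ) : ℤ) = l.2 := by decide +kernel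
    obtain ⟨l, hl, h⟩ := key _ (toNat_emod_lt (by norm_num) z.1) z.2.toNat (by omega) (by omega)
    rw [Int.toNat_of_nonneg (a := z.2) (by omega)] at h
    exact ⟨l, hl, Or.inl h⟩

theorem K8_6 (j : ℕ) : CovA (((8 * 2 ^ j : ℕ)) : ℤ) (kS 6) (2 ^ j * 14) := by
  cases j with
  | zero => exact one_sys (n := ((8 : ℕ) : ℤ)) _ kL8_6 kA8_6 kh8_6 (by decide +kernel) (by decide)
  | succ j =>
    have h := two_sys (n := ((8 : ℕ) : ℤ)) (v := 2 ^ j) (by positivity) _ kL8_6 kA8_6 kB8_6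
      (flist kF8_6) (flist_neg kF8_6) kh8_6
      (by decide +kernel) (by decide +kernel) (by decide +kernel) (by decide +kernel)
      (t := 14) (by decide) (by decide)
    have e1 : ((8 : ℕ) : ℤ) * (2 * 2 ^ j) = (((8 * 2 ^ (j + 1) : ℕ)) : ℤ) := by push_cast; ring
    have e2 : ((2 * 2 ^ j : ℤ)).toNat = 2 ^ (j + 1) := by
      rw [show (2 * 2 ^ j : ℤ) = ((2 ^ (j + 1) : ℕ) : ℤ) by push_cast; ring]; exact Int.toNat_natCast _
    rw [e1, e2] at h
    exact h

def kA24_4 : List ((ℤ × ℤ) × (ℤ × ℤ)) :=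
  [((11, 3), (-1, -2)), ((10, 2), (0, 1)), ((9, 3), (0, -3)), ((8, 3), (-1, -3)),
   ((11, 2), (-6, -1)), ((5, 2), (-7, -3)), ((9, 1), (-3, 2)), ((5, 3), (6, -2)),
   ((0, 2), (4, 1)), ((8, 2), (3, -3)), ((-2, 2), (-9, -2)), ((4, 2), (-2, 1)),
   ((7, 2), (-4, 1)), ((-2, 3), (8, -1)), ((-1, 3), (-3, 0)), ((2, 2), (5, -1)),
   ((3, 2), (9, -3)), ((-1, 2), (9, -1)), ((5, 0), (7, -2)), ((-11, 2), (1, -1)),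
   ((-5, 3), (-1, 0)), ((-6, 1), (10, -3)), ((-11, 3), (3, -1)), ((-9, 2), (8, -3)),
   ((-10, 2), (7, -3)), ((-12, 3), (5, -2))]

def kB24_4 : List ((ℤ × ℤ) × (ℤ × ℤ)) :=
  [((6, 1), (5, 2)), ((7, 0), (-10, -3)), ((8, 3), (1, 0)), ((11, 2), (-11, -1)),
   ((-6, 1), (-4, -3)), ((1, 1), (-7, -3)), ((-12, 1), (9, 2)), ((8, 2), (-3, 1)),
   ((3, 1), (3, 2)), ((1, 3), (2, -3)), ((-10, 2), (0, -3)), ((-6, 2), (8, -3)),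
   ((0, 2), (-11, 1)), ((-8, 1), (-1, -2)), ((-9, 2), (5, 0)), ((-7, 2), (9, 0)),
   ((-5, 1), (-2, -3)), ((-7, 3), (-4, -1)), ((-1, 1), (-3, 2)), ((-10, 3), (9, -1)),
   ((7, 1), (-12, 2)), ((11, 0), (1, -3)), ((5, 1), (-10, 1)), ((-7, 1), (-2, 2)),
   ((-4, 1), (-4, -2)), ((-8, 2), (6, -3))]

def kL24_4 : List (ℤ × ℤ) :=
  (([-12, -11, -10, -9, -8, -7, -6, -5, -4, -3, -2, -1, 0, 1, 2, 3, 4, 5, 6, 7, 8, 9, 10, 11] : List ℤ).flatMap fun r =>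
    ([1, 2, 3] : List ℤ).map fun c => (r, c)) ++
  ([1, 3, 5, 7, 9, 11] : List ℤ).map fun r => (r, 0)

def kF24_4 : List (ℤ × ℤ) :=
  [(9, 1), (11, 1), (-11, 2), (-8, 2), (-7, 2), (-6, 2), (-2, 2), (-1, 2),
   (1, 2), (2, 2), (6, 2), (7, 2), (8, 2), (10, 2), (11, 2), (-12, 3),
   (-10, 3), (-9, 3), (-8, 3), (-7, 3), (-6, 3), (-1, 3), (2, 3), (4, 3),
   (5, 3), (7, 3), (8, 3), (9, 3)]

theorem kh24_4 : ∀ z, kS 4 z → ∃ l ∈ kL24_4, HitE ((24 : ℕ) : ℤ) l z := by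
  intro z hz
  refine hitE_fin (by norm_num) ?_
  rcases hz with ⟨h0, h1⟩ | ⟨h1, h2⟩
  · have key : ∀ r < 24, r % 2 = 1 → ∃ l ∈ kL24_4, ((((r : ℕ) : ℤ) - l.1) % ((24 : ℕ) : ℤ) = 0 ∧ 0 = l.2) ∨
      ((((r : ℕ) : ℤ) + l.1) % ((24 : ℕ) : ℤ) = 0 ∧ 0 = -l.2) := by decide +kernel
    rw [h0]
    exact key _ (toNat_emod_lt (by norm_num) z.1) (by omega)
  · have key : ∀ r < 24, ∀ c < 4, c ≠ 0 →
      ∃ l ∈ kL24_4, (((r : ℕ) : ℤ) - l.1) % ((24 : ℕ) : ℤ) = 0 ∧ ((c : ℕ) : ℤ) = l.2 := by decide +kernel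
    obtain ⟨l, hl, h⟩ := key _ (toNat_emod_lt (by norm_num) z.1) z.2.toNat (by omega) (by omega)
    rw [Int.toNat_of_nonneg (a := z.2) (by omega)] at h
    exact ⟨l, hl, Or.inl h⟩

theorem K24_4 (j : ℕ) : CovA (((24 * 2 ^ j : ℕ)) : ℤ) (kS 4) (2 ^ j * 26) := by
  cases j with
  | zero => exact one_sys (n := ((24 : ℕ) : ℤ)) _ kL24_4 kA24_4 kh24_4 (by decide +kernel) (by decide)
  | succ j =>
    have h := two_sys (n := ((24 : ℕ) : ℤ)) (v := 2 ^ j) (by positivity) _ kL24_4 kA24_4 kB24_4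
      (flist kF24_4) (flist_neg kF24_4) kh24_4
      (by decide +kernel) (by decide +kernel) (by decide +kernel) (by decide +kernel)
      (t := 26) (by decide) (by decide)
    have e1 : ((24 : ℕ) : ℤ) * (2 * 2 ^ j) = (((24 * 2 ^ (j + 1) : ℕ)) : ℤ) := by push_cast; ring
    have e2 : ((2 * 2 ^ j : ℤ)).toNat = 2 ^ (j + 1) := by
      rw [show (2 * 2 ^ j : ℤ) = ((2 ^ (j + 1) : ℕ) : ℤ) by push_cast; ring]; exact Int.toNat_natCast _
    rw [e1, e2] at h
    exact h

def kA24_7 : List ((ℤ × ℤ) × (ℤ × ℤ)) :=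
  [((11, 6), (-3, 0)), ((10, 6), (-11, -2)), ((-12, 6), (2, -5)), ((5, 3), (-9, -6)),
   ((11, 5), (-3, -3)), ((1, 5), (-10, -5)), ((-4, 4), (11, -6)), ((1, 3), (10, -6)),
   ((-12, 2), (0, 3)), ((-5, 1), (11, 4)), ((-3, 2), (-7, -6)), ((3, 2), (6, 3)),
   ((6, 6), (-10, -1)), ((2, 2), (-11, -3)), ((9, 4), (-4, 1)), ((4, 5), (-5, -6)),
   ((6, 1), (1, 4)), ((8, 5), (3, -4)), ((8, 3), (0, 1)), ((10, 3), (0, -5)),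
   ((7, 4), (-8, 1)), ((5, 4), (-2, 2)), ((-2, 4), (-4, -6)), ((2, 6), (-6, -4)),
   ((5, 2), (4, 1)), ((8, 1), (-7, 5)), ((0, 6), (-7, -2)), ((7, 1), (-10, -2)),
   ((-2, 6), (-4, -2)), ((-1, 6), (-2, -3)), ((-5, 6), (12, -3)), ((4, 4), (5, -2)),
   ((-9, 6), (-3, -5)), ((-1, 3), (3, -6)), ((-1, 1), (4, -6)), ((-5, 5), (7, 0)),
   ((-7, 6), (8, -6)), ((-6, 6), (-2, -4)), ((11, 0), (-8, 4)), ((-9, 4), (11, -5)),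
   ((-9, 2), (11, -1)), ((-6, 2), (-4, 3)), ((5, 0), (5, -4)), ((-9, 5), (-1, -2)),
   ((-9, 3), (9, -1)), ((-7, 3), (8, -5)), ((-8, 3), (-3, 1)), ((-6, 5), (6, -1)),
   ((-6, 3), (11, -2)), ((-7, 1), (12, -4))]

def kB24_7 : List ((ℤ × ℤ) × (ℤ × ℤ)) :=
  [((11, 6), (0, -6)), ((-3, 6), (12, -6)), ((10, 6), (-4, -2)), ((9, 6), (2, -1)),
   ((-1, 1), (-10, -5)), ((-1, 3), (-8, -6)), ((10, 1), (-9, -5)), ((4, 1), (3, 5)),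
   ((8, 1), (-8, -5)), ((-5, 5), (11, 1)), ((-2, 3), (-10, 2)), ((0, 5), (-5, -6)),
   ((3, 0), (-11, -3)), ((10, 2), (-3, 3)), ((4, 6), (3, -5)), ((3, 2), (-10, -4)),
   ((9, 4), (-11, 2)), ((6, 5), (-7, 0)), ((3, 6), (-9, -2)), ((10, 3), (-2, -5)),
   ((2, 6), (3, -2)), ((7, 3), (1, 1)), ((5, 3), (2, 1)), ((2, 3), (-11, -2)),
   ((5, 5), (-1, -2)), ((-10, 1), (4, 5)), ((-1, 6), (7, -5)), ((6, 3), (-5, 1)),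
   ((8, 2), (-1, -6)), ((4, 4), (-5, -2)), ((3, 4), (-3, -3)), ((0, 2), (12, -4)),
   ((6, 2), (-10, 4)), ((-12, 1), (7, -1)), ((1, 5), (-8, 1)), ((-9, 5), (11, -1)),
   ((9, 1), (2, -5)), ((-5, 6), (0, -3)), ((2, 2), (4, -5)), ((-10, 5), (8, -3)),
   ((-9, 3), (8, -6)), ((-9, 2), (-3, 1)), ((-6, 5), (9, -4)), ((-8, 4), (4, -1)),
   ((-2, 4), (8, -5)), ((-10, 3), (-1, 0)), ((-11, 5), (7, -3)), ((-11, 6), (6, -2)),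
   ((-10, 6), (3, -4)), ((-9, 6), (5, -2))]

def kL24_7 : List (ℤ × ℤ) :=
  (([-12, -11, -10, -9, -8, -7, -6, -5, -4, -3, -2, -1, 0, 1, 2, 3, 4, 5, 6, 7, 8, 9, 10, 11] : List ℤ).flatMap fun r =>
    ([1, 2, 3, 4, 5, 6] : List ℤ).map fun c => (r, c)) ++
  ([1, 3, 5, 7, 9, 11] : List ℤ).map fun r => (r, 0)

def kF24_7 : List (ℤ × ℤ) :=
  [(-9, 2), (9, 2), (10, 2), (-12, 3), (-11, 3), (-10, 3), (-9, 3), (-7, 3),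
   (-6, 3), (-5, 3), (-4, 3), (-1, 3), (0, 3), (4, 3), (5, 3), (8, 3),
   (9, 3), (10, 3), (11, 3), (-11, 4), (-8, 4), (-6, 4), (-5, 4), (-1, 4),
   (0, 4), (5, 4), (7, 4), (11, 4), (-11, 5), (-7, 5), (-4, 5), (-3, 5),
   (-2, 5), (2, 5), (3, 5), (4, 5), (5, 5), (7, 5), (8, 5), (9, 5),
   (10, 5), (11, 5), (-11, 6), (-8, 6), (-6, 6), (-1, 6), (0, 6), (2, 6),
   (4, 6), (7, 6), (9, 6), (11, 6)]

theorem kh24_7 : ∀ z, kS 7 z → ∃ l ∈ kL24_7, HitE ((24 : ℕ) : ℤ) l z := by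
  intro z hz
  refine hitE_fin (by norm_num) ?_
  rcases hz with ⟨h0, h1⟩ | ⟨h1, h2⟩
  · have key : ∀ r < 24, r % 2 = 1 → ∃ l ∈ kL24_7, ((((r : ℕ) : ℤ) - l.1) % ((24 : ℕ) : ℤ) = 0 ∧ 0 = l.2) ∨
      ((((r : ℕ) : ℤ) + l.1) % ((24 : ℕ) : ℤ) = 0 ∧ 0 = -l.2) := by decide +kernel
    rw [h0]
    exact key _ (toNat_emod_lt (by norm_num) z.1) (by omega)
  · have key : ∀ r < 24, ∀ c < 7, c ≠ 0 →
      ∃ l ∈ kL24_7, (((r : ℕ) : ℤ) - l.1) % ((24 : ℕ) : ℤ) = 0 ∧ ((c : ℕ) : ℤ) = l.2 := by decide +kernel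
    obtain ⟨l, hl, h⟩ := key _ (toNat_emod_lt (by norm_num) z.1) z.2.toNat (by omega) (by omega)
    rw [Int.toNat_of_nonneg (a := z.2) (by omega)] at h
    exact ⟨l, hl, Or.inl h⟩

theorem K24_7 (j : ℕ) : CovA (((24 * 2 ^ j : ℕ)) : ℤ) (kS 7) (2 ^ j * 50) := by
  cases j with
  | zero => exact one_sys (n := ((24 : ℕ) : ℤ)) _ kL24_7 kA24_7 kh24_7 (by decide +kernel) (by decide)
  | succ j =>
    have h := two_sys (n := ((24 : ℕ) : ℤ)) (v := 2 ^ j) (by positivity) _ kL24_7 kA24_7 kB24_7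
      (flist kF24_7) (flist_neg kF24_7) kh24_7
      (by decide +kernel) (by decide +kernel) (by decide +kernel) (by decide +kernel)
      (t := 50) (by decide) (by decide)
    have e1 : ((24 : ℕ) : ℤ) * (2 * 2 ^ j) = (((24 * 2 ^ (j + 1) : ℕ)) : ℤ) := by push_cast; ring
    have e2 : ((2 * 2 ^ j : ℤ)).toNat = 2 ^ (j + 1) := by
      rw [show (2 * 2 ^ j : ℤ) = ((2 ^ (j + 1) : ℕ) : ℤ) by push_cast; ring]; exact Int.toNat_natCast _
    rw [e1, e2] at h
    exact h

/-! ### Combining inner and outer parts -/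

theorem comb {q N d : ℤ} {a b : ℕ} (cop : IsCoprime q N) (hN : N % 2 = 1)
    (hX : Cov (q * N) (Xset N d) a) (hK : CovA q (kS d) b) :
    Cov (q * N) (fun z => ¬ (2 * N) ∣ z) (a + b) := by
  obtain ⟨e, f, he, hef⟩ := crt_pair cop
  have hk := CovA.hom (n' := q * N) (AddMonoidHom.mulLeft f) hK.symm he
  refine (hX.union hk).mono ?_ le_rfl
  intro z hz
  by_cases hx : Xset N d z
  · exact Or.inl hx
  · right
    simp only [Xset, not_forall, not_not] at hx
    obtain ⟨c, h1, h2, h3⟩ := hx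
    refine ⟨(z, c), ?_, by simpa using hef z c z (by simp) h3⟩
    rcases lt_trichotomy c 0 with h | h | h
    · exact Or.inr (Or.inr ⟨by simp only [Prod.snd_neg]; omega, by simp only [Prod.snd_neg]; omega⟩)
    · refine Or.inl (Or.inl ⟨h, ?_⟩)
      by_contra hodd
      apply hz
      have : (2 : ℤ) ∣ z := by simp only at hodd; omega
      subst h
      refine IsCoprime.mul_dvd ⟨-(N / 2), 1, by omega⟩ this (by simpa using h3)
    · exact Or.inl (Or.inr ⟨by simp only; omega, by simpa using h2⟩)

theorem PP_of_comb {g N q a b : ℕ} (hq : q = 2 * g) (h : Cov ((q : ℤ) * (N : ℤ)) (fun z => ¬ (2 * (N : ℤ)) ∣ z) (a + b))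
    (ht : 6 * (a + b) = g * (2 * N - 1)) : PP g (2 * N) := by
  have e : (((g * (2 * N) : ℕ)) : ℤ) = (q : ℤ) * N := by rw [hq]; push_cast; ring
  unfold PP
  rw [e, ← ht]
  refine h.mono ?_ (by omega)
  intro z hz
  simpa using hz

theorem cop8 {N : ℤ} (hN : N % 2 = 1) (j : ℕ) : IsCoprime (((8 * 2 ^ j : ℕ)) : ℤ) N := by
  have h2N : IsCoprime (2 : ℤ) N := ⟨-(N / 2), 1, by omega⟩
  have : (((8 * 2 ^ j : ℕ)) : ℤ) = 2 ^ (j + 3) := by push_cast; ring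
  rw [this]
  exact h2N.pow_left

theorem cop24 {N : ℤ} (hN : N % 2 = 1) (h3 : N % 3 = 1) (j : ℕ) :
    IsCoprime (((24 * 2 ^ j : ℕ)) : ℤ) N := by
  have h : IsCoprime (3 : ℤ) N := ⟨-(N / 3), 1, by omega⟩
  have : (((24 * 2 ^ j : ℕ)) : ℤ) = 3 * (((8 * 2 ^ j : ℕ)) : ℤ) := by push_cast; ring
  rw [this]
  exact h.mul_left (cop8 hN j)

theorem PP4w {N d t b : ℕ} (hN : N % 2 = 1) (hX : XX N d t)
    (hK : ∀ j : ℕ, CovA (((8 * 2 ^ j : ℕ)) : ℤ) (kS (d : ℤ)) (2 ^ j * b))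
    (ht : 6 * (8 * t + b) = 4 * (2 * N - 1)) (j : ℕ) : PP (4 * 2 ^ j) (2 * N) := by
  have hN' : (N : ℤ) % 2 = 1 := by omega
  refine PP_of_comb (q := 8 * 2 ^ j) (by ring)
    (comb (cop8 hN' j) hN' (Xlift hN' hX.1 hX.2 j) (hK j)) ?_
  calc _ = 2 ^ j * (6 * (8 * t + b)) := by ring
    _ = _ := by rw [ht]; ring

theorem PP12w {N d t b : ℕ} (hN : N % 2 = 1) (hN3 : N % 3 = 1) (hX : XX N d t)
    (hK : ∀ j : ℕ, CovA (((24 * 2 ^ j : ℕ)) : ℤ) (kS (d : ℤ)) (2 ^ j * b))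
    (ht : 6 * (24 * t + b) = 12 * (2 * N - 1)) (j : ℕ) : PP (12 * 2 ^ j) (2 * N) := by
  have hN' : (N : ℤ) % 2 = 1 := by omega
  have hX' := (Xlift hN' hX.1 hX.2 j).lift_odd (u := 3) (by norm_num)
  have e : ((3 : ℕ) : ℤ) * ((((8 * 2 ^ j : ℕ)) : ℤ) * N) = (((24 * 2 ^ j : ℕ)) : ℤ) * N := by
    push_cast; ring
  have hX2 : Cov ((((24 * 2 ^ j : ℕ)) : ℤ) * N) (Xset N d) (3 * (8 * 2 ^ j * t)) := by
    rw [← e]; exact hX'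
  refine PP_of_comb (q := 24 * 2 ^ j) (by ring)
    (comb (cop24 hN' (by omega) j) hN' hX2 (hK j)) ?_
  calc _ = 2 ^ j * (6 * (24 * t + b)) := by ring
    _ = _ := by rw [ht]; ring

/-! ### The case analysis -/

theorem oddA {w : ℕ} (hw : 4 ≤ w) (h6 : w % 6 = 1) (s : ℕ) (hs : s = 1 → w % 4 = 1) :
    PP (2 ^ s) w := by
  induction s using Nat.strong_induction_on with
  | _ s ih =>
    match s with
    | 0 =>
      have := PP1 (t := w / 6) (by omega)
      rwa [show 6 * (w / 6) + 1 = w by omega] at this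
    | 1 =>
      have h4 := hs rfl
      have := PP2 (l := w / 3) (by omega) (by omega)
      rwa [show 3 * (w / 3) + 1 = w by omega] at this
    | 2 =>
      have := PP4 (k := w / 6)
      rwa [show 6 * (w / 6) + 1 = w by omega] at this
    | 3 =>
      by_cases h4 : w % 4 = 1
      · exact (ih 1 (by omega) (fun _ => h4)).quad_g (by norm_num) (by norm_num) (by omega)
      · exact PP8 (by omega)
    | s + 4 =>
      have := (ih (s + 2) (by omega) (by omega)).quad_g
        (by rw [pow_succ]; omega) (by positivity) (by omega)
      rwa [show 4 * 2 ^ (s + 2) = 2 ^ (s + 4) by ring] at this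

theorem oddB {w : ℕ} (hw : 4 ≤ w) (hw2 : w % 2 = 1) (s : ℕ) (hs : s = 1 → w % 4 = 1) :
    PP (3 * 2 ^ s) w := by
  induction s using Nat.strong_induction_on with
  | _ s ih =>
    match s with
    | 0 => exact PP3 (by omega) hw2
    | 1 => exact PP6 hw (Or.inr (hs rfl))
    | 2 => exact PP12 (by omega) hw2
    | 3 =>
      by_cases h4 : w % 4 = 1
      · exact (ih 1 (by omega) (fun _ => h4)).quad_g (by norm_num) (by norm_num) (by omega)
      · exact PP24 (by omega) (by omega)
    | s + 4 =>
      have := (ih (s + 2) (by omega) (by omega)).quad_g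
        (by rw [pow_succ]; omega) (by positivity) (by omega)
      rwa [show 4 * (3 * 2 ^ (s + 2)) = 3 * 2 ^ (s + 4) by ring] at this

theorem pow_u (j : ℕ) : (2 ^ j = 1 ∨ (0 < 2 ^ j ∧ 2 ^ j % 2 = 0)) := by
  cases j with
  | zero => exact Or.inl rfl
  | succ j => exact Or.inr ⟨by positivity, by rw [pow_succ]; omega⟩

theorem w10 (j : ℕ) : PP (4 * 2 ^ j) 10 :=
  PP4w (N := 5) (by norm_num) (XX3 0) K8_3 (by norm_num) j

theorem W1 (s w : ℕ) (hw : 4 ≤ w) (h3 : w % 3 = 1) (h0 : s = 0 → w % 2 = 1)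
    (h1 : s = 1 → w % 4 = 0 ∨ w % 4 = 1) : PP (2 ^ s) w := by
  induction w using Nat.strong_induction_on with
  | _ w ih =>
    by_cases hodd : w % 2 = 1
    · exact oddA hw (by omega) s (by omega)
    match s with
    | 0 => omega
    | 1 =>
      have := PP2 (l := w / 3) (by omega) (by omega)
      rwa [show 3 * (w / 3) + 1 = w by omega] at this
    | s + 2 =>
      by_cases h4 : w % 4 = 0
      · have ev2 : 2 ^ (s + 2) % 2 = 0 := by rw [pow_succ]; omega
        have : PP (2 ^ (s + 2)) (w / 4) := by
          by_cases hw4 : w = 4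
          · subst hw4; exact PP.one _
          · exact ih (w / 4) (by omega) (by omega) (by omega) (by omega) (by omega)
        have := this.quad_w ev2 (by positivity) (by omega)
        rwa [show 4 * (w / 4) = w by omega] at this
      · rw [show 2 ^ (s + 2) = 4 * 2 ^ s by ring]
        by_cases h5 : w % 24 = 10
        · have := PP4w (by omega) (XX3 (w / 24)) K8_3 (by omega) s
          rwa [show 2 * (12 * (w / 24) + 5) = w by omega] at this
        · by_cases e1 : w = 46
          · subst e1; exact PP4_46 _ (pow_u s)
          by_cases e2 : w = 70
          · subst e2
            refine PP.comp (w1 := 10) (w2 := 7) ?_ (w10 s) (by norm_num) (by norm_num)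
            have := (oddA (w := 7) (by norm_num) (by norm_num) (s + 3) (by omega)).lift_odd
              (u := 5) (by norm_num)
            rwa [show 5 * 2 ^ (s + 3) = 4 * 2 ^ s * 10 by ring] at this
          have := PP4w (by omega) (XX6 (w / 24) (by omega) (by omega)) K8_6 (by omega) s
          rwa [show 2 * (12 * (w / 24) + 11) = w by omega] at this

theorem W3 (s w : ℕ) (hw : 4 ≤ w) (h3 : w % 3 ≠ 1) (h0 : s = 0 → w % 2 = 1)
    (h1 : s = 1 → w % 4 = 0 ∨ w % 4 = 1) : PP (3 * 2 ^ s) w := by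
  induction w using Nat.strong_induction_on with
  | _ w ih =>
    by_cases hodd : w % 2 = 1
    · exact oddB hw (by omega) s (by omega)
    match s with
    | 0 => omega
    | 1 => exact PP6 hw (h1 rfl)
    | s + 2 =>
      have e12 : 3 * 2 ^ (s + 2) = 12 * 2 ^ s := by ring
      by_cases h4 : w % 4 = 0
      · by_cases hw8 : w = 8
        · subst hw8; rw [e12]; exact PP12_8 _ (pow_u s)
        by_cases hw12 : w = 12
        · subst hw12; rw [e12]; exact PP12_12 _ (pow_u s)
        have := (ih (w / 4) (by omega) (by omega) (by omega) (by omega) (by omega)).quad_w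
          (by rw [e12]; omega) (by positivity) (by omega)
        rwa [show 4 * (w / 4) = w by omega] at this
      · rw [e12]
        by_cases h30 : w % 3 = 0
        · by_cases e1 : w = 6
          · subst e1; exact PP12_6 _ (pow_u s)
          by_cases e2 : w = 18
          · subst e2; exact PP12_18 _ (pow_u s)
          have := PP.comp (g := 12 * 2 ^ s) (w1 := 6) (w2 := w / 6) (by
            have := (oddB (w := w / 6) (by omega) (by omega) (s + 3) (by omega)).lift_odd
              (u := 3) (by norm_num)
            rwa [show 3 * (3 * 2 ^ (s + 3)) = 12 * 2 ^ s * 6 by ring] at this)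
            (PP12_6 _ (pow_u s)) (by norm_num) (by omega)
          rwa [show 6 * (w / 6) = w by omega] at this
        · by_cases h5 : w % 24 = 14
          · by_cases e1 : w = 38
            · subst e1; exact PP12_38 _ (pow_u s)
            have := PP12w (by omega) (by omega) (XX4 (w / 24) (by omega)) K24_4 (by omega) s
            rwa [show 2 * (12 * (w / 24) + 7) = w by omega] at this
          · by_cases e1 : w = 74
            · subst e1; exact PP12_74 _ (pow_u s)
            by_cases e2 : w = 50
            · subst e2
              refine PP.comp (w1 := 10) (w2 := 5) ?_ ?_ (by norm_num) (by norm_num)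
              · have := (oddB (w := 5) (by norm_num) (by norm_num) (s + 3) (by omega)).lift_odd
                  (u := 5) (by norm_num)
                rwa [show 5 * (3 * 2 ^ (s + 3)) = 12 * 2 ^ s * 10 by ring] at this
              · have := (w10 s).lift_odd (u := 3) (by norm_num)
                rwa [show 3 * (4 * 2 ^ s) = 12 * 2 ^ s by ring] at this
            have := PP12w (by omega) (by omega) (XX7 (w / 24 - 1) (by omega) (by omega)) K24_7
              (by omega) s
            rwa [show 2 * (12 * (w / 24 - 1) + 13) = w by omega] at this

theorem PP_all {g w : ℕ} (hg : 0 < g) (hw : 4 ≤ w) (h6 : (g * (w - 1)) % 6 = 0)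
    (h2 : g % 4 = 2 → w % 4 = 0 ∨ w % 4 = 1) : PP g w := by
  obtain ⟨s, u, hu, rfl⟩ := Nat.exists_eq_two_pow_mul_odd hg.ne'
  have hu' : u % 2 = 1 := Nat.odd_iff.1 hu
  have d2 : 2 ∣ 2 ^ s * u * (w - 1) := by omega
  have d3 : 3 ∣ 2 ^ s * u * (w - 1) := by omega
  have h0 : s = 0 → w % 2 = 1 := by
    rintro rfl
    rw [pow_zero, one_mul] at d2
    rcases (Nat.Prime.dvd_mul Nat.prime_two).1 d2 with h | h <;> omega
  have h1 : s = 1 → w % 4 = 0 ∨ w % 4 = 1 := by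
    rintro rfl
    exact h2 (by omega)
  by_cases h3 : w % 3 = 1
  · have := (W1 s w hw h3 h0 h1).lift_odd hu'
    rwa [mul_comm] at this
  · have h3u : 3 ∣ u := by
      rcases (Nat.Prime.dvd_mul Nat.prime_three).1 d3 with h | h
      · rcases (Nat.Prime.dvd_mul Nat.prime_three).1 h with h | h
        · have := Nat.Prime.dvd_of_dvd_pow Nat.prime_three h
          omega
        · exact h
      · omega
    obtain ⟨v, rfl⟩ := h3u
    have := (W3 s w hw h3 h0 h1).lift_odd (u := v) (by omega)
    rwa [show v * (3 * 2 ^ s) = 2 ^ s * (3 * v) by ring] at this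


theorem stmt_12 (m g n : ℕ) (hm : 0 < m) (hg : 0 < g) (hn : 0 < n) (hgn : g ∣ n)
    (h6 : (n - g) % 6 = 0) (h4 : 4 * g ≤ n)
    (h2 : g % 4 = 2 → ¬(n / g % 4 = 2 ∨ n / g % 4 = 3)) :
    ∃ C : Finset (Finset (Fin m × ZMod n)),
      IsGRegOOC 3 g (∅ : Finset (Fin m)) C ∧ C.card = m ^ 2 * (n - g) / 6 := by
  obtain ⟨w, rfl⟩ := hgn
  have hw : 4 ≤ w := by
    by_contra h
    have := Nat.mul_lt_mul_of_pos_left (Nat.lt_of_not_le h) hg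
    rw [mul_comm g 4] at this
    omega
  rw [Nat.mul_div_cancel_left _ hg] at h2
  refine final_of_PP hm hg (by omega) rfl h6 (PP_all hg hw ?_ ?_)
  · rw [Nat.mul_sub, mul_one]; exact h6
  · intro h; have := h2 h; omega
end
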